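/- There exists an absolute constant C > 0 with the following property. Let 0 ≤ s < t₀ and let u be a smooth solution of the defocusing quintic nonlinear wave equation on [s, t₀]×ℝ³ (Schwartz in the space variable at each time) with E(u(t)) ≤ E for all t ∈ [s, t₀]. Suppose ‖u‖_{L²⁷_t L^{162/25}_x([s,t₀]×ℝ³)} ≤ δ, where δ > 0 satisfies C δ³ E^{1/2} ≤ 1. Then ‖u‖_{L^{9/4}_t L^{54}_x([s,t₀]×ℝ³)} ≤ C E^{1/2}, and the Duhamel integral satisfies ‖ D_{[s, t₀]}u ‖_{L⁸_{t,x}([t₀, ∞)×ℝ³)} ≤ C δ³ E. -/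

import Mathlib

open MeasureTheory Real Set Function
open scoped ENNReal NNReal FourierTransform

noncomputable section

/-- Three-dimensional Euclidean space `ℝ³`. -/
abbrev E3 : Type := EuclideanSpace ℝ (Fin 3)

/-- The time derivative `∂ₜ u` of a function `u : ℝ × ℝ³ → ℝ` (curried). -/
def tderiv (u : ℝ → E3 → ℝ) (t : ℝ) (x : E3) : ℝ := deriv (fun s => u s x) t

/-- The second time derivative `∂ₜ² u`. -/
def tderiv2 (u : ℝ → E3 → ℝ) (t : ℝ) (x : E3) : ℝ := deriv (fun s => tderiv u s x) t

/-- The spatial Laplacian `Δ f = ∑ᵢ ∂ᵢ² f` of `f : ℝ³ → ℝ`. -/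
def lap (f : E3 → ℝ) (x : E3) : ℝ :=
  ∑ i : Fin 3, iteratedFDeriv ℝ 2 f x ![EuclideanSpace.single i 1, EuclideanSpace.single i 1]

/-- `f : ℝ³ → ℝ` is a Schwartz function: it is smooth and all of its derivatives decay
faster than any polynomial. -/
def IsSchwartz (f : E3 → ℝ) : Prop :=
  ContDiff ℝ (⊤ : ℕ∞) f ∧ ∀ k n : ℕ, ∃ C : ℝ, ∀ x, ‖x‖ ^ k * ‖iteratedFDeriv ℝ n f x‖ ≤ C

/-- `u` is a smooth solution of the defocusing quintic nonlinear wave equation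
`∂ₜ²u − Δu + u⁵ = 0` on the time interval `I`, Schwartz in the space variable at each time. -/
def IsNLWOn (u : ℝ → E3 → ℝ) (I : Set ℝ) : Prop :=
  ContDiffOn ℝ (⊤ : ℕ∞) (uncurry u) (I ×ˢ univ) ∧
  (∀ t ∈ I, IsSchwartz (u t) ∧ IsSchwartz (tderiv u t)) ∧
  (∀ t ∈ I, ∀ x, tderiv2 u t x - lap (u t) x + (u t x) ^ 5 = 0)

/-- `u` is a smooth global solution of the defocusing quintic nonlinear wave equation. -/
def IsNLW (u : ℝ → E3 → ℝ) : Prop := IsNLWOn u univ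

/-- The energy `E(u(t)) = ∫ (1/2)|∂ₜu|² + (1/2)|∇ₓu|² + (1/6)u⁶ dx`. -/
def energy (u : ℝ → E3 → ℝ) (t : ℝ) : ℝ :=
  ∫ x : E3, ((1/2) * (tderiv u t x) ^ 2 + (1/2) * ‖gradient (u t) x‖ ^ 2 + (1/6) * (u t x) ^ 6)

/-- The spatial `L^q` norm (`q` finite), valued in `ℝ≥0∞`. -/
def xNorm {F : Type*} [NormedAddCommGroup F] (q : ℝ) (f : E3 → F) : ℝ≥0∞ :=
  (∫⁻ x : E3, (‖f x‖₊ : ℝ≥0∞) ^ q) ^ (1/q)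

/-- The mixed norm `‖u‖_{L^p_t L^q_x (I × ℝ³)}` for finite `p, q`. -/
def mixNorm (p q : ℝ) (I : Set ℝ) (u : ℝ → E3 → ℝ) : ℝ≥0∞ :=
  (∫⁻ t in I, (xNorm q (u t)) ^ p) ^ (1/p)

/-- The mixed norm `‖u‖_{L^∞_t L^q_x (I × ℝ³)}` (essential supremum in time). -/
def supNorm (q : ℝ) (I : Set ℝ) (u : ℝ → E3 → ℝ) : ℝ≥0∞ :=
  essSup (fun t => xNorm q (u t)) (volume.restrict I)

/-- The homogeneous Sobolev norm `‖f‖_{Ḣ^s} = (∫ |ξ|^{2s} |𝓕f(ξ)|² dξ)^{1/2}`. -/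
def sobNorm (s : ℝ) (f : E3 → ℝ) : ℝ≥0∞ :=
  (∫⁻ ξ : E3, (‖ξ‖₊ : ℝ≥0∞) ^ (2*s) *
    (‖𝓕 (fun x => (f x : ℂ)) ξ‖₊ : ℝ≥0∞) ^ (2:ℝ)) ^ ((1:ℝ)/2)

/-- The a priori bounds with constant `A`:
`‖u(t)‖_{L²} ≤ A`, `‖∂ₜu(t)‖_{Ḣ⁻¹} ≤ A`, `‖u(t)‖_{Ḣ²} ≤ A`, `‖∂ₜu(t)‖_{Ḣ¹} ≤ A` for all `t`. -/
def APriori (u : ℝ → E3 → ℝ) (A : ℝ) : Prop :=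
  ∀ t : ℝ, xNorm 2 (u t) ≤ ENNReal.ofReal A ∧ sobNorm (-1) (tderiv u t) ≤ ENNReal.ofReal A ∧
    sobNorm 2 (u t) ≤ ENNReal.ofReal A ∧ sobNorm 1 (tderiv u t) ≤ ENNReal.ofReal A

/-- The integral of `f` over the sphere of radius `r` about `x`, with respect to
two-dimensional Hausdorff (surface) measure. -/
def sphInt (x : E3) (r : ℝ) (f : E3 → ℝ) : ℝ := ∫ y in Metric.sphere x r, f y ∂(μH[2])

/-- The free wave evolution `S(t)(g, h)` given by Kirchhoff's formula. -/
def freeWave (g h : E3 → ℝ) (t : ℝ) (x : E3) : ℝ :=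
  if t = 0 then g x
  else deriv (fun s => (1/(4*π*s)) * sphInt x s g) t + (1/(4*π*t)) * sphInt x t h

/-- The Duhamel integral `D_{[s₁,s₂]}u(t,x) = ∫_{s₁}^{s₂} S(t−τ)(0, u(τ)⁵) dτ`,
written via Kirchhoff's formula. -/
def duh (u : ℝ → E3 → ℝ) (s₁ s₂ : ℝ) (t : ℝ) (x : E3) : ℝ :=
  ∫ τ in s₁..s₂, (1/(4*π*(t - τ))) * sphInt x (t - τ) (fun y => (u τ y) ^ 5)

/-- The surface measure on the unit sphere of `ℝ³`. -/
def sphMeas : Measure (Metric.sphere (0 : E3) 1) := (volume : Measure E3).toSphere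

instance : IsFiniteMeasure sphMeas := by unfold sphMeas; infer_instance

lemma finrank_E3 : Module.finrank ℝ E3 = 3 := by simp

lemma sphMeas_univ_pos : 0 < sphMeas univ := by
  rw [pos_iff_ne_zero, Measure.measure_univ_ne_zero]
  exact Measure.toSphere_ne_zero _

lemma lintegral_polar (f : E3 → ℝ≥0∞) (hf : Measurable f) :
    ∫⁻ y, f y = ∫⁻ r in Ioi (0:ℝ), ENNReal.ofReal (r ^ 2) * ∫⁻ ω, f (r • (ω : E3)) ∂sphMeas := by
  have hm : Measurable fun p : Metric.sphere (0 : E3) 1 × Ioi (0:ℝ) => f ((p.2 : ℝ) • (p.1 : E3)) := by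
    fun_prop
  calc ∫⁻ y, f y = ∫⁻ y in ({0}ᶜ : Set E3), f y := by
        rw [restrict_compl_singleton]
    _ = ∫⁻ y : ({0}ᶜ : Set E3), f y ∂(volume.comap Subtype.val) := by
        rw [lintegral_subtype_comap (measurableSet_singleton _).compl]
    _ = ∫⁻ p, f ((p.2 : ℝ) • (p.1 : E3)) ∂(sphMeas.prod (Measure.volumeIoiPow 2)) := by
        have h := (volume : Measure E3).measurePreserving_homeomorphUnitSphereProd
        rw [finrank_E3] at h
        rw [sphMeas, ← h.lintegral_comp hm]
        refine lintegral_congr fun y => ?_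
        have hy : ‖(y : E3)‖ ≠ 0 := norm_ne_zero_iff.2 y.2
        simp [smul_smul, hy]
    _ = ∫⁻ r, ∫⁻ ω, f ((r : ℝ) • (ω : E3)) ∂sphMeas ∂(Measure.volumeIoiPow 2) := by
        rw [lintegral_prod_symm _ hm.aemeasurable]
    _ = _ := by
        rw [Measure.volumeIoiPow, lintegral_withDensity_eq_lintegral_mul _ (by fun_prop)
          (Measurable.lintegral_prod_left' hm)]
        rw [← lintegral_subtype_comap measurableSet_Ioi]
        rfl

lemma lintegral_polar_norm (f : ℝ → ℝ≥0∞) (hf : Measurable f) :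
    ∫⁻ y : E3, f ‖y‖ = sphMeas univ * ∫⁻ r in Ioi (0:ℝ), ENNReal.ofReal (r ^ 2) * f r := by
  rw [lintegral_polar _ (by fun_prop), ← lintegral_const_mul _ (by fun_prop)]
  refine setLIntegral_congr_fun measurableSet_Ioi fun r hr => ?_
  have : ∀ ω : Metric.sphere (0 : E3) 1, f ‖r • (ω : E3)‖ = f r := by
    intro ω
    rw [norm_smul, norm_eq_of_mem_sphere, mul_one, Real.norm_of_nonneg (le_of_lt hr)]
  simp only [this, lintegral_const]
  ring

lemma integral_polar (f : E3 → ℝ) (hf : Integrable f) :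
    ∫ y, f y = ∫ r in Ioi (0:ℝ), r ^ 2 * ∫ ω, f (r • (ω : E3)) ∂sphMeas := by
  have h := (volume : Measure E3).measurePreserving_homeomorphUnitSphereProd
  rw [finrank_E3] at h
  have hg : ∀ y : ({0}ᶜ : Set E3), f (((homeomorphUnitSphereProd E3 y).2 : ℝ) •
      ((homeomorphUnitSphereProd E3 y).1 : E3)) = f y := by
    intro y
    have hy : ‖(y : E3)‖ ≠ 0 := norm_ne_zero_iff.2 y.2
    simp [smul_smul, hy]
  have hi : Integrable (fun p : Metric.sphere (0 : E3) 1 × Ioi (0:ℝ) => f ((p.2 : ℝ) • (p.1 : E3)))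
      (sphMeas.prod (Measure.volumeIoiPow 2)) := by
    rw [sphMeas, ← h.integrable_comp_emb (Homeomorph.measurableEmbedding _)]
    have : Integrable (fun y : ({0}ᶜ : Set E3) => f y) (volume.comap Subtype.val) := by
      rw [← comp_def f, ← integrableOn_iff_comap_subtypeVal (measurableSet_singleton _).compl]
      exact hf.integrableOn
    refine this.congr (Filter.Eventually.of_forall fun y => (hg y).symm)
  calc ∫ y, f y = ∫ y in ({0}ᶜ : Set E3), f y := by
        rw [restrict_compl_singleton]
    _ = ∫ y : ({0}ᶜ : Set E3), f y ∂(volume.comap Subtype.val) := by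
        rw [integral_subtype_comap (measurableSet_singleton _).compl]
    _ = ∫ p, f ((p.2 : ℝ) • (p.1 : E3)) ∂(sphMeas.prod (Measure.volumeIoiPow 2)) := by
        rw [sphMeas, ← h.integral_comp (Homeomorph.measurableEmbedding _)]
        exact integral_congr_ae (Filter.Eventually.of_forall fun y => (hg y).symm)
    _ = ∫ r, ∫ ω, f ((r : ℝ) • (ω : E3)) ∂sphMeas ∂(Measure.volumeIoiPow 2) := by
        rw [integral_prod_symm _ hi]
    _ = _ := by
        simp only [Measure.volumeIoiPow, ENNReal.ofReal]
        rw [integral_withDensity_eq_integral_smul (by fun_prop),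
          integral_subtype_comap measurableSet_Ioi
            fun r : ℝ => Real.toNNReal (r ^ 2) • ∫ ω, f (r • (ω : E3)) ∂sphMeas]
        refine setIntegral_congr_fun measurableSet_Ioi fun r hr => ?_
        simp only [NNReal.smul_def, Real.coe_toNNReal _ (sq_nonneg r), smul_eq_mul]

lemma lintegral_radial_plane (h : ℝ → ℝ≥0∞) (hh : Measurable h) :
    ∫⁻ p : ℝ × ℝ, h (p.1 ^ 2 + p.2 ^ 2) =
      ENNReal.ofReal (2 * π) * ∫⁻ r in Ioi (0:ℝ), ENNReal.ofReal r * h (r ^ 2) := by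
  rw [← lintegral_comp_polarCoord_symm]
  have h1 : ∀ p : ℝ × ℝ, ENNReal.ofReal p.1 • h ((polarCoord.symm p).1 ^ 2 +
      (polarCoord.symm p).2 ^ 2) = ENNReal.ofReal p.1 * h (p.1 ^ 2) := by
    intro p
    have : (polarCoord.symm p).1 ^ 2 + (polarCoord.symm p).2 ^ 2 = p.1 ^ 2 := by
      simp only [polarCoord_symm_apply]
      nlinarith [Real.sin_sq_add_cos_sq p.2]
    rw [this, smul_eq_mul]
  simp only [h1]
  rw [polarCoord_target, Measure.volume_eq_prod, ← Measure.prod_restrict,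
    lintegral_prod _ (by fun_prop)]
  simp only [lintegral_const, Measure.restrict_apply_univ, Real.volume_Ioo]
  rw [lintegral_mul_const _ (by fun_prop), mul_comm]
  congr 2
  ring

lemma lintegral_cylinder (f : ℝ → ℝ → ℝ≥0∞) (hf : Measurable (uncurry f)) :
    ∫⁻ x : E3, f (x 0) ((x 1) ^ 2 + (x 2) ^ 2) =
      ENNReal.ofReal (2 * π) * ∫⁻ z, ∫⁻ r in Ioi (0:ℝ), ENNReal.ofReal r * f z (r ^ 2) := by
  have hf' : ∀ z, Measurable (f z) := fun z => hf.comp (measurable_const.prodMk measurable_id)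
  have e1 : ∫⁻ x : E3, f (x 0) ((x 1) ^ 2 + (x 2) ^ 2) =
      ∫⁻ y : Fin 3 → ℝ, f (y 0) ((y 1) ^ 2 + (y 2) ^ 2) := by
    rw [← (PiLp.volume_preserving_ofLp (Fin 3)).lintegral_comp]
    exact hf.comp (by fun_prop : Measurable fun y : Fin 3 → ℝ => (y 0, (y 1) ^ 2 + (y 2) ^ 2))
  have e2 : ∫⁻ y : Fin 3 → ℝ, f (y 0) ((y 1) ^ 2 + (y 2) ^ 2) =
      ∫⁻ p : ℝ × (Fin 2 → ℝ), f p.1 ((p.2 0) ^ 2 + (p.2 1) ^ 2) := by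
    rw [← (volume_preserving_piFinSuccAbove (fun _ : Fin 3 => ℝ) 0).lintegral_comp]
    · rfl
    · exact hf.comp (by fun_prop : Measurable fun p : ℝ × (Fin 2 → ℝ) =>
        (p.1, (p.2 0) ^ 2 + (p.2 1) ^ 2))
  have hm : Measurable fun p : ℝ × (Fin 2 → ℝ) => f p.1 ((p.2 0) ^ 2 + (p.2 1) ^ 2) :=
    hf.comp (by fun_prop : Measurable fun p : ℝ × (Fin 2 → ℝ) => (p.1, (p.2 0) ^ 2 + (p.2 1) ^ 2))
  rw [e1, e2, Measure.volume_eq_prod, lintegral_prod _ hm.aemeasurable, ← lintegral_const_mul]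
  · refine lintegral_congr fun z => ?_
    rw [← lintegral_radial_plane (f z) (hf' z)]
    rw [← (volume_preserving_finTwoArrow ℝ).lintegral_comp]
    · rfl
    · exact (hf' z).comp (by fun_prop)
  · refine Measurable.lintegral_prod_right' (f := fun p : ℝ × ℝ =>
      ENNReal.ofReal p.2 * f p.1 (p.2 ^ 2)) ?_
    exact (by fun_prop : Measurable fun p : ℝ × ℝ => ENNReal.ofReal p.2).mul
      (hf.comp (by fun_prop : Measurable fun p : ℝ × ℝ => (p.1, p.2 ^ 2)))

lemma lintegral_sqrt_subst_le (z : ℝ) (h : ℝ → ℝ≥0∞) :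
    ∫⁻ r in Ioi (0:ℝ), ENNReal.ofReal r * h (√(z ^ 2 + r ^ 2)) ≤
      ∫⁻ t in Ioi |z|, ENNReal.ofReal t * h t := by
  have hpos : ∀ r ∈ Ioi (0:ℝ), 0 < z ^ 2 + r ^ 2 := fun r hr => by
    have : 0 < r := hr
    positivity
  have hd : ∀ r ∈ Ioi (0:ℝ), HasDerivWithinAt (fun r => √(z ^ 2 + r ^ 2))
      (r / √(z ^ 2 + r ^ 2)) (Ioi 0) r := by
    intro r hr
    have h1 : HasDerivAt (fun r : ℝ => z ^ 2 + r ^ 2) (2 * r) r := by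
      simpa using (hasDerivAt_pow 2 r).const_add (z ^ 2)
    have := (h1.sqrt (hpos r hr).ne').hasDerivWithinAt (s := Ioi 0)
    rwa [mul_div_mul_left _ _ two_ne_zero] at this
  have hinj : InjOn (fun r => √(z ^ 2 + r ^ 2)) (Ioi 0) := by
    intro a ha b hb hab
    have h1 := (Real.sqrt_inj (hpos a ha).le (hpos b hb).le).1 hab
    exact (pow_left_inj₀ (le_of_lt ha) (le_of_lt hb) two_ne_zero).1 (by linarith)
  calc ∫⁻ r in Ioi (0:ℝ), ENNReal.ofReal r * h (√(z ^ 2 + r ^ 2))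
      = ∫⁻ r in Ioi (0:ℝ), ENNReal.ofReal |r / √(z ^ 2 + r ^ 2)| *
          (ENNReal.ofReal √(z ^ 2 + r ^ 2) * h (√(z ^ 2 + r ^ 2))) := by
        refine setLIntegral_congr_fun measurableSet_Ioi fun r hr => ?_
        have h0 : 0 < √(z ^ 2 + r ^ 2) := Real.sqrt_pos.2 (hpos r hr)
        have hr' : 0 < r := hr
        rw [← mul_assoc, ← ENNReal.ofReal_mul (abs_nonneg _), abs_of_pos (by positivity),
          div_mul_cancel₀ _ h0.ne']
    _ = ∫⁻ t in (fun r => √(z ^ 2 + r ^ 2)) '' Ioi 0, ENNReal.ofReal t * h t :=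
        (lintegral_image_eq_lintegral_abs_deriv_mul measurableSet_Ioi hd hinj
          (fun t => ENNReal.ofReal t * h t)).symm
    _ ≤ _ := by
        refine lintegral_mono_set ?_
        rintro _ ⟨r, hr, rfl⟩
        refine Real.lt_sqrt_of_sq_lt ?_
        rw [sq_abs]
        have : 0 < r := hr
        nlinarith

lemma lintegral_cos_subst_le {t d : ℝ} (ht : 0 < t) (hd : 0 < d) (h : ℝ → ℝ≥0∞) :
    ∫⁻ z in Ioo (-t) t, h (√(t ^ 2 + d ^ 2 - 2 * z * d)) ≤
      ENNReal.ofReal (1 / d) * ∫⁻ t' in Ioi (0:ℝ) ∩ {t' | |t - t'| ≤ d}, ENNReal.ofReal t' * h t' := by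
  have hpos : ∀ z ∈ Ioo (-t) t, 0 < t ^ 2 + d ^ 2 - 2 * z * d := fun z hz => by
    nlinarith [hz.1, hz.2, sq_nonneg (t - d), mul_pos ht hd, mul_lt_mul_of_pos_right hz.2 hd]
  have hder : ∀ z ∈ Ioo (-t) t, HasDerivWithinAt (fun z => √(t ^ 2 + d ^ 2 - 2 * z * d))
      (-d / √(t ^ 2 + d ^ 2 - 2 * z * d)) (Ioo (-t) t) z := by
    intro z hz
    have h1 : HasDerivAt (fun z : ℝ => t ^ 2 + d ^ 2 - 2 * z * d) (-(2 * d)) z := by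
      simpa using (((hasDerivAt_id z).const_mul 2).mul_const d).const_sub (t ^ 2 + d ^ 2)
    have := (h1.sqrt (hpos z hz).ne').hasDerivWithinAt (s := Ioo (-t) t)
    rwa [← mul_neg, mul_div_mul_left _ _ two_ne_zero] at this
  have hinj : InjOn (fun z => √(t ^ 2 + d ^ 2 - 2 * z * d)) (Ioo (-t) t) := by
    intro a ha b hb hab
    have h1 := (Real.sqrt_inj (hpos a ha).le (hpos b hb).le).1 hab
    have : a * d = b * d := by linarith
    exact mul_right_cancel₀ hd.ne' this
  have hms : MeasurableSet (Ioi (0:ℝ) ∩ {t' | |t - t'| ≤ d}) :=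
    measurableSet_Ioi.inter (measurableSet_le (by fun_prop) (by fun_prop))
  calc ∫⁻ z in Ioo (-t) t, h (√(t ^ 2 + d ^ 2 - 2 * z * d))
      = ∫⁻ z in Ioo (-t) t, ENNReal.ofReal |-d / √(t ^ 2 + d ^ 2 - 2 * z * d)| *
          (ENNReal.ofReal (1 / d) * (ENNReal.ofReal √(t ^ 2 + d ^ 2 - 2 * z * d) *
            h (√(t ^ 2 + d ^ 2 - 2 * z * d)))) := by
        refine setLIntegral_congr_fun measurableSet_Ioo fun z hz => ?_
        have h0 : 0 < √(t ^ 2 + d ^ 2 - 2 * z * d) := Real.sqrt_pos.2 (hpos z hz)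
        rw [← mul_assoc, ← mul_assoc, ← ENNReal.ofReal_mul (abs_nonneg _),
          ← ENNReal.ofReal_mul (by positivity), abs_div, abs_neg, abs_of_pos hd, abs_of_pos h0]
        have : d / √(t ^ 2 + d ^ 2 - 2 * z * d) * (1 / d) * √(t ^ 2 + d ^ 2 - 2 * z * d) = 1 := by
          generalize √(t ^ 2 + d ^ 2 - 2 * z * d) = q at h0 ⊢
          field_simp
        rw [this]; simp
    _ = ∫⁻ t' in (fun z => √(t ^ 2 + d ^ 2 - 2 * z * d)) '' Ioo (-t) t,
          ENNReal.ofReal (1 / d) * (ENNReal.ofReal t' * h t') :=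
        (lintegral_image_eq_lintegral_abs_deriv_mul measurableSet_Ioo hder hinj
          (fun t' => ENNReal.ofReal (1 / d) * (ENNReal.ofReal t' * h t'))).symm
    _ ≤ ∫⁻ t' in Ioi (0:ℝ) ∩ {t' | |t - t'| ≤ d},
          ENNReal.ofReal (1 / d) * (ENNReal.ofReal t' * h t') := by
        refine lintegral_mono_set ?_
        rintro _ ⟨z, hz, rfl⟩
        have h0 : 0 < √(t ^ 2 + d ^ 2 - 2 * z * d) := Real.sqrt_pos.2 (hpos z hz)
        refine ⟨h0, ?_⟩
        have hzd := mul_lt_mul_of_pos_right hz.2 hd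
        have hzd' := mul_lt_mul_of_pos_right hz.1 hd
        have hs := Real.sq_sqrt (hpos z hz).le
        rw [mem_ofPred_eq]
        rw [abs_le]
        constructor
        · have : √(t ^ 2 + d ^ 2 - 2 * z * d) ≤ t + d := by
            refine Real.sqrt_le_iff.2 ⟨by positivity, by nlinarith⟩
          linarith
        · have : t - d ≤ √(t ^ 2 + d ^ 2 - 2 * z * d) := Real.le_sqrt_of_sq_le (by nlinarith)
          linarith
    _ = _ := lintegral_const_mul' _ _ ENNReal.ofReal_ne_top

lemma norm_E3 (x : E3) : ‖x‖ = √((x 0) ^ 2 + ((x 1) ^ 2 + (x 2) ^ 2)) := by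
  rw [EuclideanSpace.norm_eq, Fin.sum_univ_three]
  simp [add_assoc]

lemma lintegral_bipolar_axis {d : ℝ} (hd : 0 < d) (F : ℝ → ℝ → ℝ≥0∞) (hF : Measurable (uncurry F)) :
    ∫⁻ x : E3, F ‖x‖ ‖x - EuclideanSpace.single 0 d‖ ≤
      ENNReal.ofReal (2 * π / d) * ∫⁻ t in Ioi (0:ℝ), ∫⁻ t' in Ioi (0:ℝ) ∩ {t' | |t - t'| ≤ d},
        ENNReal.ofReal t * (ENNReal.ofReal t' * F t t') := by
  have e1 : ∀ x : E3, F ‖x‖ ‖x - EuclideanSpace.single 0 d‖ =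
      F (√((x 0) ^ 2 + ((x 1) ^ 2 + (x 2) ^ 2)))
        (√((x 0 - d) ^ 2 + ((x 1) ^ 2 + (x 2) ^ 2))) := by
    intro x
    rw [norm_E3 x, norm_E3 (x - _)]
    simp
  have hm1 : Measurable (uncurry fun z p : ℝ => F (√(z ^ 2 + p)) (√((z - d) ^ 2 + p))) :=
    hF.comp (by fun_prop : Measurable fun q : ℝ × ℝ =>
      (√(q.1 ^ 2 + q.2), √((q.1 - d) ^ 2 + q.2)))
  have hm2 : Measurable (fun q : ℝ × ℝ => ENNReal.ofReal q.2 *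
      F q.2 (√(q.2 ^ 2 + d ^ 2 - 2 * q.1 * d))) :=
    (by fun_prop : Measurable fun q : ℝ × ℝ => ENNReal.ofReal q.2).mul
    (hF.comp (by fun_prop : Measurable fun q : ℝ × ℝ => (q.2, √(q.2 ^ 2 + d ^ 2 - 2 * q.1 * d))))
  calc ∫⁻ x : E3, F ‖x‖ ‖x - EuclideanSpace.single 0 d‖
      = ENNReal.ofReal (2 * π) * ∫⁻ z, ∫⁻ r in Ioi (0:ℝ), ENNReal.ofReal r *
          F (√(z ^ 2 + r ^ 2)) (√((z - d) ^ 2 + r ^ 2)) := by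
        simp only [e1]
        exact lintegral_cylinder (fun z p => F (√(z ^ 2 + p)) (√((z - d) ^ 2 + p))) hm1
    _ ≤ ENNReal.ofReal (2 * π) * ∫⁻ z, ∫⁻ t in Ioi |z|, ENNReal.ofReal t *
          F t (√(t ^ 2 + d ^ 2 - 2 * z * d)) := by
        refine mul_le_mul_right (lintegral_mono fun z => ?_) _
        refine le_trans (le_of_eq ?_) (lintegral_sqrt_subst_le z
          (fun t => F t (√(t ^ 2 + d ^ 2 - 2 * z * d))))
        refine lintegral_congr fun r => ?_
        rw [Real.sq_sqrt (by positivity)]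
        congr 3
        ring
    _ = ENNReal.ofReal (2 * π) * ∫⁻ t in Ioi (0:ℝ), ∫⁻ z in Ioo (-t) t, ENNReal.ofReal t *
          F t (√(t ^ 2 + d ^ 2 - 2 * z * d)) := by
        congr 1
        have hS : MeasurableSet {q : ℝ × ℝ | |q.1| < q.2} :=
          measurableSet_lt (by fun_prop) (by fun_prop)
        have hS' : ∀ z t : ℝ, {q : ℝ × ℝ | |q.1| < q.2}.indicator (fun q => ENNReal.ofReal q.2 *
            F q.2 (√(q.2 ^ 2 + d ^ 2 - 2 * q.1 * d))) (z, t) = (Ioi |z|).indicator (fun t =>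
            ENNReal.ofReal t * F t (√(t ^ 2 + d ^ 2 - 2 * z * d))) t := by
          intro z t
          simp [indicator]
        have hS'' : ∀ z t : ℝ, {q : ℝ × ℝ | |q.1| < q.2}.indicator (fun q => ENNReal.ofReal q.2 *
            F q.2 (√(q.2 ^ 2 + d ^ 2 - 2 * q.1 * d))) (z, t) = (Ioo (-t) t).indicator (fun z =>
            ENNReal.ofReal t * F t (√(t ^ 2 + d ^ 2 - 2 * z * d))) z := by
          intro z t
          simp [indicator, abs_lt]
        calc _ = ∫⁻ z, ∫⁻ t, {q : ℝ × ℝ | |q.1| < q.2}.indicator (fun q => ENNReal.ofReal q.2 *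
            F q.2 (√(q.2 ^ 2 + d ^ 2 - 2 * q.1 * d))) (z, t) := by
              simp only [hS', lintegral_indicator measurableSet_Ioi]
          _ = ∫⁻ t, ∫⁻ z, {q : ℝ × ℝ | |q.1| < q.2}.indicator (fun q => ENNReal.ofReal q.2 *
            F q.2 (√(q.2 ^ 2 + d ^ 2 - 2 * q.1 * d))) (z, t) :=
              lintegral_lintegral_swap (hm2.indicator hS).aemeasurable
          _ = ∫⁻ t, ∫⁻ z in Ioo (-t) t, ENNReal.ofReal t *
              F t (√(t ^ 2 + d ^ 2 - 2 * z * d)) := by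
              simp only [hS'', lintegral_indicator measurableSet_Ioo]
          _ = _ := by
              rw [← lintegral_indicator measurableSet_Ioi]
              refine lintegral_congr fun t => ?_
              by_cases ht : 0 < t
              · simp [ht]
              · simp [ht]
    _ ≤ ENNReal.ofReal (2 * π) * ∫⁻ t in Ioi (0:ℝ), ENNReal.ofReal (1 / d) *
          ∫⁻ t' in Ioi (0:ℝ) ∩ {t' | |t - t'| ≤ d},
            ENNReal.ofReal t * (ENNReal.ofReal t' * F t t') := by
        refine mul_le_mul_right (setLIntegral_mono' measurableSet_Ioi fun t ht => ?_) _
        rw [lintegral_const_mul' _ _ ENNReal.ofReal_ne_top,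
          lintegral_const_mul' _ _ ENNReal.ofReal_ne_top, mul_left_comm]
        exact mul_le_mul_right (lintegral_cos_subst_le ht hd (F t)) _
    _ = _ := by
        rw [lintegral_const_mul' _ _ ENNReal.ofReal_ne_top, ← mul_assoc,
          ← ENNReal.ofReal_mul (by positivity)]
        congr 2
        ring

/-- Integration in bipolar coordinates, as an upper bound. -/
lemma lintegral_bipolar_le {a b : E3} (hab : a ≠ b) (F : ℝ → ℝ → ℝ≥0∞)
    (hF : Measurable (uncurry F)) :
    ∫⁻ x : E3, F ‖x - a‖ ‖x - b‖ ≤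
      ENNReal.ofReal (2 * π / ‖a - b‖) *
        ∫⁻ t in Ioi (0:ℝ), ∫⁻ t' in Ioi (0:ℝ) ∩ {t' | |t - t'| ≤ ‖a - b‖},
        ENNReal.ofReal t * (ENNReal.ofReal t' * F t t') := by
  set d := ‖a - b‖ with hd
  have hdpos : 0 < d := norm_pos_iff.2 (sub_ne_zero.2 hab)
  set v : E3 := EuclideanSpace.single 0 d
  have hv : ‖v‖ = ‖b - a‖ := by
    rw [norm_sub_rev, ← hd]
    simp [v, abs_of_pos hdpos]
  have hR := Submodule.reflection_sub hv
  set R := Submodule.reflection (ℝ ∙ (v - (b - a)))ᗮ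
  have hm : Measurable fun x : E3 => F ‖x - a‖ ‖x - b‖ :=
    hF.comp (by fun_prop : Measurable fun x : E3 => (‖x - a‖, ‖x - b‖))
  have hm' : Measurable fun x : E3 => F ‖x + a - a‖ ‖x + a - b‖ := hm.comp (measurable_add_const a)
  have e : ∫⁻ x : E3, F ‖x - a‖ ‖x - b‖ = ∫⁻ x : E3, F ‖x‖ ‖x - v‖ := by
    rw [← lintegral_add_right_eq_self _ a, ← (R.measurePreserving).lintegral_comp hm']
    refine lintegral_congr fun y => ?_
    have h1 : ‖R y + a - a‖ = ‖y‖ := by simp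
    have h2 : R y + a - b = R (y - v) := by rw [map_sub, hR]; abel
    rw [h1, h2, R.norm_map]
  rw [e]
  exact lintegral_bipolar_axis hdpos F hF

/-- The spherical mean operator `t ∫_{S²} f(x + tω) dω`, on nonnegative functions. -/
def sphMean (f : E3 → ℝ≥0∞) (t : ℝ) (x : E3) : ℝ≥0∞ :=
  ENNReal.ofReal t * ∫⁻ ω, f (x + t • (ω : E3)) ∂sphMeas

/-- The formal adjoint of `sphMean`. -/
def sphMeanAdj (G : ℝ → E3 → ℝ≥0∞) (x : E3) : ℝ≥0∞ :=
  ∫⁻ a, ENNReal.ofReal (1 / ‖x - a‖) * G ‖x - a‖ a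

/-- The kernel of the composition of `sphMean` with its adjoint. -/
def bipolarKernel (d r : ℝ) : ℝ≥0∞ := (Ici d).indicator (fun r => ENNReal.ofReal (2 * π / r)) r

lemma measurable_sphMean {f : E3 → ℝ≥0∞} (hf : Measurable f) :
    Measurable fun p : ℝ × E3 => sphMean f p.1 p.2 := by
  unfold sphMean
  refine Measurable.mul (by fun_prop) ?_
  have hm : Measurable fun q : (ℝ × E3) × Metric.sphere (0 : E3) 1 =>
      f (q.1.2 + q.1.1 • (q.2 : E3)) := by fun_prop
  exact hm.lintegral_prod_right'

lemma measurable_bipolarKernel : Measurable fun p : ℝ × ℝ => bipolarKernel p.1 p.2 := by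
  have : (fun p : ℝ × ℝ => bipolarKernel p.1 p.2) =
      indicator {p : ℝ × ℝ | p.1 ≤ p.2} fun p => ENNReal.ofReal (2 * π / p.2) := by
    ext p; simp [bipolarKernel, indicator]
  rw [this]
  exact Measurable.indicator (by fun_prop) (measurableSet_le (by fun_prop) (by fun_prop))

lemma lintegral_sphMean_mul {f : E3 → ℝ≥0∞} (hf : Measurable f) {G : ℝ → E3 → ℝ≥0∞}
    (hG : Measurable (uncurry G)) :
    ∫⁻ t in Ioi (0:ℝ), ∫⁻ x, sphMean f t x * G t x = ∫⁻ y, f y * sphMeanAdj G y := by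
  have hG' : ∀ {α : Type} [MeasurableSpace α] {a : α → ℝ} {b : α → E3}, Measurable a →
      Measurable b → Measurable fun z => G (a z) (b z) := fun ha hb => hG.comp (ha.prodMk hb)
  have e1 : ∀ t ∈ Ioi (0:ℝ), ∫⁻ x, sphMean f t x * G t x =
      ∫⁻ y, f y * (ENNReal.ofReal (t ^ 2) * ∫⁻ ω, ENNReal.ofReal (1 / t) *
        G t (y - t • (ω : E3)) ∂sphMeas) := by
    intro t ht
    have ht0 : (0:ℝ) < t := ht
    have m1 : Measurable fun q : E3 × Metric.sphere (0 : E3) 1 =>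
        ENNReal.ofReal t * (f (q.1 + t • (q.2 : E3)) * G t q.1) := by
      have := hG' (α := E3 × Metric.sphere (0 : E3) 1) (a := fun _ => t) (b := fun q => q.1)
        (by fun_prop) (by fun_prop)
      fun_prop
    have m2 : Measurable fun q : E3 × Metric.sphere (0 : E3) 1 =>
        ENNReal.ofReal t * (f q.1 * G t (q.1 - t • (q.2 : E3))) := by
      have := hG' (α := E3 × Metric.sphere (0 : E3) 1) (a := fun _ => t)
        (b := fun q => q.1 - t • (q.2 : E3)) (by fun_prop) (by fun_prop)
      fun_prop
    calc ∫⁻ x, sphMean f t x * G t x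
        = ∫⁻ x, ∫⁻ ω, ENNReal.ofReal t * (f (x + t • (ω : E3)) * G t x) ∂sphMeas := by
          refine lintegral_congr fun x => ?_
          rw [lintegral_const_mul _ (by fun_prop), lintegral_mul_const _ (by fun_prop), sphMean]
          ring
      _ = ∫⁻ ω, ∫⁻ x, ENNReal.ofReal t * (f (x + t • (ω : E3)) * G t x) ∂volume ∂sphMeas :=
          lintegral_lintegral_swap m1.aemeasurable
      _ = ∫⁻ ω, ∫⁻ y, ENNReal.ofReal t * (f y * G t (y - t • (ω : E3))) ∂volume ∂sphMeas := by
          refine lintegral_congr fun ω => ?_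
          have := lintegral_add_right_eq_self (μ := (volume : Measure E3))
            (fun y => ENNReal.ofReal t * (f y * G t (y - t • (ω : E3)))) (t • (ω : E3))
          simpa using this
      _ = ∫⁻ y, ∫⁻ ω, ENNReal.ofReal t * (f y * G t (y - t • (ω : E3))) ∂sphMeas := by
          rw [← lintegral_lintegral_swap]; exact m2.aemeasurable
      _ = _ := by
          refine lintegral_congr fun y => ?_
          have m3 : Measurable fun ω : Metric.sphere (0 : E3) 1 => G t (y - t • (ω : E3)) :=
            hG' (by fun_prop) (by fun_prop)
          rw [lintegral_const_mul _ (by fun_prop), lintegral_const_mul _ (by fun_prop),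
            lintegral_const_mul _ (by fun_prop), ← mul_assoc (ENNReal.ofReal (t ^ 2)),
            ← ENNReal.ofReal_mul (by positivity)]
          have : t ^ 2 * (1 / t) = t := by field_simp
          rw [this]; ring
  rw [setLIntegral_congr_fun measurableSet_Ioi e1]
  have m4 : Measurable fun q : (ℝ × E3) × Metric.sphere (0 : E3) 1 =>
      ENNReal.ofReal (1 / q.1.1) * G q.1.1 (q.1.2 - q.1.1 • (q.2 : E3)) := by
    have := hG' (α := (ℝ × E3) × Metric.sphere (0 : E3) 1) (a := fun q => q.1.1)
      (b := fun q => q.1.2 - q.1.1 • (q.2 : E3)) (by fun_prop) (by fun_prop)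
    fun_prop
  have m5 : Measurable fun q : ℝ × E3 => ∫⁻ ω, ENNReal.ofReal (1 / q.1) *
      G q.1 (q.2 - q.1 • (ω : E3)) ∂sphMeas := m4.lintegral_prod_right'
  rw [lintegral_lintegral_swap]
  swap
  · have : Measurable fun q : ℝ × E3 => f q.2 * (ENNReal.ofReal (q.1 ^ 2) * ∫⁻ ω,
      ENNReal.ofReal (1 / q.1) * G q.1 (q.2 - q.1 • (ω : E3)) ∂sphMeas) := by fun_prop
    exact this.aemeasurable
  refine lintegral_congr fun y => ?_
  have m6 : Measurable fun r : ℝ => ∫⁻ ω, ENNReal.ofReal (1 / r) *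
      G r (y - r • (ω : E3)) ∂sphMeas := m5.comp (measurable_id.prodMk measurable_const)
  rw [lintegral_const_mul _ (by fun_prop)]
  congr 1
  rw [sphMeanAdj, ← lintegral_sub_left_eq_self _ y]
  simp only [sub_sub_cancel]
  rw [lintegral_polar]
  · refine setLIntegral_congr_fun measurableSet_Ioi fun r hr => ?_
    have hr0 : (0:ℝ) < r := hr
    simp only [norm_smul, norm_eq_of_mem_sphere, mul_one, Real.norm_of_nonneg hr0.le]
  · have := hG' (α := E3) (a := fun z => ‖z‖) (b := fun z => y - z) (by fun_prop) (by fun_prop)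
    fun_prop

lemma lintegral_swap_pairs {α β : Type*} [MeasurableSpace α] [MeasurableSpace β] (μ : Measure α)
    (ν : Measure β) [SFinite μ] [SFinite ν] (F : α → α → β → β → ℝ≥0∞)
    (hF : Measurable fun q : ((α × α) × β) × β => F q.1.1.1 q.1.1.2 q.1.2 q.2) :
    ∫⁻ a, ∫⁻ b, ∫⁻ t, ∫⁻ t', F a b t t' ∂ν ∂ν ∂μ ∂μ =
      ∫⁻ t, ∫⁻ t', ∫⁻ a, ∫⁻ b, F a b t t' ∂μ ∂μ ∂ν ∂ν := by
  have m1 : Measurable fun q : (α × α) × β => ∫⁻ t', F q.1.1 q.1.2 q.2 t' ∂ν :=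
    hF.lintegral_prod_right'
  have m2 : Measurable fun q : (α × β) × α => ∫⁻ t', F q.1.1 q.2 q.1.2 t' ∂ν :=
    m1.comp (f := fun q : (α × β) × α => ((q.1.1, q.2), q.1.2)) (by fun_prop)
  have m3 : Measurable fun q : ((α × β) × β) × α => F q.1.1.1 q.2 q.1.1.2 q.1.2 :=
    hF.comp (f := fun q : ((α × β) × β) × α => (((q.1.1.1, q.2), q.1.1.2), q.1.2)) (by fun_prop)
  have m4 : Measurable fun q : (α × β) × β => ∫⁻ b, F q.1.1 b q.1.2 q.2 ∂μ :=
    m3.lintegral_prod_right'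
  calc _ = ∫⁻ a, ∫⁻ t, ∫⁻ b, ∫⁻ t', F a b t t' ∂ν ∂μ ∂ν ∂μ := by
        refine lintegral_congr fun a => lintegral_lintegral_swap ?_
        exact (m1.comp (f := fun q : α × β => ((a, q.1), q.2)) (by fun_prop)).aemeasurable
    _ = ∫⁻ t, ∫⁻ a, ∫⁻ b, ∫⁻ t', F a b t t' ∂ν ∂μ ∂μ ∂ν :=
        lintegral_lintegral_swap m2.lintegral_prod_right'.aemeasurable
    _ = ∫⁻ t, ∫⁻ a, ∫⁻ t', ∫⁻ b, F a b t t' ∂μ ∂ν ∂μ ∂ν := by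
        refine lintegral_congr fun t => lintegral_congr fun a => lintegral_lintegral_swap ?_
        exact (hF.comp (f := fun q : α × β => (((a, q.1), t), q.2)) (by fun_prop)).aemeasurable
    _ = _ := by
        refine lintegral_congr fun t => lintegral_lintegral_swap ?_
        exact (m4.comp (f := fun q : α × β => ((q.1, t), q.2)) (by fun_prop)).aemeasurable

lemma lintegral_adj_kernel_mul_le {G : ℝ → E3 → ℝ≥0∞} (hG : Measurable (uncurry G)) {a b : E3}
    (hb : b ≠ a) :
    ∫⁻ x, ENNReal.ofReal (1 / ‖x - a‖) * G ‖x - a‖ a *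
      (ENNReal.ofReal (1 / ‖x - b‖) * G ‖x - b‖ b) ≤
    ∫⁻ t in Ioi (0:ℝ), ∫⁻ t' in Ioi (0:ℝ),
      G t a * (bipolarKernel |t - t'| ‖a - b‖ * G t' b) := by
  have hG' : ∀ {α : Type} [MeasurableSpace α] {a : α → ℝ} {b : α → E3}, Measurable a →
      Measurable b → Measurable fun z => G (a z) (b z) := fun ha hb => hG.comp (ha.prodMk hb)
  refine (lintegral_bipolar_le (Ne.symm hb) (fun t t' => ENNReal.ofReal (1 / t) * G t a *
    (ENNReal.ofReal (1 / t') * G t' b)) ?_).trans ?_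
  · have h1 := hG' (α := ℝ × ℝ) (a := fun q => q.1) (b := fun q => a)
      (by fun_prop) (by fun_prop)
    have h2 := hG' (α := ℝ × ℝ) (a := fun q => q.2) (b := fun q => b)
      (by fun_prop) (by fun_prop)
    have : Measurable fun q : ℝ × ℝ => ENNReal.ofReal (1 / q.1) * G q.1 a *
      (ENNReal.ofReal (1 / q.2) * G q.2 b) := by fun_prop
    exact this
  · have ga : Measurable fun t => G t a := hG' (by fun_prop) (by fun_prop)
    have gb : Measurable fun t => G t b := hG' (by fun_prop) (by fun_prop)
    rw [← lintegral_const_mul' _ _ ENNReal.ofReal_ne_top]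
    refine setLIntegral_mono' measurableSet_Ioi fun t ht => ?_
    rw [← lintegral_const_mul' _ _ ENNReal.ofReal_ne_top]
    have hms : MeasurableSet {t' : ℝ | |t - t'| ≤ ‖a - b‖} :=
      measurableSet_le (by fun_prop) (by fun_prop)
    rw [inter_comm, ← setLIntegral_indicator hms]
    refine setLIntegral_mono' measurableSet_Ioi fun t' ht' => ?_
    have ht0 : (0:ℝ) < t := ht
    have ht0' : (0:ℝ) < t' := ht'
    by_cases h : |t - t'| ≤ ‖a - b‖
    · rw [indicator_of_mem (by exact h), bipolarKernel, indicator_of_mem (by exact h)]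
      have i1 : ENNReal.ofReal t * ENNReal.ofReal (1 / t) = 1 := by
        rw [← ENNReal.ofReal_mul ht0.le, mul_one_div_cancel ht0.ne', ENNReal.ofReal_one]
      have i2 : ENNReal.ofReal t' * ENNReal.ofReal (1 / t') = 1 := by
        rw [← ENNReal.ofReal_mul ht0'.le, mul_one_div_cancel ht0'.ne', ENNReal.ofReal_one]
      calc _ = ENNReal.ofReal (2 * π / ‖a - b‖) * (G t a * G t' b) *
            ((ENNReal.ofReal t * ENNReal.ofReal (1 / t)) *
            (ENNReal.ofReal t' * ENNReal.ofReal (1 / t'))) := by ring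
        _ ≤ _ := by rw [i1, i2]; apply le_of_eq; ring
    · rw [indicator_of_notMem (by exact h)]; exact zero_le

lemma lintegral_sphMeanAdj_sq_le {G : ℝ → E3 → ℝ≥0∞} (hG : Measurable (uncurry G)) :
    ∫⁻ y, sphMeanAdj G y ^ 2 ≤ ∫⁻ t in Ioi (0:ℝ), ∫⁻ t' in Ioi (0:ℝ), ∫⁻ a, ∫⁻ b,
      G t a * (bipolarKernel |t - t'| ‖a - b‖ * G t' b) := by
  have hG' : ∀ {α : Type} [MeasurableSpace α] {a : α → ℝ} {b : α → E3}, Measurable a →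
      Measurable b → Measurable fun z => G (a z) (b z) := fun ha hb => hG.comp (ha.prodMk hb)
  have hK : ∀ {α : Type} [MeasurableSpace α] {a : α → ℝ} {b : α → ℝ}, Measurable a →
      Measurable b → Measurable fun z => bipolarKernel (a z) (b z) := fun ha hb =>
    measurable_bipolarKernel.comp (ha.prodMk hb)
  obtain ⟨k, hk⟩ : ∃ k : E3 → E3 → ℝ≥0∞,
      k = fun x a => ENNReal.ofReal (1 / ‖x - a‖) * G ‖x - a‖ a := ⟨_, rfl⟩
  have mk : Measurable fun q : E3 × E3 => k q.1 q.2 := by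
    have := hG' (α := E3 × E3) (a := fun q => ‖q.1 - q.2‖) (b := fun q => q.2)
      (by fun_prop) (by fun_prop)
    rw [hk]; fun_prop
  have mk' : ∀ x, Measurable (k x) := fun x => mk.comp (measurable_const.prodMk measurable_id)
  have e1 : ∀ y, sphMeanAdj G y ^ 2 = ∫⁻ a, ∫⁻ b, k y a * k y b := by
    intro y
    have : sphMeanAdj G y = ∫⁻ a, k y a := by rw [hk, sphMeanAdj]
    rw [sq, this, ← lintegral_mul_const _ (mk' y)]
    refine lintegral_congr fun a => ?_
    rw [← lintegral_const_mul _ (mk' y)]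
  have m3 : Measurable fun q : (E3 × E3) × E3 => k q.1.1 q.1.2 * k q.1.1 q.2 := by
    have h1 : Measurable fun q : (E3 × E3) × E3 => k q.1.1 q.1.2 :=
      mk.comp (measurable_fst)
    have h2 : Measurable fun q : (E3 × E3) × E3 => k q.1.1 q.2 :=
      mk.comp (measurable_fst.fst.prodMk measurable_snd)
    exact h1.mul h2
  calc ∫⁻ y, sphMeanAdj G y ^ 2 = ∫⁻ y, ∫⁻ a, ∫⁻ b, k y a * k y b := lintegral_congr e1
    _ = ∫⁻ a, ∫⁻ y, ∫⁻ b, k y a * k y b := by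
        rw [lintegral_lintegral_swap]
        exact (m3.lintegral_prod_right').aemeasurable
    _ = ∫⁻ a, ∫⁻ b, ∫⁻ y, k y a * k y b := by
        refine lintegral_congr fun a => ?_
        rw [lintegral_lintegral_swap]
        have : Measurable fun q : E3 × E3 => k q.1 a * k q.1 q.2 :=
          m3.comp ((measurable_fst.prodMk measurable_const).prodMk measurable_snd)
        exact this.aemeasurable
    _ ≤ ∫⁻ a, ∫⁻ b, ∫⁻ t in Ioi (0:ℝ), ∫⁻ t' in Ioi (0:ℝ),
          G t a * (bipolarKernel |t - t'| ‖a - b‖ * G t' b) := by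
        refine lintegral_mono fun a => lintegral_mono_ae ?_
        have hne : ∀ᵐ b : E3, b ≠ a := by simp [ae_iff]
        filter_upwards [hne] with b hb
        rw [hk]; exact lintegral_adj_kernel_mul_le hG hb
    _ = _ := by
        have h1 := hG' (α := ((E3 × E3) × ℝ) × ℝ) (a := fun q => q.1.2) (b := fun q => q.1.1.1)
          (by fun_prop) (by fun_prop)
        have h2 := hG' (α := ((E3 × E3) × ℝ) × ℝ) (a := fun q => q.2) (b := fun q => q.1.1.2)
          (by fun_prop) (by fun_prop)
        have h3 := hK (α := ((E3 × E3) × ℝ) × ℝ) (a := fun q => |q.1.2 - q.2|)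
          (b := fun q => ‖q.1.1.1 - q.1.1.2‖) (by fun_prop) (by fun_prop)
        exact lintegral_swap_pairs volume (volume.restrict (Ioi (0:ℝ)))
          (fun a b t t' => G t a * (bipolarKernel |t - t'| ‖a - b‖ * G t' b)) (by fun_prop)

lemma lintegral_rpow_mul_rpow_mul_rpow_le {α : Type*} [MeasurableSpace α] {μ : Measure α}
    {f g h : α → ℝ≥0∞} (hf : AEMeasurable f μ) (hg : AEMeasurable g μ) (hh : AEMeasurable h μ)
    {a b c : ℝ} (ha : 0 ≤ a) (hb : 0 ≤ b) (hc : 0 ≤ c) (habc : a + b + c = 1) :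
    ∫⁻ x, f x ^ a * g x ^ b * h x ^ c ∂μ ≤
      (∫⁻ x, f x ∂μ) ^ a * (∫⁻ x, g x ∂μ) ^ b * (∫⁻ x, h x ∂μ) ^ c := by
  have := ENNReal.lintegral_prod_norm_pow_le (μ := μ) (Finset.univ : Finset (Fin 3))
    (f := ![f, g, h]) (p := ![a, b, c]) (by intro i _; fin_cases i <;> assumption)
    (by simp [Fin.sum_univ_three, habc]) (by intro i _; fin_cases i <;> assumption)
  simpa [Fin.prod_univ_three] using this

/-- Young's convolution inequality in the dual pair of exponents `(r', r)`. -/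
lemma lintegral_conv_le {g h : E3 → ℝ≥0∞} (hg : Measurable g) (hh : Measurable h)
    {K : ℝ → ℝ≥0∞} (hK : Measurable K) {r : ℝ} (hr : 2 < r) :
    ∫⁻ a, ∫⁻ b, g a * (K ‖a - b‖ * h b) ≤
      (∫⁻ a, g a ^ (r / (r - 1))) ^ ((r - 1) / r) * (∫⁻ a, h a ^ (r / (r - 1))) ^ ((r - 1) / r) *
        (∫⁻ y : E3, K ‖y‖ ^ (r / 2)) ^ (2 / r) := by
  set p := r / (r - 1) with hp
  set A := ∫⁻ a, g a ^ p
  set B := ∫⁻ a, h a ^ p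
  set k := ∫⁻ y : E3, K ‖y‖ ^ (r / 2) with hk
  have hr1 : 0 < r - 1 := by linarith
  have hr0 : 0 < r := by linarith
  have e1 : p * (1 - 2 / r) + p * (1 / r) = 1 := by rw [hp]; field_simp; ring
  have hp0 : 0 ≤ p := by positivity
  have hn : 0 ≤ 1 - 2 / r := by rw [sub_nonneg, div_le_one hr0]; exact hr.le
  have hn' : 0 ≤ 1 / r := by positivity
  have key : ∀ a b, g a * (K ‖a - b‖ * h b) = (g a ^ p * h b ^ p) ^ (1 - 2 / r) *
      (g a ^ p * K ‖a - b‖ ^ (r / 2)) ^ (1 / r) * (h b ^ p * K ‖a - b‖ ^ (r / 2)) ^ (1 / r) := by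
    intro a b
    simp only [ENNReal.mul_rpow_of_nonneg _ _ hn, ENNReal.mul_rpow_of_nonneg _ _ hn',
      ← ENNReal.rpow_mul]
    have h1 : g a = g a ^ (p * (1 - 2 / r)) * g a ^ (p * (1 / r)) := by
      rw [← ENNReal.rpow_add_of_nonneg _ _ (by positivity) (by positivity), e1, ENNReal.rpow_one]
    have h2 : h b = h b ^ (p * (1 - 2 / r)) * h b ^ (p * (1 / r)) := by
      rw [← ENNReal.rpow_add_of_nonneg _ _ (by positivity) (by positivity), e1, ENNReal.rpow_one]
    have h3 : K ‖a - b‖ = K ‖a - b‖ ^ (r / 2 * (1 / r)) * K ‖a - b‖ ^ (r / 2 * (1 / r)) := by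
      rw [← ENNReal.rpow_add_of_nonneg _ _ (by positivity) (by positivity)]
      have : r / 2 * (1 / r) + r / 2 * (1 / r) = 1 := by field_simp; norm_num
      rw [this, ENNReal.rpow_one]
    conv_lhs => rw [h1, h2, h3]
    ring
  have m1 : Measurable fun q : E3 × E3 => g q.1 ^ p * h q.2 ^ p := by fun_prop
  have m2 : Measurable fun q : E3 × E3 => g q.1 ^ p * K ‖q.1 - q.2‖ ^ (r / 2) := by fun_prop
  have m3 : Measurable fun q : E3 × E3 => h q.2 ^ p * K ‖q.1 - q.2‖ ^ (r / 2) := by fun_prop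
  have m0 : Measurable fun q : E3 × E3 => g q.1 * (K ‖q.1 - q.2‖ * h q.2) := by fun_prop
  have i1 : ∫⁻ q : E3 × E3, g q.1 ^ p * h q.2 ^ p = A * B :=
    lintegral_prod_mul (hg.pow_const p).aemeasurable (hh.pow_const p).aemeasurable
  have i2 : ∫⁻ q : E3 × E3, g q.1 ^ p * K ‖q.1 - q.2‖ ^ (r / 2) = A * k := by
    rw [Measure.volume_eq_prod, lintegral_prod _ m2.aemeasurable, ← lintegral_mul_const _ (by fun_prop)]
    refine lintegral_congr fun a => ?_
    dsimp only
    rw [lintegral_const_mul _ (by fun_prop)]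
    congr 1
    exact lintegral_sub_left_eq_self (μ := (volume : Measure E3)) (fun y => K ‖y‖ ^ (r / 2)) a
  have i3 : ∫⁻ q : E3 × E3, h q.2 ^ p * K ‖q.1 - q.2‖ ^ (r / 2) = B * k := by
    rw [Measure.volume_eq_prod, lintegral_prod_symm _ m3.aemeasurable,
      ← lintegral_mul_const _ (by fun_prop)]
    refine lintegral_congr fun b => ?_
    dsimp only
    rw [lintegral_const_mul _ (by fun_prop)]
    congr 1
    exact lintegral_sub_right_eq_self (μ := (volume : Measure E3)) (fun y => K ‖y‖ ^ (r / 2)) b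
  have e2 : (1 - 2 / r) + 1 / r = (r - 1) / r := by field_simp; ring
  have e3 : 1 / r + 1 / r = 2 / r := by ring
  calc ∫⁻ a, ∫⁻ b, g a * (K ‖a - b‖ * h b)
      = ∫⁻ q : E3 × E3, g q.1 * (K ‖q.1 - q.2‖ * h q.2) := by
        rw [Measure.volume_eq_prod, lintegral_prod _ m0.aemeasurable]
    _ = ∫⁻ q : E3 × E3, (g q.1 ^ p * h q.2 ^ p) ^ (1 - 2 / r) *
      (g q.1 ^ p * K ‖q.1 - q.2‖ ^ (r / 2)) ^ (1 / r) *
      (h q.2 ^ p * K ‖q.1 - q.2‖ ^ (r / 2)) ^ (1 / r) := lintegral_congr fun q => key _ _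
    _ ≤ (A * B) ^ (1 - 2 / r) * (A * k) ^ (1 / r) * (B * k) ^ (1 / r) := by
        rw [← i1, ← i2, ← i3]
        exact lintegral_rpow_mul_rpow_mul_rpow_le m1.aemeasurable m2.aemeasurable m3.aemeasurable
          hn hn' hn' (by ring)
    _ = (A ^ (1 - 2 / r) * A ^ (1 / r)) * (B ^ (1 - 2 / r) * B ^ (1 / r)) *
        (k ^ (1 / r) * k ^ (1 / r)) := by
        simp only [ENNReal.mul_rpow_of_nonneg _ _ hn, ENNReal.mul_rpow_of_nonneg _ _ hn']
        ring
    _ = _ := by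
        rw [← ENNReal.rpow_add_of_nonneg _ _ hn hn', ← ENNReal.rpow_add_of_nonneg _ _ hn hn',
          ← ENNReal.rpow_add_of_nonneg _ _ hn' hn', e2, e3]

lemma lintegral_Ioi_rpow {a c : ℝ} (ha : a < -1) (hc : 0 < c) :
    ∫⁻ x in Ioi c, ENNReal.ofReal (x ^ a) = ENNReal.ofReal (-c ^ (a + 1) / (a + 1)) := by
  rw [← integral_Ioi_rpow_of_lt ha hc, ofReal_integral_eq_lintegral_ofReal
    (integrableOn_Ioi_rpow_of_lt ha hc)]
  filter_upwards [ae_restrict_mem measurableSet_Ioi] with x hx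
  exact Real.rpow_nonneg (hc.trans hx).le _

lemma lintegral_Ioc_rpow {a c : ℝ} (ha : -1 < a) (hc : 0 < c) :
    ∫⁻ x in Ioc 0 c, ENNReal.ofReal (x ^ a) = ENNReal.ofReal (c ^ (a + 1) / (a + 1)) := by
  have h := integral_rpow (a := 0) (b := c) (r := a) (Or.inl ha)
  rw [Real.zero_rpow (by linarith), sub_zero, intervalIntegral.integral_of_le hc.le] at h
  rw [← h, ofReal_integral_eq_lintegral_ofReal]
  · exact ((intervalIntegral.intervalIntegrable_rpow' ha).1)
  · filter_upwards [ae_restrict_mem measurableSet_Ioc] with x hx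
    exact Real.rpow_nonneg hx.1.le _

lemma lintegral_bipolarKernel_rpow {d r : ℝ} (hd : 0 < d) (hr : 6 < r) :
    ∫⁻ y : E3, bipolarKernel d ‖y‖ ^ (r / 2) = sphMeas univ *
      ENNReal.ofReal ((2 * π) ^ (r / 2) / (r / 2 - 3) * d ^ (3 - r / 2)) := by
  have hm : Measurable fun ρ => bipolarKernel d ρ ^ (r / 2) :=
    (measurable_bipolarKernel.comp (measurable_const.prodMk measurable_id)).pow_const _
  rw [lintegral_polar_norm _ hm]
  congr 1
  have e : ∀ ρ ∈ Ioi (0:ℝ), ENNReal.ofReal (ρ ^ 2) * bipolarKernel d ρ ^ (r / 2) =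
      (Ici d).indicator (fun ρ => ENNReal.ofReal ((2 * π) ^ (r / 2)) *
        ENNReal.ofReal (ρ ^ (2 - r / 2))) ρ := by
    intro ρ hρ
    have hρ0 : (0:ℝ) < ρ := hρ
    by_cases h : ρ ∈ Ici d
    · rw [bipolarKernel, indicator_of_mem h, indicator_of_mem h,
        ENNReal.ofReal_rpow_of_pos (by positivity), ← ENNReal.ofReal_mul (by positivity),
        ← ENNReal.ofReal_mul (by positivity)]
      congr 1
      rw [Real.div_rpow (by positivity) hρ0.le, Real.rpow_sub hρ0, Real.rpow_two]
      ring
    · rw [bipolarKernel, indicator_of_notMem h, indicator_of_notMem h,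
        ENNReal.zero_rpow_of_pos (by linarith), mul_zero]
  rw [setLIntegral_congr_fun measurableSet_Ioi e, setLIntegral_indicator measurableSet_Ici,
    inter_eq_left.2 (Ici_subset_Ioi.2 hd), setLIntegral_congr Ioi_ae_eq_Ici.symm,
    lintegral_const_mul _ (by fun_prop), lintegral_Ioi_rpow (by linarith) hd,
    ← ENNReal.ofReal_mul (by positivity)]
  congr 1
  have h1 : 2 - r / 2 + 1 = 3 - r / 2 := by ring
  have h2 : r / 2 - 3 ≠ 0 := by linarith
  have h3 : 3 - r / 2 ≠ 0 := by linarith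
  rw [h1, neg_div, ← div_neg, neg_sub]
  ring

/-- The fixed-time dispersive bound for the composition of `sphMean` with its adjoint. -/
lemma lintegral_bipolarKernel_conv_le {r : ℝ} (hr : 6 < r) : ∃ C : ℝ≥0∞, C ≠ ∞ ∧
    ∀ (g h : E3 → ℝ≥0∞), Measurable g → Measurable h → ∀ d : ℝ, 0 < d →
    ∫⁻ a, ∫⁻ b, g a * (bipolarKernel d ‖a - b‖ * h b) ≤ C * ((∫⁻ a, g a ^ (r / (r - 1))) ^ ((r - 1) / r) *
      (ENNReal.ofReal (d ^ (6 / r - 1)) * (∫⁻ a, h a ^ (r / (r - 1))) ^ ((r - 1) / r))) := by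
  have hr2 : (0:ℝ) ≤ 2 / r := by positivity
  refine ⟨sphMeas univ ^ (2 / r) * ENNReal.ofReal (((2 * π) ^ (r / 2) / (r / 2 - 3)) ^ (2 / r)),
    ENNReal.mul_ne_top (ENNReal.rpow_ne_top_of_nonneg hr2 (measure_ne_top _ _))
      ENNReal.ofReal_ne_top, fun g h hg hh d hd => ?_⟩
  have hK : Measurable (bipolarKernel d) :=
    (measurable_bipolarKernel.comp (measurable_const.prodMk measurable_id))
  refine (lintegral_conv_le hg hh hK (by linarith : 2 < r)).trans (le_of_eq ?_)
  have h3 : 0 < r / 2 - 3 := by linarith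
  rw [lintegral_bipolarKernel_rpow hd hr, ENNReal.mul_rpow_of_nonneg _ _ hr2,
    ENNReal.ofReal_rpow_of_pos (by positivity), Real.mul_rpow (by positivity) (by positivity),
    ENNReal.ofReal_mul (by positivity), ← Real.rpow_mul hd.le]
  have : (3 - r / 2) * (2 / r) = 6 / r - 1 := by field_simp; ring
  rw [this]
  ring

lemma lintegral_comp_abs (f : ℝ → ℝ≥0∞) :
    ∫⁻ x, f |x| = 2 * ∫⁻ x in Ioi (0:ℝ), f x := by
  rw [← lintegral_add_compl _ (measurableSet_Ioi (a := (0:ℝ))), compl_Ioi, two_mul]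
  have h1 : ∫⁻ x in Ioi (0:ℝ), f |x| = ∫⁻ x in Ioi (0:ℝ), f x :=
    setLIntegral_congr_fun measurableSet_Ioi fun x hx => by
      rw [abs_of_pos (by exact hx)]
  have h2 : ∫⁻ x in Iic (0:ℝ), f |x| = ∫⁻ x in Ioi (0:ℝ), f |x| := by
    rw [setLIntegral_congr Ioi_ae_eq_Ici, ← lintegral_indicator measurableSet_Iic,
      ← lintegral_indicator measurableSet_Ici, ← lintegral_neg_eq_self]
    refine lintegral_congr fun x => ?_
    by_cases h : 0 ≤ x <;> simp [indicator, h]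
  rw [h2, h1]

lemma lintegral_comp_abs_sub (f : ℝ → ℝ≥0∞) (t : ℝ) :
    ∫⁻ x, f |t - x| = 2 * ∫⁻ x in Ioi (0:ℝ), f x := by
  rw [← lintegral_comp_abs]
  exact lintegral_sub_left_eq_self (μ := (volume : Measure ℝ)) (fun y => f |y|) t

lemma lintegral_truncated_riesz_le {q : ℝ} (hq : 2 < q) {g : ℝ → ℝ≥0∞} (hg : Measurable g)
    {v N : ℝ} (hv : 0 < v) (hN : 0 < N)
    (hgN : ∫⁻ t, g t ^ (q / (q - 1)) ≤ ENNReal.ofReal N ^ (q / (q - 1))) (t : ℝ) :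
    ∫⁻ t', {t' | g t' ≤ ENNReal.ofReal v}.indicator
        (fun t' => ENNReal.ofReal (|t - t'| ^ (-(2 / q))) * g t') t' ≤
      ENNReal.ofReal ((2 / (1 - 2 / q) + 2 ^ (1 / q)) *
        (v ^ (q / (q - 1) - 1) * N ^ (2 - q / (q - 1)))) := by
  set p := q / (q - 1) with hp
  set γ := 2 / q with hγ
  have hq0 : 0 < q := by linarith
  have hq1 : 0 < q - 1 := by linarith
  have hγ1 : 0 < 1 - γ := by rw [hγ, sub_pos, div_lt_one hq0]; exact hq
  have hγ0 : 0 < γ := by positivity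
  have hp0 : 0 < p := by positivity
  set ρ := (N / v) ^ p with hρ
  have hρ0 : 0 < ρ := by positivity
  have hpq : p.HolderConjugate q := by
    have : q.HolderConjugate p := by
      rw [hp]; exact Real.HolderConjugate.conjExponent (by linarith)
    exact this.symm
  set φ : ℝ → ℝ≥0∞ := (Iic ρ).indicator fun x => ENNReal.ofReal v * ENNReal.ofReal (x ^ (-γ)) with hφ
  set ψ : ℝ → ℝ≥0∞ := (Ioi ρ).indicator fun x => ENNReal.ofReal (x ^ (-γ)) with hψ
  have mφ : Measurable φ := Measurable.indicator (by fun_prop) measurableSet_Iic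
  have mψ : Measurable ψ := Measurable.indicator (by fun_prop) measurableSet_Ioi
  have pt : ∀ t', {t' | g t' ≤ ENNReal.ofReal v}.indicator
        (fun t' => ENNReal.ofReal (|t - t'| ^ (-γ)) * g t') t' ≤ φ |t - t'| + g t' * ψ |t - t'| := by
    intro t'
    by_cases h : g t' ≤ ENNReal.ofReal v
    · rw [indicator_of_mem (by exact h)]
      by_cases h' : |t - t'| ≤ ρ
      · rw [hφ, indicator_of_mem (by exact h'), mul_comm]
        exact (mul_le_mul_left h _).trans le_self_add
      · rw [hψ, indicator_of_mem (by exact not_le.1 h'), mul_comm]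
        exact le_add_self
    · rw [indicator_of_notMem (by exact h)]; exact zero_le
  have i1 : ∫⁻ t', φ |t - t'| = ENNReal.ofReal (2 / (1 - γ) * (v * ρ ^ (1 - γ))) := by
    rw [lintegral_comp_abs_sub, hφ, setLIntegral_indicator measurableSet_Iic, inter_comm,
      Ioi_inter_Iic, lintegral_const_mul _ (by fun_prop), lintegral_Ioc_rpow (by linarith) hρ0,
      ← ENNReal.ofReal_mul hv.le, ← ENNReal.ofReal_ofNat, ← ENNReal.ofReal_mul (by norm_num),
      neg_add_eq_sub]
    congr 1
    ring
  have i2 : (∫⁻ t', ψ |t - t'| ^ q) ^ (1 / q) = ENNReal.ofReal (2 ^ (1 / q) * ρ ^ (-(1 / q))) := by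
    have e : (fun x => ψ x ^ q) = (Ioi ρ).indicator fun x => ENNReal.ofReal (x ^ (-2:ℝ)) := by
      ext x
      by_cases h : x ∈ Ioi ρ
      · have hx : 0 < x := hρ0.trans h
        rw [hψ, indicator_of_mem h, indicator_of_mem h, ENNReal.ofReal_rpow_of_pos (by positivity),
          ← Real.rpow_mul hx.le]
        congr 2
        rw [hγ]; field_simp
      · rw [hψ, indicator_of_notMem h, indicator_of_notMem h, ENNReal.zero_rpow_of_pos hq0]
    have := lintegral_comp_abs_sub (fun x => ψ x ^ q) t
    rw [this, e, setLIntegral_indicator measurableSet_Ioi, inter_eq_left.2 (Ioi_subset_Ioi hρ0.le),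
      lintegral_Ioi_rpow (by norm_num) hρ0, ← ENNReal.ofReal_ofNat,
      ← ENNReal.ofReal_mul (by norm_num), show (-2:ℝ) + 1 = -1 by norm_num, neg_div_neg_eq, div_one,
      ENNReal.ofReal_rpow_of_pos (by positivity), Real.mul_rpow (by norm_num) (by positivity),
      ← Real.rpow_mul hρ0.le]
    congr 3
    ring
  have i3 : (∫⁻ t, g t ^ p) ^ (1 / p) ≤ ENNReal.ofReal N := by
    calc _ ≤ (ENNReal.ofReal N ^ p) ^ (1 / p) := ENNReal.rpow_le_rpow hgN (by positivity)
      _ = _ := by rw [← ENNReal.rpow_mul, mul_one_div_cancel hp0.ne', ENNReal.rpow_one]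
  calc _ ≤ ∫⁻ t', (φ |t - t'| + g t' * ψ |t - t'|) := lintegral_mono pt
    _ = (∫⁻ t', φ |t - t'|) + ∫⁻ t', g t' * ψ |t - t'| :=
        lintegral_add_left (mφ.comp (by fun_prop)) _
    _ ≤ ENNReal.ofReal (2 / (1 - γ) * (v * ρ ^ (1 - γ))) +
        ENNReal.ofReal N * ENNReal.ofReal (2 ^ (1 / q) * ρ ^ (-(1 / q))) := by
        refine add_le_add i1.le ((ENNReal.lintegral_mul_le_Lp_mul_Lq volume hpq hg.aemeasurable
          (g := fun t' => ψ |t - t'|) (by fun_prop)).trans ?_)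
        rw [i2]
        exact mul_le_mul_left i3 _
    _ = _ := by
        rw [← ENNReal.ofReal_mul hN.le, ← ENNReal.ofReal_add (by positivity) (by positivity)]
        congr 1
        have h1 : v * ρ ^ (1 - γ) = v ^ (p - 1) * N ^ (2 - p) := by
          have : p * (1 - γ) = 2 - p := by rw [hp, hγ]; field_simp; ring
          rw [hρ, ← Real.rpow_mul (by positivity), this, Real.div_rpow hN.le hv.le,
            show v ^ (p - 1) = v ^ (1 - (2 - p)) by ring_nf, Real.rpow_sub hv 1, Real.rpow_one]
          ring
        have h2 : N * ρ ^ (-(1 / q)) = v ^ (p - 1) * N ^ (2 - p) := by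
          have : p * (-(1 / q)) = 1 - p := by rw [hp]; field_simp; ring
          rw [hρ, ← Real.rpow_mul (by positivity), this, Real.div_rpow hN.le hv.le,
            show 2 - p = 1 + (1 - p) by ring, Real.rpow_add hN, Real.rpow_one,
            show p - 1 = -(1 - p) by ring, Real.rpow_neg hv.le]
          field_simp
        rw [add_mul, h1, ← h2]
        ring

/-- The diagonal Hardy–Littlewood–Sobolev inequality on the line. -/
lemma lintegral_riesz_le {q : ℝ} (hq : 2 < q) : ∃ C : ℝ≥0∞, C ≠ ∞ ∧
    ∀ g : ℝ → ℝ≥0∞, Measurable g →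
    ∫⁻ t, ∫⁻ t', g t * (ENNReal.ofReal (|t - t'| ^ (-(2 / q))) * g t') ≤
      C * ((∫⁻ t, g t ^ (q / (q - 1))) ^ ((q - 1) / q)) ^ 2 := by
  set p := q / (q - 1) with hp
  have hq0 : 0 < q := by linarith
  have hq1 : 0 < q - 1 := by linarith
  have hp0 : 0 < p := by positivity
  have hp1 : 1 < p := by rw [hp, lt_div_iff₀ hq1]; linarith
  have hip : (q - 1) / q = 1 / p := by rw [hp, one_div_div]
  set C1 := 2 / (1 - 2 / q) + 2 ^ (1 / q) with hC1
  have hγ1 : 0 < 1 - 2 / q := by rw [sub_pos, div_lt_one hq0]; exact hq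
  have hC0 : 0 < C1 := by positivity
  refine ⟨2 * ENNReal.ofReal C1, ENNReal.mul_ne_top (by norm_num) ENNReal.ofReal_ne_top,
    fun g hg => ?_⟩
  rw [hip]
  set I := ∫⁻ t, g t ^ p with hI
  rcases eq_or_ne I 0 with h0 | h0
  · have hz : ∀ᵐ t, g t = 0 := by
      have := (lintegral_eq_zero_iff (hg.pow_const p)).1 h0
      filter_upwards [this] with t ht
      simpa [hp0, hp0.le, hp0.not_gt] using ht
    have : ∫⁻ t, ∫⁻ t', g t * (ENNReal.ofReal (|t - t'| ^ (-(2 / q))) * g t') = 0 := by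
      refine (lintegral_congr_ae ?_).trans lintegral_zero
      filter_upwards [hz] with t ht
      simp [ht]
    rw [this]; exact zero_le
  rcases eq_or_ne I ∞ with hT | hT
  · rw [hT, ENNReal.top_rpow_of_pos (by positivity)]
    simp [hC0]
  set N := (I ^ (1 / p)).toReal with hN
  have hNt : I ^ (1 / p) ≠ ∞ := ENNReal.rpow_ne_top_of_nonneg (by positivity) hT
  have hN0 : 0 < N := ENNReal.toReal_pos (by simp [h0, hT]) hNt
  have hNe : ENNReal.ofReal N = I ^ (1 / p) := ENNReal.ofReal_toReal hNt
  have hNp : ENNReal.ofReal N ^ p = I := by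
    rw [hNe, ← ENNReal.rpow_mul, one_div_mul_cancel hp0.ne', ENNReal.rpow_one]
  set F : ℝ → ℝ → ℝ≥0∞ := fun t t' => g t * (ENNReal.ofReal (|t - t'| ^ (-(2 / q))) * g t') with hF
  set Q := ∫⁻ t, ∫⁻ t', {t' | g t' ≤ g t}.indicator (F t) t' with hQ
  have hQle : Q ≤ ENNReal.ofReal (C1 * N ^ (2 - p)) * I := by
    rw [hQ, hI, ← lintegral_const_mul _ (by fun_prop)]
    refine lintegral_mono_ae ?_
    have hfin : ∀ᵐ t, g t ^ p < ∞ := ae_lt_top (by fun_prop) hT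
    filter_upwards [hfin] with t ht
    have ht' : g t ≠ ∞ := fun h => by simp [h, hp0] at ht
    rcases eq_or_ne (g t) 0 with hz | hz
    · have : ∀ t', {t' | g t' ≤ g t}.indicator (F t) t' = 0 := by
        intro t'; simp [indicator, hF, hz]
      simp [this]
    · have hv : 0 < (g t).toReal := ENNReal.toReal_pos hz ht'
      have hve : ENNReal.ofReal (g t).toReal = g t := ENNReal.ofReal_toReal ht'
      have key := lintegral_truncated_riesz_le hq hg hv hN0 (by rw [hNp]) t
      rw [hve, ← hp, ← hC1] at key
      have e : ∀ t', {t' | g t' ≤ g t}.indicator (F t) t' = g t * {t' | g t' ≤ g t}.indicator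
          (fun t' => ENNReal.ofReal (|t - t'| ^ (-(2 / q))) * g t') t' := by
        intro t'
        by_cases h : g t' ≤ g t
        · rw [indicator_of_mem (by exact h), indicator_of_mem (by exact h)]
        · rw [indicator_of_notMem (by exact h), indicator_of_notMem (by exact h), mul_zero]
      rw [lintegral_congr e, lintegral_const_mul' _ _ ht']
      refine (mul_le_mul_right key _).trans (le_of_eq ?_)
      conv_lhs => rw [← hve]
      conv_rhs => rw [← hve]
      rw [ENNReal.ofReal_rpow_of_pos hv, ← ENNReal.ofReal_mul hv.le,
        ← ENNReal.ofReal_mul (by positivity)]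
      congr 1
      rw [ENNReal.toReal_ofReal hv.le, Real.rpow_sub_one hv.ne']
      field_simp
  have hsplit : ∫⁻ t, ∫⁻ t', F t t' ≤ 2 * Q := by
    have mF : Measurable fun z : ℝ × ℝ => F z.1 z.2 := by rw [hF]; fun_prop
    have mi : Measurable fun z : ℝ × ℝ => {z : ℝ × ℝ | g z.2 ≤ g z.1}.indicator
        (fun z => F z.1 z.2) z :=
      mF.indicator (measurableSet_le (by fun_prop) (by fun_prop))
    have mi' : Measurable fun z : ℝ × ℝ => {z : ℝ × ℝ | g z.1 ≤ g z.2}.indicator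
        (fun z => F z.2 z.1) z :=
      (mF.comp measurable_swap).indicator (measurableSet_le (by fun_prop) (by fun_prop))
    have hsw : Q = ∫⁻ t, ∫⁻ t', {t' | g t ≤ g t'}.indicator (fun t' => F t' t) t' := by
      rw [hQ, lintegral_lintegral_swap]
      · rfl
      · exact mi.aemeasurable
    rw [two_mul]
    conv_rhs => rw [hsw]
    conv_rhs => arg 2; rw [← hsw, hQ]
    rw [← lintegral_add_left]
    · refine lintegral_mono fun t => ?_
      have m : Measurable fun t' => {t' | g t ≤ g t'}.indicator (fun t' => F t' t) t' :=
        mi'.comp (measurable_const.prodMk measurable_id)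
      rw [← lintegral_add_left m]
      refine lintegral_mono fun t' => ?_
      rcases le_total (g t) (g t') with h | h
      · rw [indicator_of_mem (by exact h)]
        have : F t t' = F t' t := by simp only [hF]; rw [abs_sub_comm]; ring
        rw [this]; exact le_self_add
      · rw [indicator_of_mem (s := {t' | g t' ≤ g t}) (by exact h)]
        exact le_add_self
    · exact mi'.lintegral_prod_right'
  refine hsplit.trans ?_
  refine (mul_le_mul_right hQle _).trans (le_of_eq ?_)
  rw [← hNe]
  conv_lhs => rw [← hNp]
  rw [ENNReal.ofReal_rpow_of_pos hN0, ENNReal.ofReal_mul hC0.le]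
  have : ENNReal.ofReal (N ^ (2 - p)) * ENNReal.ofReal (N ^ p) = ENNReal.ofReal N ^ 2 := by
    rw [← ENNReal.ofReal_mul (by positivity), ← Real.rpow_add hN0, ← ENNReal.ofReal_pow hN0.le]
    congr 1
    simp
  rw [← this]
  ring

/-- The mixed norm `L^q_t L^r_x` of a nonnegative function. -/
def mixE (q r : ℝ) (G : ℝ → E3 → ℝ≥0∞) : ℝ≥0∞ :=
  (∫⁻ t, ((∫⁻ x, G t x ^ r) ^ (1 / r)) ^ q) ^ (1 / q)

/-- The mixed norm `L^{q'}_t L^{r'}_x` of a nonnegative function, for the dual exponents. -/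
def mixDual (q r : ℝ) (G : ℝ → E3 → ℝ≥0∞) : ℝ≥0∞ :=
  (∫⁻ t, ((∫⁻ x, G t x ^ (r / (r - 1))) ^ ((r - 1) / r)) ^ (q / (q - 1))) ^ ((q - 1) / q)

/-- The `L²` norm of a nonnegative function. -/
def l2E (f : E3 → ℝ≥0∞) : ℝ≥0∞ := (∫⁻ x, f x ^ (2:ℝ)) ^ (1 / (2:ℝ))

lemma measurable_xnorm {G : ℝ → E3 → ℝ≥0∞} (hG : Measurable (uncurry G)) (r s : ℝ) :
    Measurable fun t => (∫⁻ x, G t x ^ r) ^ s := by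
  have : Measurable fun z : ℝ × E3 => G z.1 z.2 ^ r := hG.pow_const r
  exact this.lintegral_prod_right'.pow_const s

lemma exists_lintegral_sphMeanAdj_sq_le {q r : ℝ} (hq : 2 < q) (hr : 6 < r)
    (hqr : 1 / q + 3 / r = 1 / 2) : ∃ C : ℝ≥0∞, C ≠ ∞ ∧ ∀ G : ℝ → E3 → ℝ≥0∞,
      Measurable (uncurry G) → ∫⁻ y, sphMeanAdj G y ^ 2 ≤ C * mixDual q r G ^ 2 := by
  obtain ⟨C1, hC1, h1⟩ := lintegral_bipolarKernel_conv_le hr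
  obtain ⟨C2, hC2, h2⟩ := lintegral_riesz_le hq
  refine ⟨C1 * C2, ENNReal.mul_ne_top hC1 hC2, fun G hG => ?_⟩
  have he : 6 / r - 1 = -(2 / q) := by
    have : 6 / r = 2 * (3 / r) := by ring
    rw [this, show 3 / r = 1 / 2 - 1 / q by linarith]; ring
  set g : ℝ → ℝ≥0∞ := fun t => (∫⁻ x, G t x ^ (r / (r - 1))) ^ ((r - 1) / r) with hg
  have mg : Measurable g := measurable_xnorm hG _ _
  have hGt : ∀ t, Measurable (G t) := fun t => hG.comp (measurable_const.prodMk measurable_id)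
  calc _ ≤ _ := lintegral_sphMeanAdj_sq_le hG
    _ ≤ ∫⁻ t in Ioi (0:ℝ), ∫⁻ t' in Ioi (0:ℝ),
        C1 * (g t * (ENNReal.ofReal (|t - t'| ^ (-(2 / q))) * g t')) := by
        refine lintegral_mono fun t => lintegral_mono_ae (ae_restrict_of_ae ?_)
        have hne : ∀ᵐ t' : ℝ, t' ≠ t := by simp [ae_iff]
        filter_upwards [hne] with t' ht'
        have := h1 (G t) (G t') (hGt t) (hGt t') |t - t'| (abs_pos.2 (sub_ne_zero.2 ht'.symm))
        rwa [he] at this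
    _ ≤ ∫⁻ t, ∫⁻ t', C1 * (g t * (ENNReal.ofReal (|t - t'| ^ (-(2 / q))) * g t')) :=
        (setLIntegral_le_lintegral _ _).trans
          (lintegral_mono fun t => setLIntegral_le_lintegral _ _)
    _ = C1 * ∫⁻ t, ∫⁻ t', g t * (ENNReal.ofReal (|t - t'| ^ (-(2 / q))) * g t') := by
        rw [← lintegral_const_mul' _ _ hC1]
        exact lintegral_congr fun t => lintegral_const_mul' _ _ hC1
    _ ≤ C1 * (C2 * mixDual q r G ^ 2) := mul_le_mul_right (h2 g mg) _
    _ = _ := by rw [mul_assoc]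

/-- The homogeneous Strichartz estimate for `sphMean`, in dual form. -/
lemma exists_lintegral_sphMean_mul_le {q r : ℝ} (hq : 2 < q) (hr : 6 < r)
    (hqr : 1 / q + 3 / r = 1 / 2) : ∃ C : ℝ≥0∞, C ≠ ∞ ∧ ∀ (f : E3 → ℝ≥0∞), Measurable f →
      ∀ G : ℝ → E3 → ℝ≥0∞, Measurable (uncurry G) →
      ∫⁻ t in Ioi (0:ℝ), ∫⁻ x, sphMean f t x * G t x ≤ C * (l2E f * mixDual q r G) := by
  obtain ⟨C, hC, h⟩ := exists_lintegral_sphMeanAdj_sq_le hq hr hqr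
  refine ⟨C ^ (1 / (2:ℝ)), ENNReal.rpow_ne_top_of_nonneg (by norm_num) hC, fun f hf G hG => ?_⟩
  rw [lintegral_sphMean_mul hf hG]
  have mA : Measurable (sphMeanAdj G) := by
    have : Measurable fun z : E3 × E3 => ENNReal.ofReal (1 / ‖z.1 - z.2‖) * G ‖z.1 - z.2‖ z.2 := by
      refine Measurable.mul (by fun_prop) ?_
      exact hG.comp (f := fun z : E3 × E3 => (‖z.1 - z.2‖, z.2)) (by fun_prop)
    exact this.lintegral_prod_right'
  have hpq : (2:ℝ).HolderConjugate 2 := Real.HolderConjugate.two_two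
  refine (ENNReal.lintegral_mul_le_Lp_mul_Lq volume hpq hf.aemeasurable mA.aemeasurable).trans ?_
  have h2 : (∫⁻ y, sphMeanAdj G y ^ (2:ℝ)) ^ (1 / (2:ℝ)) ≤ C ^ (1 / (2:ℝ)) * mixDual q r G := by
    have : C ^ (1 / (2:ℝ)) * mixDual q r G = (C * mixDual q r G ^ 2) ^ (1 / (2:ℝ)) := by
      rw [ENNReal.mul_rpow_of_nonneg _ _ (by norm_num), ← ENNReal.rpow_two, ← ENNReal.rpow_mul]
      norm_num
    rw [this]
    simp only [ENNReal.rpow_two]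
    exact ENNReal.rpow_le_rpow (h G hG) (by norm_num)
  refine (mul_le_mul_right h2 _).trans (le_of_eq ?_)
  rw [l2E]; ring

lemma mixDual_comp_add (q r τ : ℝ) (G : ℝ → E3 → ℝ≥0∞) :
    mixDual q r (fun t => G (t + τ)) = mixDual q r G := by
  unfold mixDual
  congr 1
  exact lintegral_add_right_eq_self (μ := (volume : Measure ℝ))
    (fun t => ((∫⁻ x, G t x ^ (r / (r - 1))) ^ ((r - 1) / r)) ^ (q / (q - 1))) τ

lemma setLIntegral_Ioi_shift (f : ℝ → ℝ≥0∞) (τ : ℝ) :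
    ∫⁻ t in Ioi τ, f t = ∫⁻ t in Ioi (0:ℝ), f (t + τ) := by
  rw [← lintegral_indicator measurableSet_Ioi, ← lintegral_indicator measurableSet_Ioi,
    ← lintegral_add_right_eq_self _ τ]
  refine lintegral_congr fun t => ?_
  by_cases h : 0 < t <;> simp [indicator, h]

lemma lintegral_comp_mul_left_pos (f : ℝ → ℝ≥0∞) {a : ℝ} (ha : 0 < a) :
    ∫⁻ t, f (a * t) = ENNReal.ofReal a⁻¹ * ∫⁻ t, f t := by
  have h := Real.map_volume_mul_left ha.ne'
  have := (Homeomorph.mulLeft₀ a ha.ne').measurableEmbedding.lintegral_map (μ := volume) f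
  simp only [Homeomorph.coe_mulLeft₀] at this
  rw [← this, h, lintegral_smul_measure, abs_of_pos (inv_pos.2 ha), smul_eq_mul]

lemma setLIntegral_Ioi_comp_mul_left (f : ℝ → ℝ≥0∞) {a : ℝ} (ha : 0 < a) (c : ℝ) :
    ∫⁻ t in Ioi c, f (a * t) = ENNReal.ofReal a⁻¹ * ∫⁻ t in Ioi (a * c), f t := by
  rw [← lintegral_indicator measurableSet_Ioi, ← lintegral_indicator measurableSet_Ioi,
    ← lintegral_comp_mul_left_pos _ ha]
  refine lintegral_congr fun t => ?_
  by_cases h : c < t <;> simp [indicator, h, ha]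

lemma mixDual_comp_mul {q r a : ℝ} (hq : 1 < q) (ha : 0 < a) (G : ℝ → E3 → ℝ≥0∞) :
    mixDual q r (fun t => G (a * t)) = ENNReal.ofReal (a ^ (-((q - 1) / q))) * mixDual q r G := by
  unfold mixDual
  have := lintegral_comp_mul_left_pos
    (fun t => ((∫⁻ x, G t x ^ (r / (r - 1))) ^ ((r - 1) / r)) ^ (q / (q - 1))) ha
  have h0 : 0 ≤ (q - 1) / q := div_nonneg (by linarith) (by linarith)
  rw [this, ENNReal.mul_rpow_of_nonneg _ _ h0, ENNReal.ofReal_rpow_of_pos (by positivity),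
    Real.inv_rpow ha.le, Real.rpow_neg ha.le]

/-- The integral of the spherical means of `f` over all radii larger than `ρ`. -/
def sphTail (f : E3 → ℝ≥0∞) (ρ : ℝ) (x : E3) : ℝ≥0∞ :=
  ∫⁻ r in Ioi ρ, ENNReal.ofReal (1 / r) * sphMean f r x

/-- The dual form of the homogeneous Strichartz estimate with constant `C`. -/
def DualStrichartz (q r : ℝ) (C : ℝ≥0∞) : Prop :=
  ∀ f : E3 → ℝ≥0∞, Measurable f → ∀ G : ℝ → E3 → ℝ≥0∞, Measurable (uncurry G) →
    ∫⁻ t in Ioi (0:ℝ), ∫⁻ x, sphMean f t x * G t x ≤ C * (l2E f * mixDual q r G)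

lemma sphMean_of_nonpos (f : E3 → ℝ≥0∞) {t : ℝ} (ht : t ≤ 0) (x : E3) : sphMean f t x = 0 := by
  simp [sphMean, ENNReal.ofReal_of_nonpos ht]

lemma measurable_sphMean_joint {F : ℝ → E3 → ℝ≥0∞} (hF : Measurable (uncurry F)) :
    Measurable fun z : (ℝ × E3) × ℝ => sphMean (F z.2) (z.1.1 - z.2) z.1.2 := by
  unfold sphMean
  refine Measurable.mul (by fun_prop) ?_
  have hm : Measurable fun q : ((ℝ × E3) × ℝ) × Metric.sphere (0 : E3) 1 =>
      F q.1.2 (q.1.1.2 + (q.1.1.1 - q.1.2) • (q.2 : E3)) :=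
    hF.comp (f := fun q : ((ℝ × E3) × ℝ) × Metric.sphere (0 : E3) 1 =>
      (q.1.2, q.1.1.2 + (q.1.1.1 - q.1.2) • (q.2 : E3))) (by fun_prop)
  exact hm.lintegral_prod_right'

lemma measurable_sphTail {f : E3 → ℝ≥0∞} (hf : Measurable f) :
    Measurable fun z : ℝ × E3 => sphTail f z.1 z.2 := by
  have h0 := measurable_sphMean hf
  have hm : Measurable fun q : (ℝ × E3) × ℝ => {q : (ℝ × E3) × ℝ | q.1.1 < q.2}.indicator
      (fun q => ENNReal.ofReal (1 / q.2) * sphMean f q.2 q.1.2) q := by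
    refine Measurable.indicator ?_ (measurableSet_lt (by fun_prop) (by fun_prop))
    refine Measurable.mul (by fun_prop) ?_
    exact h0.comp (f := fun q : (ℝ × E3) × ℝ => (q.2, q.1.2)) (by fun_prop)
  have e : (fun z : ℝ × E3 => sphTail f z.1 z.2) = fun z : ℝ × E3 => ∫⁻ r,
      {q : (ℝ × E3) × ℝ | q.1.1 < q.2}.indicator
      (fun q => ENNReal.ofReal (1 / q.2) * sphMean f q.2 q.1.2) (z, r) := by
    ext z
    rw [sphTail, ← lintegral_indicator measurableSet_Ioi]
    rfl
  rw [e]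
  exact hm.lintegral_prod_right'

lemma DualStrichartz.shift {q r : ℝ} {C : ℝ≥0∞} (hS : DualStrichartz q r C)
    {f : E3 → ℝ≥0∞} (hf : Measurable f) {G : ℝ → E3 → ℝ≥0∞} (hG : Measurable (uncurry G)) (τ : ℝ) :
    ∫⁻ t, ∫⁻ x, sphMean f (t - τ) x * G t x ≤ C * (l2E f * mixDual q r G) := by
  rw [← mixDual_comp_add q r τ G]
  have e : ∫⁻ t, ∫⁻ x, sphMean f (t - τ) x * G t x =
      ∫⁻ t in Ioi (0:ℝ), ∫⁻ x, sphMean f t x * G (t + τ) x := by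
    rw [← lintegral_add_right_eq_self _ τ]
    simp only [add_sub_cancel_right]
    refine (setLIntegral_eq_of_support_subset fun t ht => ?_).symm
    by_contra h
    refine ht ?_
    simp [sphMean_of_nonpos f (not_lt.1 h)]
  rw [e]
  exact hS f hf _ (hG.comp (f := fun z : ℝ × E3 => (z.1 + τ, z.2)) (by fun_prop))

lemma DualStrichartz.duhamel {q r : ℝ} {C : ℝ≥0∞} (hC : C ≠ ∞) (hS : DualStrichartz q r C)
    {F : ℝ → E3 → ℝ≥0∞} (hF : Measurable (uncurry F)) {G : ℝ → E3 → ℝ≥0∞}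
    (hG : Measurable (uncurry G)) (J : Set ℝ) :
    ∫⁻ t, ∫⁻ x, (∫⁻ τ in J, sphMean (F τ) (t - τ) x) * G t x ≤
      C * ((∫⁻ τ in J, l2E (F τ)) * mixDual q r G) := by
  have hm := measurable_sphMean_joint hF
  have hGt : ∀ t, Measurable (G t) := fun t => hG.comp (measurable_const.prodMk measurable_id)
  have hm2 : Measurable fun z : (ℝ × E3) × ℝ => sphMean (F z.2) (z.1.1 - z.2) z.1.2 * G z.1.1 z.1.2 :=
    hm.mul (hG.comp (f := fun z : (ℝ × E3) × ℝ => z.1) measurable_fst)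
  calc _ = ∫⁻ t, ∫⁻ x, ∫⁻ τ in J, sphMean (F τ) (t - τ) x * G t x := by
        refine lintegral_congr fun t => lintegral_congr fun x => ?_
        rw [lintegral_mul_const]
        exact hm.comp (f := fun τ : ℝ => ((t, x), τ)) (by fun_prop)
    _ = ∫⁻ t, ∫⁻ τ in J, ∫⁻ x, sphMean (F τ) (t - τ) x * G t x := by
        refine lintegral_congr fun t => lintegral_lintegral_swap ?_
        exact (hm2.comp (f := fun z : E3 × ℝ => ((t, z.1), z.2)) (by fun_prop)).aemeasurable
    _ = ∫⁻ τ in J, ∫⁻ t, ∫⁻ x, sphMean (F τ) (t - τ) x * G t x := by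
        refine lintegral_lintegral_swap ?_
        have : Measurable fun z : (ℝ × ℝ) × E3 => sphMean (F z.1.2) (z.1.1 - z.1.2) z.2 * G z.1.1 z.2 :=
          hm2.comp (f := fun z : (ℝ × ℝ) × E3 => ((z.1.1, z.2), z.1.2)) (by fun_prop)
        exact this.lintegral_prod_right'.aemeasurable
    _ ≤ ∫⁻ τ in J, C * (l2E (F τ) * mixDual q r G) :=
        lintegral_mono fun τ => hS.shift (hF.comp (measurable_const.prodMk measurable_id)) hG τ
    _ = _ := by
        rw [lintegral_const_mul' _ _ hC, lintegral_mul_const]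
        exact measurable_xnorm hF _ _

lemma sphTail_eq {f : E3 → ℝ≥0∞} {t : ℝ} (ht : 0 < t) (x : E3) :
    sphTail f t x = ∫⁻ l in Ioi (1:ℝ), ENNReal.ofReal (1 / l) * sphMean f (l * t) x := by
  have h := setLIntegral_Ioi_comp_mul_left
    (fun r => ENNReal.ofReal (1 / r) * sphMean f r x) ht 1
  rw [mul_one] at h
  have h1 : ENNReal.ofReal t * ENNReal.ofReal t⁻¹ = 1 := by
    rw [← ENNReal.ofReal_mul ht.le, mul_inv_cancel₀ ht.ne', ENNReal.ofReal_one]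
  rw [sphTail, ← one_mul (∫⁻ r in Ioi t, _), ← h1, mul_assoc, ← h,
    ← lintegral_const_mul' _ _ ENNReal.ofReal_ne_top]
  refine setLIntegral_congr_fun measurableSet_Ioi fun l hl => ?_
  have hl0 : (0:ℝ) < l := zero_lt_one.trans hl
  rw [← mul_assoc, ← ENNReal.ofReal_mul ht.le, mul_comm l t]
  congr 2
  field_simp

lemma DualStrichartz.tail {q r : ℝ} {C : ℝ≥0∞} (hq : 1 < q) (hS : DualStrichartz q r C)
    {f : E3 → ℝ≥0∞} (hf : Measurable f) {G : ℝ → E3 → ℝ≥0∞} (hG : Measurable (uncurry G)) (τ : ℝ) :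
    ∫⁻ t in Ioi τ, ∫⁻ x, sphTail f (t - τ) x * G t x ≤
      C * ENNReal.ofReal q * (l2E f * mixDual q r G) := by
  have hq0 : 0 < q := by linarith
  wlog h0 : τ = 0 generalizing τ G with H
  · rw [← mixDual_comp_add q r τ G, setLIntegral_Ioi_shift]
    simpa using H (G := fun t => G (t + τ)) (hG.comp (f := fun z : ℝ × E3 => (z.1 + τ, z.2)) (by fun_prop)) 0 rfl
  subst h0
  simp only [sub_zero]
  have hm := measurable_sphMean hf
  have hm2 : Measurable fun z : (ℝ × E3) × ℝ =>
      ENNReal.ofReal (1 / z.2) * sphMean f (z.2 * z.1.1) z.1.2 * G z.1.1 z.1.2 := by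
    refine Measurable.mul (Measurable.mul (by fun_prop) ?_)
      (hG.comp (f := fun z : (ℝ × E3) × ℝ => z.1) measurable_fst)
    exact hm.comp (f := fun z : (ℝ × E3) × ℝ => (z.2 * z.1.1, z.1.2)) (by fun_prop)
  calc _ = ∫⁻ t in Ioi (0:ℝ), ∫⁻ x, ∫⁻ l in Ioi (1:ℝ),
          ENNReal.ofReal (1 / l) * sphMean f (l * t) x * G t x := by
        refine setLIntegral_congr_fun measurableSet_Ioi fun t ht => lintegral_congr fun x => ?_
        rw [sphTail_eq ht, lintegral_mul_const]
        refine Measurable.mul (by fun_prop) ?_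
        exact hm.comp (f := fun l : ℝ => (l * t, x)) (by fun_prop)
    _ = ∫⁻ t in Ioi (0:ℝ), ∫⁻ l in Ioi (1:ℝ), ∫⁻ x,
          ENNReal.ofReal (1 / l) * sphMean f (l * t) x * G t x := by
        refine lintegral_congr fun t => lintegral_lintegral_swap ?_
        exact (hm2.comp (f := fun z : E3 × ℝ => ((t, z.1), z.2)) (by fun_prop)).aemeasurable
    _ = ∫⁻ l in Ioi (1:ℝ), ∫⁻ t in Ioi (0:ℝ), ∫⁻ x,
          ENNReal.ofReal (1 / l) * sphMean f (l * t) x * G t x := by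
        refine lintegral_lintegral_swap ?_
        have : Measurable fun z : (ℝ × ℝ) × E3 =>
            ENNReal.ofReal (1 / z.1.2) * sphMean f (z.1.2 * z.1.1) z.2 * G z.1.1 z.2 :=
          hm2.comp (f := fun z : (ℝ × ℝ) × E3 => ((z.1.1, z.2), z.1.2)) (by fun_prop)
        exact this.lintegral_prod_right'.aemeasurable
    _ ≤ ∫⁻ l in Ioi (1:ℝ), C * (l2E f * mixDual q r G) * ENNReal.ofReal (l ^ (-1 - 1 / q)) := by
        refine setLIntegral_mono' measurableSet_Ioi fun l hl => ?_
        have hl0 : (0:ℝ) < l := zero_lt_one.trans hl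
        have e1 : ∫⁻ t in Ioi (0:ℝ), ∫⁻ x,
            ENNReal.ofReal (1 / l) * sphMean f (l * t) x * G t x =
            ENNReal.ofReal (1 / l) * (ENNReal.ofReal l⁻¹ *
              ∫⁻ t in Ioi (0:ℝ), ∫⁻ x, sphMean f t x * G (l⁻¹ * t) x) := by
          have := setLIntegral_Ioi_comp_mul_left
            (fun t => ∫⁻ x, sphMean f t x * G (l⁻¹ * t) x) hl0 0
          rw [mul_zero] at this
          rw [← this, ← lintegral_const_mul' _ _ ENNReal.ofReal_ne_top]
          refine lintegral_congr fun t => ?_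
          rw [← lintegral_const_mul' _ _ ENNReal.ofReal_ne_top]
          refine lintegral_congr fun x => ?_
          rw [inv_mul_cancel_left₀ hl0.ne', mul_assoc]
        rw [e1]
        have e2 := hS f hf (fun t => G (l⁻¹ * t))
          (hG.comp (f := fun z : ℝ × E3 => (l⁻¹ * z.1, z.2)) (by fun_prop))
        rw [mixDual_comp_mul hq (inv_pos.2 hl0)] at e2
        refine (mul_le_mul_right (mul_le_mul_right e2 _) _).trans (le_of_eq ?_)
        have e3 : ENNReal.ofReal (1 / l) * (ENNReal.ofReal l⁻¹ *
            ENNReal.ofReal (l⁻¹ ^ (-((q - 1) / q)))) = ENNReal.ofReal (l ^ (-1 - 1 / q)) := by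
          rw [← ENNReal.ofReal_mul (by positivity), ← ENNReal.ofReal_mul (by positivity)]
          congr 1
          have : -1 - 1 / q = (-1) + ((-1) + (q - 1) / q) := by field_simp; ring
          rw [this, Real.rpow_add hl0, Real.rpow_add hl0, Real.rpow_neg_one, one_div,
            Real.inv_rpow hl0.le, Real.rpow_neg hl0.le, inv_inv]
        rw [← e3]; ring
    _ = _ := by
        have h1 : -1 - 1 / q < -1 := by
          have : 0 < 1 / q := by positivity
          linarith
        rw [lintegral_const_mul _ (by fun_prop), lintegral_Ioi_rpow h1 one_pos, Real.one_rpow]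
        have : -1 / (-1 - 1 / q + 1) = q := by
          have : -1 - 1 / q + 1 = -(1 / q) := by ring
          rw [this]; field_simp
        rw [this]; ring

lemma mixE_mono {q r : ℝ} (hq : 0 < q) (hr : 0 < r) {V W : ℝ → E3 → ℝ≥0∞}
    (h : ∀ t x, V t x ≤ W t x) : mixE q r V ≤ mixE q r W := by
  unfold mixE
  refine ENNReal.rpow_le_rpow (lintegral_mono fun t => ENNReal.rpow_le_rpow
    (ENNReal.rpow_le_rpow (lintegral_mono fun x => ENNReal.rpow_le_rpow (h t x) hr.le)
    (by positivity)) hq.le) (by positivity)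

lemma mixE_le_of_tendsto {q r : ℝ} (hq : 0 < q) (hr : 0 < r) {W : ℝ → E3 → ℝ≥0∞}
    {V : ℕ → ℝ → E3 → ℝ≥0∞} (hV : ∀ n, Measurable (uncurry (V n)))
    (hmono : ∀ t x, Monotone fun n => V n t x)
    (hlim : ∀ t x, Filter.Tendsto (fun n => V n t x) Filter.atTop (nhds (W t x)))
    {M : ℝ≥0∞} (hM : ∀ n, mixE q r (V n) ≤ M) : mixE q r W ≤ M := by
  have hr1 : 0 < 1 / r := by positivity
  have hq1 : 0 < 1 / q := by positivity
  have h1 : ∀ t, Filter.Tendsto (fun n => ((∫⁻ x, V n t x ^ r) ^ (1 / r)) ^ q) Filter.atTop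
      (nhds (((∫⁻ x, W t x ^ r) ^ (1 / r)) ^ q)) := by
    intro t
    refine (ENNReal.continuous_rpow_const.tendsto _).comp
      ((ENNReal.continuous_rpow_const.tendsto _).comp ?_)
    refine lintegral_tendsto_of_tendsto_of_monotone (fun n => ?_)
      (Filter.Eventually.of_forall fun x m n hmn => ENNReal.rpow_le_rpow (hmono t x hmn) hr.le)
      (Filter.Eventually.of_forall fun x => (ENNReal.continuous_rpow_const.tendsto _).comp (hlim t x))
    exact (((hV n).comp (measurable_const.prodMk measurable_id)).pow_const r).aemeasurable
  have h2 : Filter.Tendsto (fun n => mixE q r (V n)) Filter.atTop (nhds (mixE q r W)) := by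
    refine (ENNReal.continuous_rpow_const.tendsto _).comp ?_
    refine lintegral_tendsto_of_tendsto_of_monotone (fun n => ?_)
      (Filter.Eventually.of_forall fun t m n hmn => ?_)
      (Filter.Eventually.of_forall h1)
    · exact ((measurable_xnorm (hV n) r (1 / r)).pow_const q).aemeasurable
    · exact ENNReal.rpow_le_rpow (ENNReal.rpow_le_rpow (lintegral_mono fun x =>
        ENNReal.rpow_le_rpow (hmono t x hmn) hr.le) hr1.le) hq.le
  exact le_of_tendsto' h2 hM

/-- A converse to Hölder's inequality for finite mixed norms. -/
lemma mixE_le_of_dual_of_finite {q r : ℝ} (hq : 1 < q) (hr : 1 < r) {W : ℝ → E3 → ℝ≥0∞}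
    (hW : Measurable (uncurry W)) (hfin : mixE q r W ≠ ∞) (hfin' : ∀ t, ∫⁻ x, W t x ^ r ≠ ∞)
    {M : ℝ≥0∞} (hM : ∀ G : ℝ → E3 → ℝ≥0∞, Measurable (uncurry G) →
      ∫⁻ t, ∫⁻ x, W t x * G t x ≤ M * mixDual q r G) : mixE q r W ≤ M := by
  have hq0 : 0 < q := by linarith
  have hr0 : 0 < r := by linarith
  have hq1 : 0 < q - 1 := by linarith
  have hr1 : 0 < r - 1 := by linarith
  set a : ℝ → ℝ≥0∞ := fun t => (∫⁻ x, W t x ^ r) ^ (1 / r) with ha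
  have ma : Measurable a := measurable_xnorm hW _ _
  have hWt : ∀ t, Measurable (W t) := fun t => hW.comp (measurable_const.prodMk measurable_id)
  have hat : ∀ t, a t ≠ ∞ := fun t => ENNReal.rpow_ne_top_of_nonneg (by positivity) (hfin' t)
  have har : ∀ t, ∫⁻ x, W t x ^ r = a t ^ r := fun t => by
    rw [ha, ← ENNReal.rpow_mul, one_div_mul_cancel hr0.ne', ENNReal.rpow_one]
  set I := ∫⁻ t, a t ^ q with hI
  have hA : mixE q r W = I ^ (1 / q) := rfl
  rcases eq_or_ne I 0 with h0 | h0
  · rw [hA, h0, ENNReal.zero_rpow_of_pos (by positivity)]; exact zero_le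
  have hIt : I ≠ ∞ := fun h => hfin (by rw [hA, h, ENNReal.top_rpow_of_pos (by positivity)])
  set G : ℝ → E3 → ℝ≥0∞ := fun t x => W t x ^ (r - 1) * a t ^ (q - r) with hG
  have mG : Measurable (uncurry G) := by
    have : Measurable fun z : ℝ × E3 => W z.1 z.2 ^ (r - 1) * a z.1 ^ (q - r) := by
      have h1 : Measurable fun z : ℝ × E3 => W z.1 z.2 := hW
      fun_prop
    exact this
  have hzero : ∀ t, a t = 0 → ∀ᵐ x, W t x = 0 := by
    intro t ht
    have := har t
    rw [ht, ENNReal.zero_rpow_of_pos hr0, lintegral_eq_zero_iff ((hWt t).pow_const r)] at this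
    filter_upwards [this] with x hx
    simpa [hr0, hr0.not_gt] using hx
  have h1 : ∫⁻ t, ∫⁻ x, W t x * G t x = I := by
    refine lintegral_congr fun t => ?_
    rcases eq_or_ne (a t) 0 with h | h
    · rw [h, ENNReal.zero_rpow_of_pos hq0]
      refine (lintegral_congr_ae ?_).trans lintegral_zero
      filter_upwards [hzero t h] with x hx
      rw [hx, zero_mul]
    · have e : ∀ x, W t x * G t x = a t ^ (q - r) * W t x ^ r := by
        intro x
        have : W t x ^ r = W t x * W t x ^ (r - 1) := by
          conv_rhs => rw [← ENNReal.rpow_one (W t x), ← ENNReal.rpow_mul, one_mul,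
            ← ENNReal.rpow_add_of_nonneg _ _ zero_le_one hr1.le]
          congr 1; ring
        rw [this, hG]; ring
      rw [lintegral_congr e, lintegral_const_mul _ ((hWt t).pow_const r), har,
        ← ENNReal.rpow_add _ _ h (hat t), sub_add_cancel]
  have h2 : mixDual q r G = I ^ ((q - 1) / q) := by
    unfold mixDual
    congr 1
    refine lintegral_congr fun t => ?_
    have hrr : 0 < r / (r - 1) := by positivity
    have hrr' : 0 < (r - 1) / r := by positivity
    have hqq : 0 < q / (q - 1) := by positivity
    rcases eq_or_ne (a t) 0 with h | h
    · have : ∫⁻ x, G t x ^ (r / (r - 1)) = 0 := by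
        refine (lintegral_congr_ae ?_).trans lintegral_zero
        filter_upwards [hzero t h] with x hx
        rw [hG]; dsimp only
        rw [hx, ENNReal.zero_rpow_of_pos hr1, zero_mul, ENNReal.zero_rpow_of_pos hrr]
      rw [this, h, ENNReal.zero_rpow_of_pos hrr', ENNReal.zero_rpow_of_pos hqq,
        ENNReal.zero_rpow_of_pos hq0]
    · have e : ∀ x, G t x ^ (r / (r - 1)) = (a t ^ (q - r)) ^ (r / (r - 1)) * W t x ^ r := by
        intro x
        rw [hG, ENNReal.mul_rpow_of_nonneg _ _ hrr.le, ← ENNReal.rpow_mul (W t x),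
          mul_div_cancel₀ _ hr1.ne', mul_comm]
      have e' : (a t ^ (q - r)) ^ (r / (r - 1)) * a t ^ r =
          a t ^ ((q - r) * (r / (r - 1)) + r) := by
        rw [← ENNReal.rpow_mul, ← ENNReal.rpow_add _ _ h (hat t)]
      rw [lintegral_congr e, lintegral_const_mul _ ((hWt t).pow_const r), har, e',
        ← ENNReal.rpow_mul, ← ENNReal.rpow_mul]
      congr 1
      field_simp
      ring
  have h3 := hM G mG
  rw [h1, h2] at h3
  have h4 : I = I ^ (1 / q) * I ^ ((q - 1) / q) := by
    rw [← ENNReal.rpow_add _ _ h0 hIt, ← add_div, add_sub_cancel, div_self hq0.ne', ENNReal.rpow_one]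
  rw [hA]
  have h5 : I ^ ((q - 1) / q) ≠ 0 := by simp [h0, hIt]
  have h6 : I ^ ((q - 1) / q) ≠ ∞ := ENNReal.rpow_ne_top_of_nonneg (by positivity) hIt
  rw [← ENNReal.mul_le_mul_iff_left h5 h6, ← h4]
  exact h3

lemma mixE_le_of_dual {q r : ℝ} (hq : 1 < q) (hr : 1 < r) {W : ℝ → E3 → ℝ≥0∞}
    (hW : Measurable (uncurry W)) {M : ℝ≥0∞} (hM : ∀ G : ℝ → E3 → ℝ≥0∞, Measurable (uncurry G) →
      ∫⁻ t, ∫⁻ x, W t x * G t x ≤ M * mixDual q r G) : mixE q r W ≤ M := by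
  have hq0 : 0 < q := by linarith
  have hr0 : 0 < r := by linarith
  set S : ℕ → Set (ℝ × E3) := fun n => Metric.closedBall 0 n ×ˢ Metric.closedBall 0 n with hS
  set V : ℕ → ℝ → E3 → ℝ≥0∞ := fun n t x => (S n).indicator (fun z => min (W z.1 z.2) n) (t, x)
    with hV
  have mV : ∀ n, Measurable (uncurry (V n)) := by
    intro n
    have : Measurable fun z : ℝ × E3 => (S n).indicator (fun z => min (W z.1 z.2) (n : ℝ≥0∞)) z := by
      refine Measurable.indicator ?_ (Metric.isClosed_closedBall.measurableSet.prod
        Metric.isClosed_closedBall.measurableSet)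
      exact Measurable.min hW measurable_const
    exact this
  have hVW : ∀ n t x, V n t x ≤ W t x := by
    intro n t x
    simp only [hV]
    refine (indicator_le_self _ _ _).trans (min_le_left _ _)
  have hbd : ∀ n t x, V n t x ≤ (Metric.closedBall (0:E3) n).indicator (fun _ => (n : ℝ≥0∞)) x := by
    intro n t x
    by_cases h : (t, x) ∈ S n
    · simp only [hV]
      rw [indicator_of_mem h, indicator_of_mem h.2]
      exact min_le_right _ _
    · simp only [hV]; rw [indicator_of_notMem h]; exact zero_le
  have hxb : ∀ n t, ∫⁻ x, V n t x ^ r ≤ (n : ℝ≥0∞) ^ r * volume (Metric.closedBall (0:E3) n) := by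
    intro n t
    rw [← setLIntegral_const, ← lintegral_indicator Metric.isClosed_closedBall.measurableSet]
    refine lintegral_mono fun x => ?_
    refine (ENNReal.rpow_le_rpow (hbd n t x) hr0.le).trans (le_of_eq ?_)
    by_cases h : x ∈ Metric.closedBall (0:E3) n
    · rw [indicator_of_mem h, indicator_of_mem h]
    · rw [indicator_of_notMem h, indicator_of_notMem h, ENNReal.zero_rpow_of_pos hr0]
  have hKt : ∀ n : ℕ, (n : ℝ≥0∞) ^ r * volume (Metric.closedBall (0:E3) n) ≠ ∞ := fun n =>
    ENNReal.mul_ne_top (ENNReal.rpow_ne_top_of_nonneg hr0.le (ENNReal.natCast_ne_top n))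
      measure_closedBall_lt_top.ne
  refine mixE_le_of_tendsto hq0 hr0 mV ?_ ?_ fun n => mixE_le_of_dual_of_finite hq hr (mV n) ?_ ?_ ?_
  · intro t x m n hmn
    have hmn' : (m : ℝ) ≤ n := by exact_mod_cast hmn
    have hsub : S m ⊆ S n := Set.prod_mono (Metric.closedBall_subset_closedBall hmn')
      (Metric.closedBall_subset_closedBall hmn')
    simp only [hV]
    refine (indicator_le_indicator_of_subset hsub (fun _ => zero_le) _).trans
      (indicator_le_indicator ?_)
    exact min_le_min le_rfl (by exact_mod_cast hmn)
  · intro t x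
    have h1 : ∀ᶠ n : ℕ in Filter.atTop, V n t x = min (W t x) n := by
      filter_upwards [Filter.eventually_ge_atTop ⌈max ‖t‖ ‖x‖⌉₊] with n hn
      have hn' := Nat.ceil_le.1 hn
      have : (t, x) ∈ S n := ⟨by simpa using (le_max_left _ _).trans hn',
        by simpa using (le_max_right _ _).trans hn'⟩
      simp only [hV]
      rw [indicator_of_mem this]
    refine Filter.Tendsto.congr' (h1.mono fun n h => h.symm) ?_
    have := (tendsto_const_nhds (x := W t x)).min ENNReal.tendsto_nat_nhds_top
    simpa using this
  · unfold mixE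
    refine ENNReal.rpow_ne_top_of_nonneg (by positivity) ?_
    refine ne_top_of_le_ne_top (b := (((n : ℝ≥0∞) ^ r *
      volume (Metric.closedBall (0:E3) n)) ^ (1 / r)) ^ q * volume (Metric.closedBall (0:ℝ) n))
      (ENNReal.mul_ne_top (ENNReal.rpow_ne_top_of_nonneg hq0.le
        (ENNReal.rpow_ne_top_of_nonneg (by positivity) (hKt n))) measure_closedBall_lt_top.ne) ?_
    rw [← setLIntegral_const, ← lintegral_indicator Metric.isClosed_closedBall.measurableSet]
    refine lintegral_mono fun t => ?_
    by_cases h : t ∈ Metric.closedBall (0:ℝ) n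
    · rw [indicator_of_mem h]
      exact ENNReal.rpow_le_rpow (ENNReal.rpow_le_rpow (hxb n t) (by positivity)) hq0.le
    · have : ∀ x, V n t x = 0 := fun x => indicator_of_notMem (fun hh => h hh.1) _
      simp only [this]
      rw [ENNReal.zero_rpow_of_pos hr0, lintegral_zero, ENNReal.zero_rpow_of_pos (by positivity),
        ENNReal.zero_rpow_of_pos hq0]
      exact zero_le
  · exact fun t => ne_top_of_le_ne_top (hKt n) (hxb n t)
  · exact fun G hG => (lintegral_mono fun t => lintegral_mono fun x =>
      mul_le_mul_left (hVW n t x) _).trans (hM G hG)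

lemma sum_map_single_mul {F : Type*} [AddCommGroup F] [Module ℝ F] (A : E3 →ₗ[ℝ] F) (y : E3) :
    ∑ i : Fin 3, y i • A (EuclideanSpace.single i 1) = A y := by
  conv_rhs => rw [← (EuclideanSpace.basisFun (Fin 3) ℝ).sum_repr y]
  simp [map_sum]

lemma sum_sq_E3 (y : E3) : ∑ i : Fin 3, y i * y i = ‖y‖ ^ 2 := by
  rw [EuclideanSpace.norm_sq_eq]
  exact Finset.sum_congr rfl fun i _ => by rw [Real.norm_eq_abs, sq_abs, sq]

/-- A smooth radial cutoff whose profile is supported away from the origin. -/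
lemma exists_radial_profile {c : ℝ → ℝ} (hc : ContDiff ℝ (⊤ : ℕ∞) c)
    (hs : tsupport c ⊆ Ioi 0) :
    ∃ b : ℝ → ℝ, ContDiff ℝ (⊤ : ℕ∞) b ∧ ∀ y : E3, c ‖y‖ = b (‖y‖ ^ 2) := by
  refine ⟨fun v => c (Real.sqrt v), ?_, fun y => by simp [Real.sqrt_sq (norm_nonneg y)]⟩
  rw [contDiff_iff_contDiffAt]
  intro v
  rcases eq_or_ne v 0 with rfl | hv
  · have h0 : (0:ℝ) ∉ tsupport c := fun h => lt_irrefl (0:ℝ) (hs h)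
    have h1 : ∀ᶠ v in nhds (0:ℝ), c (Real.sqrt v) = 0 := by
      have : ∀ᶠ w in nhds (Real.sqrt 0), c w = 0 := by
        rw [Real.sqrt_zero]
        exact notMem_tsupport_iff_eventuallyEq.1 h0
      exact Real.continuous_sqrt.continuousAt.eventually this
    exact (contDiffAt_const (c := (0:ℝ))).congr_of_eventuallyEq h1
  · exact hc.contDiffAt.comp v (Real.contDiffAt_sqrt hv)

lemma integral_radial_mul_div_eq_zero {D : E3 → E3 →L[ℝ] ℝ} {D2 : E3 → E3 →L[ℝ] E3 →L[ℝ] ℝ}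
    (hD : ∀ y, HasFDerivAt D (D2 y) y) (hD2 : Continuous D2) {c : ℝ → ℝ}
    (hc : ContDiff ℝ (⊤ : ℕ∞) c) (hcs : HasCompactSupport c) (hs : tsupport c ⊆ Ioi 0) :
    ∫ y : E3, c ‖y‖ * (D2 y y y + 2 * D y y - ‖y‖ ^ 2 *
      ∑ i : Fin 3, D2 y (EuclideanSpace.single i 1) (EuclideanSpace.single i 1)) = 0 := by
  obtain ⟨b, hb, hbc⟩ := exists_radial_profile hc hs
  have hDc : Continuous D := continuous_iff_continuousAt.2 fun y => (hD y).continuousAt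
  obtain ⟨φ, hφ⟩ : ∃ φ : E3 → ℝ, φ = fun y => b (‖y‖ ^ 2) := ⟨_, rfl⟩
  have hφs : HasCompactSupport φ := by
    obtain ⟨R, hR⟩ := hcs.isCompact.isBounded.subset_closedBall 0
    refine HasCompactSupport.intro (isCompact_closedBall (0:E3) R) fun y hy => ?_
    rw [hφ]; dsimp only
    rw [← hbc]
    refine image_eq_zero_of_notMem_tsupport fun h => hy ?_
    have := hR h
    simpa using this
  have hφc : Continuous φ := by rw [hφ]; exact hb.continuous.comp (by fun_prop)
  have hφd : ∀ y, HasFDerivAt φ ((2 * deriv b (‖y‖ ^ 2)) • innerSL ℝ y) y := by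
    intro y
    have h1 := (hasStrictFDerivAt_norm_sq y).hasFDerivAt
    have h2 := ((hb.differentiable (by simp)) (‖y‖ ^ 2)).hasDerivAt
    have h3 := h2.comp_hasFDerivAt y h1
    rw [hφ]
    refine h3.congr_fderiv ?_
    ext v; simp; ring
  have hbd : Continuous (deriv b) := hb.continuous_deriv (by simp)
  obtain ⟨g, hg⟩ : ∃ g : Fin 3 → E3 → ℝ, g = fun i y => D y y * y i - ‖y‖ ^ 2 *
    D y (EuclideanSpace.single i 1) := ⟨_, rfl⟩
  obtain ⟨g', hg'⟩ : ∃ g' : Fin 3 → E3 → ℝ, g' = fun i y =>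
    (D2 y (EuclideanSpace.single i 1) y + D y (EuclideanSpace.single i 1)) * y i + D y y
      - (2 * y i * D y (EuclideanSpace.single i 1) + ‖y‖ ^ 2 *
        D2 y (EuclideanSpace.single i 1) (EuclideanSpace.single i 1)) := ⟨_, rfl⟩
  have hgc : ∀ i, Continuous (g i) := by intro i; rw [hg]; fun_prop
  have hgc' : ∀ i, Continuous (g' i) := by intro i; rw [hg']; fun_prop
  have hcoord : ∀ i : Fin 3, ∀ y, HasFDerivAt (fun y : E3 => y i)
      (EuclideanSpace.proj i : E3 →L[ℝ] ℝ) y := fun i y =>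
    (EuclideanSpace.proj i : E3 →L[ℝ] ℝ).hasFDerivAt
  have hgd : ∀ i y, DifferentiableAt ℝ (g i) y ∧
      fderiv ℝ (g i) y (EuclideanSpace.single i 1) = g' i y := by
    intro i y
    have h1 := ((hD y).clm_apply (hasFDerivAt_id y)).mul (hcoord i y)
    have h2 := (hasStrictFDerivAt_norm_sq y).hasFDerivAt.mul
      ((hD y).clm_apply (hasFDerivAt_const (EuclideanSpace.single i (1:ℝ)) y))
    have h3 := h1.sub h2
    have e : g i = (fun y => D y (id y) * y i) - (fun y => ‖y‖ ^ 2 *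
      D y (EuclideanSpace.single i 1)) := by rw [hg]; rfl
    rw [e]
    refine ⟨h3.differentiableAt, ?_⟩
    erw [h3.fderiv]
    rw [hg']
    simp [EuclideanSpace.inner_single_right]
    ring
  have hint : ∀ {p : E3 → ℝ}, Continuous p → HasCompactSupport p → Integrable p := fun h h' =>
    h.integrable_of_hasCompactSupport h'
  have hfφ : ∀ i : Fin 3, ∀ y, fderiv ℝ φ y (EuclideanSpace.single i 1) = 2 * deriv b (‖y‖ ^ 2) * y i := by
    intro i y
    rw [(hφd y).fderiv]
    simp [EuclideanSpace.inner_single_right]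
  have hibp : ∀ i : Fin 3, ∫ y, φ y * g' i y = - ∫ y, (2 * deriv b (‖y‖ ^ 2) * y i) * g i y := by
    intro i
    have hcs1 : HasCompactSupport fun y : E3 => 2 * deriv b (‖y‖ ^ 2) * y i := by
      simp_rw [← hfφ i]
      exact hφs.fderiv_apply ℝ _
    have := integral_mul_fderiv_eq_neg_fderiv_mul_of_integrable (μ := (volume : Measure E3))
      (f := φ) (g := g i) (v := EuclideanSpace.single i 1)
      (by simp_rw [hfφ i]; exact hint (by have := hgc i; fun_prop) hcs1.mul_right)
      (by simp_rw [(hgd i _).2]; exact hint (hφc.mul (hgc' i)) hφs.mul_right)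
      (hint (hφc.mul (hgc i)) hφs.mul_right)
      (fun y _ => (hφd y).differentiableAt) (fun y _ => (hgd i y).1)
    simp_rw [hfφ i, (hgd i _).2] at this
    exact this
  have hint1 : ∀ i : Fin 3, Integrable fun y => φ y * g' i y := fun i =>
    hint (hφc.mul (hgc' i)) hφs.mul_right
  have hint2 : ∀ i : Fin 3, Integrable fun y => (2 * deriv b (‖y‖ ^ 2) * y i) * g i y := by
    intro i
    have hcs1 : HasCompactSupport fun y : E3 => 2 * deriv b (‖y‖ ^ 2) * y i := by
      simp_rw [← hfφ i]
      exact hφs.fderiv_apply ℝ _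
    exact hint (by have := hgc i; fun_prop) hcs1.mul_right
  calc _ = ∫ y, ∑ i : Fin 3, φ y * g' i y := by
        refine integral_congr_ae (Filter.Eventually.of_forall fun y => ?_)
        dsimp only
        rw [← Finset.mul_sum, hbc, hφ, hg']
        dsimp only
        congr 1
        have e1 := sum_map_single_mul (D2 y : E3 →ₗ[ℝ] E3 →L[ℝ] ℝ) y
        have e1' := congrArg (fun A : E3 →L[ℝ] ℝ => A y) e1
        have e2 := sum_map_single_mul (D y : E3 →ₗ[ℝ] ℝ) y
        simp only [Fin.sum_univ_three, ContinuousLinearMap.coe_coe, smul_eq_mul,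
          add_apply, smul_apply] at e1' e2 ⊢
        linear_combination -e1' + e2
    _ = ∑ i : Fin 3, ∫ y, φ y * g' i y := integral_finsetSum _ fun i _ => hint1 i
    _ = - ∫ y, ∑ i : Fin 3, (2 * deriv b (‖y‖ ^ 2) * y i) * g i y := by
        rw [integral_finsetSum _ fun i _ => hint2 i, ← Finset.sum_neg_distrib]
        exact Finset.sum_congr rfl fun i _ => hibp i
    _ = 0 := by
        rw [neg_eq_zero]
        refine (integral_congr_ae (Filter.Eventually.of_forall fun y => ?_)).trans
          (integral_zero E3 ℝ)
        dsimp only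
        have e2 := sum_map_single_mul (D y : E3 →ₗ[ℝ] ℝ) y
        have e3 := sum_sq_E3 y
        rw [hg]
        simp only [Fin.sum_univ_three, ContinuousLinearMap.coe_coe, smul_eq_mul] at e2 e3 ⊢
        linear_combination (2 * deriv b (‖y‖ ^ 2) * D y y) * e3 -
          (2 * deriv b (‖y‖ ^ 2) * ‖y‖ ^ 2) * e2

/-- The divergence theorem on spheres for the gradient-type field `D`, differentiated in the
radius. -/
lemma integral_sphere_div {D : E3 → E3 →L[ℝ] ℝ} {D2 : E3 → E3 →L[ℝ] E3 →L[ℝ] ℝ}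
    (hD : ∀ y, HasFDerivAt D (D2 y) y) (hD2 : Continuous D2) (x : E3) {ρ : ℝ} (hρ : 0 < ρ) :
    ∫ ω : Metric.sphere (0:E3) 1, (ρ * D2 (x + ρ • (ω:E3)) ω ω + 2 * D (x + ρ • (ω:E3)) ω
      - ρ * ∑ i : Fin 3, D2 (x + ρ • (ω:E3)) (EuclideanSpace.single i 1)
        (EuclideanSpace.single i 1)) ∂sphMeas = 0 := by
  have hDc : Continuous D := continuous_iff_continuousAt.2 fun y => (hD y).continuousAt
  obtain ⟨H, hH⟩ : ∃ H : ℝ → ℝ, H = fun r => ∫ ω : Metric.sphere (0:E3) 1,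
    (r * D2 (x + r • (ω:E3)) ω ω + 2 * D (x + r • (ω:E3)) ω
      - r * ∑ i : Fin 3, D2 (x + r • (ω:E3)) (EuclideanSpace.single i 1)
        (EuclideanSpace.single i 1)) ∂sphMeas := ⟨_, rfl⟩
  have hHc : Continuous H := by
    have hf : Continuous (uncurry fun (r : ℝ) (ω : Metric.sphere (0:E3) 1) =>
        r * D2 (x + r • (ω:E3)) ω ω + 2 * D (x + r • (ω:E3)) ω
        - r * ∑ i : Fin 3, D2 (x + r • (ω:E3)) (EuclideanSpace.single i 1)
          (EuclideanSpace.single i 1)) := by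
      unfold uncurry
      fun_prop
    have := continuous_parametric_integral_of_continuous (μ := sphMeas) hf isCompact_univ
    simp_rw [Measure.restrict_univ] at this
    rw [hH]
    exact this
  have hD' : ∀ y, HasFDerivAt (fun y => D (x + y)) (D2 (x + y)) y := fun y => by
    have h1 : HasFDerivAt (fun y : E3 => x + y) (ContinuousLinearMap.id ℝ E3) y :=
      (hasFDerivAt_id y).const_add x
    have := (hD (x + y)).comp y h1
    exact this.congr_fderiv (by ext; rfl)
  have key : ∀ᵐ r : ℝ, r ∈ Ioi (0:ℝ) → r ^ 3 * H r = 0 := by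
    refine isOpen_Ioi.ae_eq_zero_of_integral_contDiff_smul_eq_zero ?_ ?_
    · exact (Continuous.locallyIntegrable (by fun_prop)).locallyIntegrableOn _
    · intro c hc hcs hs
      have h0 := integral_radial_mul_div_eq_zero hD' (by fun_prop) hc hcs hs
      rw [integral_polar] at h0
      · rw [← h0, ← integral_indicator measurableSet_Ioi]
        refine integral_congr_ae (Filter.Eventually.of_forall fun r => ?_)
        dsimp only
        by_cases hr : r ∈ Ioi (0:ℝ)
        · rw [indicator_of_mem hr, hH, smul_eq_mul, ← integral_const_mul, ← integral_const_mul,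
            ← integral_const_mul]
          refine integral_congr_ae (Filter.Eventually.of_forall fun ω => ?_)
          dsimp only
          have : ‖r • (ω:E3)‖ = r := by
            rw [norm_smul, norm_eq_of_mem_sphere, mul_one, Real.norm_of_nonneg (le_of_lt hr)]
          rw [this]
          simp only [map_smul, smul_apply, smul_eq_mul]
          ring
        · rw [indicator_of_notMem hr, image_eq_zero_of_notMem_tsupport fun h => hr (hs h), zero_smul]
      · have hcc := hc.continuous
        refine Continuous.integrable_of_hasCompactSupport (by fun_prop) ?_
        refine HasCompactSupport.mul_right ?_
        obtain ⟨R, hR⟩ := hcs.isCompact.isBounded.subset_closedBall 0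
        refine HasCompactSupport.intro (isCompact_closedBall (0:E3) R) fun y hy => ?_
        refine image_eq_zero_of_notMem_tsupport fun h => hy ?_
        have := hR h
        simpa using this
  have key2 : (fun r => r ^ 3 * H r) =ᵐ[volume.restrict (Ioi (0:ℝ))] fun _ => 0 := by
    rw [Filter.EventuallyEq, ae_restrict_iff' measurableSet_Ioi]
    exact key
  have := Measure.eqOn_open_of_ae_eq key2 isOpen_Ioi (by fun_prop) (by fun_prop) hρ
  have h := (mul_eq_zero.1 this).resolve_left (by positivity)
  rw [hH] at h
  exact h

/-- The wave operator `∂ₜ² − Δ` on space-time, in terms of the second derivative. -/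
def boxOp (V : ℝ × E3 → ℝ) (z : ℝ × E3) : ℝ :=
  fderiv ℝ (fderiv ℝ V) z (1, 0) (1, 0) - ∑ i : Fin 3, fderiv ℝ (fderiv ℝ V) z
    (0, EuclideanSpace.single i 1) (0, EuclideanSpace.single i 1)

lemma integrable_Ioc_prod_sphMeas {f : ℝ → Metric.sphere (0:E3) 1 → ℝ}
    (hf : Continuous (uncurry f)) (a b : ℝ) :
    Integrable (uncurry f) ((volume.restrict (Set.uIoc a b)).prod sphMeas) := by
  have h1 : IntegrableOn (uncurry f) (Set.uIcc a b ×ˢ univ) ((volume : Measure ℝ).prod sphMeas) :=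
    hf.continuousOn.integrableOn_compact (isCompact_uIcc.prod isCompact_univ)
  have h2 := h1.mono_set (Set.prod_mono (uIoc_subset_uIcc (a := a) (b := b)) (subset_refl univ))
  rw [IntegrableOn, ← Measure.prod_restrict, Measure.restrict_univ] at h2
  exact h2

/-- Kirchhoff's formula along backward light cones. -/
lemma kirchhoff {V : ℝ × E3 → ℝ} (hV : ContDiff ℝ (⊤ : ℕ∞) V) {a t : ℝ} (hat : a ≤ t) (x : E3) :
    (sphMeas univ).toReal * V (t, x) =
      ∫ ω : Metric.sphere (0:E3) 1, ((t - a) * fderiv ℝ V (a, x + (t - a) • (ω:E3)) (1, (ω:E3))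
        + V (a, x + (t - a) • (ω:E3))) ∂sphMeas +
      ∫ τ in a..t, (t - τ) * ∫ ω : Metric.sphere (0:E3) 1, boxOp V (τ, x + (t - τ) • (ω:E3)) ∂sphMeas := by
  obtain ⟨L, hL⟩ : ∃ L, L = fderiv ℝ V := ⟨_, rfl⟩
  obtain ⟨M, hM⟩ : ∃ M, M = fderiv ℝ L := ⟨_, rfl⟩
  have cL : ContDiff ℝ (⊤ : ℕ∞) L := by rw [hL]; exact hV.fderiv_right (by simp)
  have cM : ContDiff ℝ (⊤ : ℕ∞) M := by rw [hM]; exact cL.fderiv_right (by simp)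
  have hV' : ∀ z, HasFDerivAt V (L z) z := fun z => by
    rw [hL]; exact (hV.differentiable (by simp) z).hasFDerivAt
  have hL' : ∀ z, HasFDerivAt L (M z) z := fun z => by
    rw [hM]; exact (cL.differentiable (by simp) z).hasFDerivAt
  have ccV := hV.continuous
  have ccL := cL.continuous
  have ccM := cM.continuous
  have hsymm : ∀ z v w, M z v w = M z w v := fun z v w => by
    have := (hV.contDiffAt (x := z)).isSymmSndFDerivAt
      (by simp only [minSmoothness_of_isRCLikeNormedField]; exact WithTop.coe_le_coe.2 (le_top : (2:ℕ∞) ≤ ⊤))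
    rw [hM, hL]
    exact this v w
  obtain ⟨p, hp⟩ : ∃ p : ℝ → Metric.sphere (0:E3) 1 → ℝ, p = fun (τ : ℝ) (ω : Metric.sphere (0:E3) 1) =>
    (t - τ) * L (τ, x + (t - τ) • (ω:E3)) (1, (ω:E3)) + V (τ, x + (t - τ) • (ω:E3)) := ⟨_, rfl⟩
  obtain ⟨p', hp'⟩ : ∃ p' : ℝ → Metric.sphere (0:E3) 1 → ℝ, p' = fun (τ : ℝ) (ω : Metric.sphere (0:E3) 1) =>
    - L (τ, x + (t - τ) • (ω:E3)) (1, (ω:E3)) +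
      (t - τ) * M (τ, x + (t - τ) • (ω:E3)) (1, -(ω:E3)) (1, (ω:E3)) +
      L (τ, x + (t - τ) • (ω:E3)) (1, -(ω:E3)) := ⟨_, rfl⟩
  have cp' : Continuous (uncurry p') := by rw [hp']; unfold uncurry; fun_prop
  have cp : ∀ τ, Continuous (p τ) := by intro τ; rw [hp]; fun_prop
  have hder : ∀ τ ω, HasDerivAt (fun τ => p τ ω) (p' τ ω) τ := by
    intro τ ω
    have h0 : HasDerivAt (fun τ : ℝ => t - τ) (-1) τ := by
      simpa using (hasDerivAt_id τ).const_sub t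
    have hγ : HasDerivAt (fun τ : ℝ => (τ, x + (t - τ) • (ω:E3))) ((1:ℝ), -(ω:E3)) τ := by
      have := (h0.smul_const (ω:E3)).const_add x
      rw [neg_one_smul] at this
      exact (hasDerivAt_id τ).prodMk this
    have hLγ := (hL' (τ, x + (t - τ) • (ω:E3))).comp_hasDerivAt τ hγ
    have hLγ' := hLγ.clm_apply (hasDerivAt_const τ ((1:ℝ), (ω:E3)))
    have hVγ := (hV' (τ, x + (t - τ) • (ω:E3))).comp_hasDerivAt τ hγ
    have := (h0.mul hLγ').add hVγ
    rw [hp, hp']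
    refine HasDerivAt.congr_deriv this ?_
    simp
  have hftc : ∀ ω, ∫ τ in a..t, p' τ ω = p t ω - p a ω := fun ω =>
    intervalIntegral.integral_eq_sub_of_hasDerivAt (fun τ _ => hder τ ω)
      ((cp'.comp (by fun_prop : Continuous fun τ : ℝ => (τ, ω))).intervalIntegrable _ _)
  have hpt : ∀ ω, p t ω = V (t, x) := fun ω => by rw [hp]; simp
  have hint : ∀ τ, Integrable (p τ) sphMeas := fun τ =>
    (cp τ).integrable_of_hasCompactSupport (HasCompactSupport.of_compactSpace _)
  have hswap := intervalIntegral_integral_swap (integrable_Ioc_prod_sphMeas cp' a t)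
  simp_rw [hftc, hpt] at hswap
  rw [integral_sub (integrable_const _) (hint a), integral_const, smul_eq_mul,
    Measure.real_def] at hswap
  have hdiv : ∀ τ ∈ Set.uIoo a t, ∫ ω, p' τ ω ∂sphMeas =
      (t - τ) * ∫ ω : Metric.sphere (0:E3) 1, boxOp V (τ, x + (t - τ) • (ω:E3)) ∂sphMeas := by
    intro τ hτ
    rw [uIoo_of_le hat] at hτ
    have hρ : 0 < t - τ := sub_pos.2 hτ.2
    have hD : ∀ y : E3, HasFDerivAt (fun y => (L (τ, y)).comp (ContinuousLinearMap.inr ℝ ℝ E3))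
        (((ContinuousLinearMap.compL ℝ E3 (ℝ × E3) ℝ).flip (ContinuousLinearMap.inr ℝ ℝ E3)).comp
          ((M (τ, y)).comp (ContinuousLinearMap.inr ℝ ℝ E3))) y := by
      intro y
      have h1 : HasFDerivAt (fun y : E3 => (τ, y)) (ContinuousLinearMap.inr ℝ ℝ E3) y :=
        hasFDerivAt_prodMk_right τ y
      have h2 := (hL' (τ, y)).comp y h1
      exact (((ContinuousLinearMap.compL ℝ E3 (ℝ × E3) ℝ).flip
        (ContinuousLinearMap.inr ℝ ℝ E3)).hasFDerivAt).comp y h2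
    have h0 := integral_sphere_div hD (by fun_prop) x hρ
    have hc1 : Continuous (p' τ) := cp'.comp (by fun_prop : Continuous fun ω : Metric.sphere (0:E3) 1 => (τ, ω))
    have hc2 : Continuous fun ω : Metric.sphere (0:E3) 1 => boxOp V (τ, x + (t - τ) • (ω:E3)) := by
      unfold boxOp
      rw [← hL, ← hM]
      fun_prop
    rw [← integral_const_mul, ← sub_eq_zero, ← integral_sub
      (hc1.integrable_of_hasCompactSupport (HasCompactSupport.of_compactSpace _))
      ((hc2.const_mul (t - τ)).integrable_of_hasCompactSupport (HasCompactSupport.of_compactSpace _)),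
      ← neg_eq_zero, ← integral_neg, ← h0]
    refine integral_congr_ae (Filter.Eventually.of_forall fun ω => ?_)
    dsimp only
    obtain ⟨z, hz⟩ : ∃ z, z = (τ, x + (t - τ) • (ω:E3)) := ⟨_, rfl⟩
    rw [hp']
    simp only [boxOp]
    rw [← hL, ← hM, ← hz]
    simp only [ContinuousLinearMap.comp_apply, ContinuousLinearMap.flip_apply,
      ContinuousLinearMap.compL_apply, ContinuousLinearMap.inr_apply]
    have e1 : ((1:ℝ), (ω:E3)) = (1, 0) + (0, (ω:E3)) := by simp
    have e2 : ((1:ℝ), -(ω:E3)) = (1, 0) - (0, (ω:E3)) := by simp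
    rw [e1, e2]
    simp only [map_add, map_sub, sub_apply]
    rw [hsymm z (1, 0) (0, (ω:E3))]
    ring
  rw [intervalIntegral.integral_congr_uIoo hdiv] at hswap
  rw [hswap, hp, ← hL]
  ring

lemma sphTail_eq_lintegral_ray {f : E3 → ℝ≥0∞} {ρ : ℝ} (hρ : 0 ≤ ρ) (x : E3) :
    sphTail f ρ x = ∫⁻ r in Ioi ρ, ∫⁻ ω, f (x + r • (ω : E3)) ∂sphMeas := by
  refine setLIntegral_congr_fun measurableSet_Ioi fun r hr => ?_
  have hr0 : 0 < r := hρ.trans_lt hr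
  rw [sphMean, ← mul_assoc, ← ENNReal.ofReal_mul (by positivity), one_div_mul_cancel hr0.ne',
    ENNReal.ofReal_one, one_mul]

lemma enorm_le_lintegral_ray {f : E3 → ℝ} (hf : ContDiff ℝ (⊤ : ℕ∞) f)
    (hlim : Filter.Tendsto f (Filter.cocompact E3) (nhds 0)) (x : E3) (ρ : ℝ)
    (ω : Metric.sphere (0:E3) 1) :
    ‖f (x + ρ • (ω:E3))‖ₑ ≤ ∫⁻ r in Ioi ρ, ‖fderiv ℝ f (x + r • (ω:E3))‖ₑ := by
  have hω : ‖(ω:E3)‖ = 1 := norm_eq_of_mem_sphere ω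
  have hc : Continuous (fderiv ℝ f) := hf.continuous_fderiv (by simp)
  have hder : ∀ r, HasDerivAt (fun r : ℝ => f (x + r • (ω:E3)))
      (fderiv ℝ f (x + r • (ω:E3)) ω) r := by
    intro r
    have h1 : HasDerivAt (fun r : ℝ => x + r • (ω:E3)) (ω:E3) r := by
      simpa using ((hasDerivAt_id r).smul_const (ω:E3)).const_add x
    exact (hf.differentiable (by simp) _).hasFDerivAt.comp_hasDerivAt r h1
  have hray : Filter.Tendsto (fun r : ℝ => x + r • (ω:E3)) Filter.atTop (Filter.cocompact E3) := by
    rw [← Metric.cobounded_eq_cocompact, ← tendsto_norm_atTop_iff_cobounded]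
    refine Filter.tendsto_atTop_mono (f := fun r : ℝ => r - ‖x‖) (fun r => ?_)
      (Filter.tendsto_atTop_add_const_right _ _ Filter.tendsto_id)
    have h1 : ‖r • (ω:E3)‖ ≤ ‖x + r • (ω:E3)‖ + ‖x‖ := by
      simpa using norm_sub_le (x + r • (ω:E3)) x
    rw [norm_smul, hω, mul_one, Real.norm_eq_abs] at h1
    linarith [le_abs_self r]
  have hle : ∀ᶠ R : ℝ in Filter.atTop, ‖f (x + ρ • (ω:E3))‖ₑ ≤ ‖f (x + R • (ω:E3))‖ₑ +
      ∫⁻ r in Ioi ρ, ‖fderiv ℝ f (x + r • (ω:E3))‖ₑ := by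
    filter_upwards [Filter.eventually_ge_atTop ρ] with R hR
    have h1 := intervalIntegral.integral_eq_sub_of_hasDerivAt (a := ρ) (b := R)
      (fun r _ => hder r)
      ((show Continuous fun r : ℝ => fderiv ℝ f (x + r • (ω:E3)) ω by fun_prop).intervalIntegrable _ _)
    have h2 : f (x + ρ • (ω:E3)) = f (x + R • (ω:E3)) -
        ∫ r in ρ..R, fderiv ℝ f (x + r • (ω:E3)) ω := by rw [h1]; ring
    rw [h2]
    refine enorm_sub_le.trans (add_le_add le_rfl ?_)
    rw [intervalIntegral.integral_of_le hR]
    refine (enorm_integral_le_lintegral_enorm _).trans ?_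
    refine (lintegral_mono_set Ioc_subset_Ioi_self).trans (lintegral_mono fun r => ?_)
    rw [← ofReal_norm, ← ofReal_norm]
    refine ENNReal.ofReal_le_ofReal ?_
    simpa [hω] using (fderiv ℝ f (x + r • (ω:E3))).le_opNorm (ω:E3)
  have hlim' : Filter.Tendsto (fun R : ℝ => ‖f (x + R • (ω:E3))‖ₑ +
      ∫⁻ r in Ioi ρ, ‖fderiv ℝ f (x + r • (ω:E3))‖ₑ) Filter.atTop
      (nhds (0 + ∫⁻ r in Ioi ρ, ‖fderiv ℝ f (x + r • (ω:E3))‖ₑ)) := by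
    refine Filter.Tendsto.add_const _ ?_
    simpa using (hlim.comp hray).enorm
  rw [zero_add] at hlim'
  exact ge_of_tendsto hlim' hle

/-- Pointwise control of a solution by spherical means of its data and of its nonlinearity. -/
lemma kirchhoff_bound {V : ℝ × E3 → ℝ} (hV : ContDiff ℝ (⊤ : ℕ∞) V) {a t : ℝ} (hat : a ≤ t) (x : E3)
    (hlim : Filter.Tendsto (fun y => V (a, y)) (Filter.cocompact E3) (nhds 0))
    (hbox : ∀ τ ∈ Ioo a t, ∀ y, boxOp V (τ, y) = - V (τ, y) ^ 5) :
    sphMeas univ * ‖V (t, x)‖ₑ ≤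
      sphMean (fun y => ‖fderiv ℝ V (a, y) (1, 0)‖ₑ) (t - a) x +
      sphMean (fun y => ‖fderiv ℝ (fun y => V (a, y)) y‖ₑ) (t - a) x +
      sphTail (fun y => ‖fderiv ℝ (fun y => V (a, y)) y‖ₑ) (t - a) x +
      ∫⁻ τ in Ioo a t, sphMean (fun y => ‖V (τ, y)‖ₑ ^ (5:ℝ)) (t - τ) x := by
  have hVa : ContDiff ℝ (⊤ : ℕ∞) fun y => V (a, y) := by fun_prop
  have hρ : 0 ≤ t - a := sub_nonneg.2 hat
  have hω : ∀ ω : Metric.sphere (0:E3) 1, ‖(ω:E3)‖ = 1 := norm_eq_of_mem_sphere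
  have hcV := hV.continuous
  have hcL : Continuous (fderiv ℝ V) := hV.continuous_fderiv (by simp)
  have hcLa : Continuous (fderiv ℝ fun y => V (a, y)) := hVa.continuous_fderiv (by simp)
  have hLa : ∀ y, fderiv ℝ (fun y => V (a, y)) y =
      (fderiv ℝ V (a, y)).comp (ContinuousLinearMap.inr ℝ ℝ E3) := fun y =>
    ((hV.differentiable (by simp) (a, y)).hasFDerivAt.comp y (hasFDerivAt_prodMk_right a y)).fderiv
  have h0 := congrArg (fun r : ℝ => ‖r‖ₑ) (kirchhoff hV hat x)
  rw [enorm_mul, Real.enorm_of_nonneg ENNReal.toReal_nonneg,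
    ENNReal.ofReal_toReal (measure_ne_top _ _)] at h0
  rw [h0]
  refine (enorm_add_le _ _).trans (add_le_add ?_ ?_)
  · refine (enorm_integral_le_lintegral_enorm _).trans ?_
    have hpt : ∀ ω : Metric.sphere (0:E3) 1,
        ‖(t - a) * fderiv ℝ V (a, x + (t - a) • (ω:E3)) (1, (ω:E3)) + V (a, x + (t - a) • (ω:E3))‖ₑ ≤
        ENNReal.ofReal (t - a) * ‖fderiv ℝ V (a, x + (t - a) • (ω:E3)) (1, 0)‖ₑ +
        ENNReal.ofReal (t - a) * ‖fderiv ℝ (fun y => V (a, y)) (x + (t - a) • (ω:E3))‖ₑ +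
        ∫⁻ r in Ioi (t - a), ‖fderiv ℝ (fun y => V (a, y)) (x + r • (ω:E3))‖ₑ := by
      intro ω
      refine (enorm_add_le _ _).trans (add_le_add ?_
        (enorm_le_lintegral_ray hVa hlim x (t - a) ω))
      rw [enorm_mul, Real.enorm_of_nonneg hρ, ← mul_add]
      refine mul_le_mul_right ?_ _
      have : ((1:ℝ), (ω:E3)) = (1, 0) + (0, (ω:E3)) := by simp
      rw [this, map_add]
      refine (enorm_add_le _ _).trans (add_le_add le_rfl ?_)
      rw [← ofReal_norm, ← ofReal_norm]
      refine ENNReal.ofReal_le_ofReal ?_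
      have := (fderiv ℝ (fun y => V (a, y)) (x + (t - a) • (ω:E3))).le_opNorm (ω:E3)
      rw [hω, mul_one] at this
      refine le_trans (le_of_eq ?_) this
      rw [hLa]; simp
    refine (lintegral_mono hpt).trans (le_of_eq ?_)
    have hm : Measurable fun p : Metric.sphere (0:E3) 1 × ℝ =>
        ‖fderiv ℝ (fun y => V (a, y)) (x + p.2 • (p.1:E3))‖ₑ :=
      Continuous.measurable (by fun_prop)
    have hm' : Measurable fun ω : Metric.sphere (0:E3) 1 =>
        ∫⁻ r in Ioi (t - a), ‖fderiv ℝ (fun y => V (a, y)) (x + r • (ω:E3))‖ₑ := by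
      exact Measurable.lintegral_prod_right' (ν := volume.restrict (Ioi (t - a))) hm
    rw [lintegral_add_right _ hm', lintegral_add_right, lintegral_const_mul, lintegral_const_mul]
    · rw [sphTail_eq_lintegral_ray hρ, lintegral_lintegral_swap]
      · rfl
      · exact hm.aemeasurable
    all_goals try exact Continuous.measurable (by fun_prop)
    exact (Continuous.measurable (by fun_prop)).const_mul _
  · rw [intervalIntegral.integral_of_le hat, integral_Ioc_eq_integral_Ioo]
    refine (enorm_integral_le_lintegral_enorm _).trans ?_
    refine setLIntegral_mono' measurableSet_Ioo fun τ hτ => ?_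
    rw [enorm_mul, Real.enorm_of_nonneg (sub_nonneg.2 hτ.2.le), sphMean]
    refine mul_le_mul_right ((enorm_integral_le_lintegral_enorm _).trans
      (lintegral_mono fun ω => ?_)) _
    rw [hbox τ hτ, enorm_neg, enorm_pow]
    exact le_of_eq (by norm_cast)

/-- Strichartz estimate for a function controlled pointwise by Kirchhoff-type means. -/
lemma DualStrichartz.mixE_le {q r : ℝ} {C κ : ℝ≥0∞} (hq : 1 < q) (hr : 1 < r) (hC : C ≠ ∞)
    (hκ : κ ≠ 0) (hκ' : κ ≠ ∞) (hS : DualStrichartz q r C) {A B : E3 → ℝ≥0∞} (hA : Measurable A)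
    (hB : Measurable B) {F W : ℝ → E3 → ℝ≥0∞} (hF : Measurable (uncurry F))
    (hW : Measurable (uncurry W)) {a : ℝ} {J : Set ℝ}
    (h : ∀ t x, κ * W t x ≤ sphMean A (t - a) x + sphMean B (t - a) x +
      (Ioi a).indicator (fun t => sphTail B (t - a) x) t +
      ∫⁻ τ in J, sphMean (F τ) (t - τ) x) :
    mixE q r W ≤ κ⁻¹ * (C * l2E A + C * l2E B + C * ENNReal.ofReal q * l2E B +
      C * ∫⁻ τ in J, l2E (F τ)) := by
  refine mixE_le_of_dual hq hr hW fun G hG => ?_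
  rw [mul_assoc, mul_comm κ⁻¹, ← div_eq_mul_inv,
    ENNReal.le_div_iff_mul_le (Or.inl hκ) (Or.inl hκ'), mul_comm]
  have hGt : ∀ t, Measurable (G t) := fun t => hG.comp (measurable_const.prodMk measurable_id)
  have hWG : Measurable fun z : ℝ × E3 => W z.1 z.2 * G z.1 z.2 :=
    Measurable.mul (f := fun z : ℝ × E3 => W z.1 z.2) (g := fun z : ℝ × E3 => G z.1 z.2) hW hG
  have m1 : ∀ {f : E3 → ℝ≥0∞}, Measurable f →
      Measurable fun z : ℝ × E3 => sphMean f (z.1 - a) z.2 * G z.1 z.2 := fun hf =>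
    Measurable.mul (f := fun z : ℝ × E3 => sphMean _ (z.1 - a) z.2) (g := fun z : ℝ × E3 => G z.1 z.2)
      ((measurable_sphMean hf).comp (f := fun z : ℝ × E3 => (z.1 - a, z.2)) (by fun_prop)) hG
  have m2 : Measurable fun z : ℝ × E3 =>
      (Ioi a).indicator (fun t => sphTail B (t - a) z.2) z.1 * G z.1 z.2 := by
    refine Measurable.mul (f := fun z : ℝ × E3 => (Ioi a).indicator (fun t => sphTail B (t - a) z.2) z.1)
      (g := fun z : ℝ × E3 => G z.1 z.2) ?_ hG
    have : Measurable fun z : ℝ × E3 => (Ioi a ×ˢ univ).indicator (fun z => sphTail B (z.1 - a) z.2) z :=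
      ((measurable_sphTail hB).comp (f := fun z : ℝ × E3 => (z.1 - a, z.2)) (by fun_prop)).indicator
        (measurableSet_Ioi.prod MeasurableSet.univ)
    convert this using 1
    funext z
    by_cases hz : z.1 ∈ Ioi a
    · rw [indicator_of_mem hz, indicator_of_mem (Set.mk_mem_prod hz (mem_univ _))]
    · rw [indicator_of_notMem hz, indicator_of_notMem (fun h => hz h.1)]
  have hsec : ∀ {f : ℝ × E3 → ℝ≥0∞}, Measurable f → ∀ t, Measurable fun x => f (t, x) := fun hf t =>
    hf.comp (measurable_const.prodMk measurable_id)
  have hint : ∀ {f : ℝ × E3 → ℝ≥0∞}, Measurable f → Measurable fun t => ∫⁻ x, f (t, x) := fun hf =>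
    hf.lintegral_prod_right'
  calc κ * ∫⁻ t, ∫⁻ x, W t x * G t x = ∫⁻ t, ∫⁻ x, κ * W t x * G t x := by
        rw [← lintegral_const_mul _ (hint hWG)]
        refine lintegral_congr fun t => ?_
        rw [← lintegral_const_mul _ (hsec hWG t)]
        exact lintegral_congr fun x => (mul_assoc _ _ _).symm
    _ ≤ ∫⁻ t, ∫⁻ x, (sphMean A (t - a) x * G t x + sphMean B (t - a) x * G t x +
          (Ioi a).indicator (fun t => sphTail B (t - a) x) t * G t x +
          (∫⁻ τ in J, sphMean (F τ) (t - τ) x) * G t x) := by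
        refine lintegral_mono fun t => lintegral_mono fun x => ?_
        dsimp only
        rw [← add_mul, ← add_mul, ← add_mul]
        exact mul_le_mul_left (h t x) _
    _ = (∫⁻ t, ∫⁻ x, sphMean A (t - a) x * G t x) + (∫⁻ t, ∫⁻ x, sphMean B (t - a) x * G t x) +
          (∫⁻ t, ∫⁻ x, (Ioi a).indicator (fun t => sphTail B (t - a) x) t * G t x) +
          ∫⁻ t, ∫⁻ x, (∫⁻ τ in J, sphMean (F τ) (t - τ) x) * G t x := by
        rw [← lintegral_add_left (hint (m1 hA)), ← lintegral_add_left, ← lintegral_add_left]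
        · refine lintegral_congr fun t => ?_
          rw [← lintegral_add_left (hsec (m1 hA) t), ← lintegral_add_left, ← lintegral_add_left]
          · exact ((hsec (m1 hA) t).add (hsec (m1 hB) t)).add (hsec m2 t)
          · exact (hsec (m1 hA) t).add (hsec (m1 hB) t)
        · exact ((hint (m1 hA)).add (hint (m1 hB))).add (hint m2)
        · exact (hint (m1 hA)).add (hint (m1 hB))
    _ ≤ C * (l2E A * mixDual q r G) + C * (l2E B * mixDual q r G) +
          C * ENNReal.ofReal q * (l2E B * mixDual q r G) +
          C * ((∫⁻ τ in J, l2E (F τ)) * mixDual q r G) := by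
        gcongr
        · exact hS.shift hA hG a
        · exact hS.shift hB hG a
        · refine le_trans (le_of_eq ?_) (hS.tail hq hB hG a)
          rw [← lintegral_indicator measurableSet_Ioi]
          refine lintegral_congr fun t => ?_
          by_cases ht : t ∈ Ioi a
          · simp only [indicator_of_mem ht]
          · simp only [indicator_of_notMem ht, zero_mul, lintegral_zero]
        · exact hS.duhamel hC hF hG J
    _ = _ := by ring

/-- Hölder's inequality for the quintic nonlinearity. -/
lemma lintegral_l2E_rpow_five_le {W : ℝ → E3 → ℝ≥0∞} (hW : Measurable (uncurry W)) :
    ∫⁻ τ, l2E (fun y => W τ y ^ (5:ℝ)) ≤ mixE 27 (162/25) W ^ 3 * mixE (9/4) 54 W ^ 2 := by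
  have hWt : ∀ t, Measurable (W t) := fun t => hW.comp (measurable_const.prodMk measurable_id)
  have h1 : ∀ τ, l2E (fun y => W τ y ^ (5:ℝ)) ≤ ((((∫⁻ x, W τ x ^ (54:ℝ)) ^ (1 / (54:ℝ))) ^ (9/4:ℝ)) ^ (8/9:ℝ)) *
      ((((∫⁻ x, W τ x ^ (162/25:ℝ)) ^ (1 / (162/25:ℝ))) ^ (27:ℝ)) ^ (1/9:ℝ)) := by
    intro τ
    have := ENNReal.lintegral_mul_norm_pow_le (μ := volume) (f := fun x => W τ x ^ (54:ℝ))
      (g := fun x => W τ x ^ (162/25:ℝ)) ((hWt τ).pow_const _).aemeasurable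
      ((hWt τ).pow_const _).aemeasurable (p := 2/27) (q := 25/27) (by norm_num) (by norm_num) (by norm_num)
    have e : ∀ x, (W τ x ^ (5:ℝ)) ^ (2:ℝ) = (W τ x ^ (54:ℝ)) ^ (2/27:ℝ) * (W τ x ^ (162/25:ℝ)) ^ (25/27:ℝ) := by
      intro x
      rw [← ENNReal.rpow_mul, ← ENNReal.rpow_mul, ← ENNReal.rpow_mul, ← ENNReal.rpow_add_of_nonneg _ _ (by norm_num) (by norm_num)]
      norm_num
    unfold l2E
    simp_rw [e]
    refine (ENNReal.rpow_le_rpow this (by norm_num)).trans (le_of_eq ?_)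
    rw [ENNReal.mul_rpow_of_nonneg _ _ (by norm_num)]
    simp only [← ENNReal.rpow_mul]
    norm_num
  refine (lintegral_mono h1).trans ?_
  refine (ENNReal.lintegral_mul_norm_pow_le ((measurable_xnorm hW _ _).pow_const _).aemeasurable
    ((measurable_xnorm hW _ _).pow_const _).aemeasurable (by norm_num) (by norm_num) (by norm_num)).trans
    (le_of_eq ?_)
  unfold mixE
  rw [mul_comm]
  simp only [← ENNReal.rpow_natCast, ← ENNReal.rpow_mul]
  norm_num

/-- The absolute value of `V` cut off to the truncated cone `‖x‖ + t ≤ R`, `a < t ≤ T`. -/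
def coneCut (V : ℝ × E3 → ℝ) (a T R : ℝ) (t : ℝ) (x : E3) : ℝ≥0∞ :=
  {z : ℝ × E3 | a < z.1 ∧ z.1 ≤ T ∧ ‖z.2‖ + z.1 ≤ R}.indicator (fun z => ‖V z‖ₑ) (t, x)

lemma coneCut_of_mem {V : ℝ × E3 → ℝ} {a T R t : ℝ} {x : E3} (h1 : a < t) (h2 : t ≤ T)
    (h3 : ‖x‖ + t ≤ R) : coneCut V a T R t x = ‖V (t, x)‖ₑ :=
  indicator_of_mem (show (t, x) ∈ {z : ℝ × E3 | a < z.1 ∧ z.1 ≤ T ∧ ‖z.2‖ + z.1 ≤ R} from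
    ⟨h1, h2, h3⟩) _

lemma coneCut_of_not {V : ℝ × E3 → ℝ} {a T R t : ℝ} {x : E3}
    (h : ¬ (a < t ∧ t ≤ T ∧ ‖x‖ + t ≤ R)) : coneCut V a T R t x = 0 :=
  indicator_of_notMem (show (t, x) ∉ {z : ℝ × E3 | a < z.1 ∧ z.1 ≤ T ∧ ‖z.2‖ + z.1 ≤ R} from h) _

lemma measurable_coneCut {V : ℝ × E3 → ℝ} (hV : Continuous V) (a T R : ℝ) :
    Measurable (uncurry (coneCut V a T R)) := by
  refine Measurable.indicator (f := fun z : ℝ × E3 => ‖V z‖ₑ) hV.enorm.measurable ?_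
  have h1 : MeasurableSet {z : ℝ × E3 | a < z.1} := measurableSet_lt measurable_const measurable_fst
  have h2 : MeasurableSet {z : ℝ × E3 | z.1 ≤ T} := measurableSet_le measurable_fst measurable_const
  have h3 : MeasurableSet {z : ℝ × E3 | ‖z.2‖ + z.1 ≤ R} :=
    measurableSet_le (measurable_snd.norm.add measurable_fst) measurable_const
  exact h1.inter (h2.inter h3)

lemma coneCut_kirchhoff {V : ℝ × E3 → ℝ} (hV : ContDiff ℝ (⊤ : ℕ∞) V) {a T R : ℝ}
    (hlim : Filter.Tendsto (fun y => V (a, y)) (Filter.cocompact E3) (nhds 0))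
    (hbox : ∀ τ ∈ Ioo a T, ∀ y, boxOp V (τ, y) = - V (τ, y) ^ 5) (t : ℝ) (x : E3) :
    sphMeas univ * coneCut V a T R t x ≤
      sphMean (fun y => ‖fderiv ℝ V (a, y) (1, 0)‖ₑ) (t - a) x +
      sphMean (fun y => ‖fderiv ℝ (fun y => V (a, y)) y‖ₑ) (t - a) x +
      (Ioi a).indicator
        (fun t => sphTail (fun y => ‖fderiv ℝ (fun y => V (a, y)) y‖ₑ) (t - a) x) t +
      ∫⁻ τ in univ, sphMean (fun y => coneCut V a T R τ y ^ (5:ℝ)) (t - τ) x := by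
  by_cases h : a < t ∧ t ≤ T ∧ ‖x‖ + t ≤ R
  · obtain ⟨h1, h2, h3⟩ := h
    rw [coneCut_of_mem h1 h2 h3, indicator_of_mem (show t ∈ Ioi a from h1), setLIntegral_univ]
    refine (kirchhoff_bound hV h1.le x hlim fun τ hτ => hbox τ ⟨hτ.1, hτ.2.trans_le h2⟩).trans ?_
    refine add_le_add le_rfl ?_
    refine le_trans ?_ (setLIntegral_le_lintegral (Ioo a t) _)
    refine setLIntegral_mono' measurableSet_Ioo fun τ hτ => ?_
    refine mul_le_mul_right (lintegral_mono fun ω => ?_) _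
    dsimp only
    have hn : ‖x + (t - τ) • (ω:E3)‖ + τ ≤ R := by
      have h4 := norm_add_le x ((t - τ) • (ω:E3))
      rw [norm_smul, norm_eq_of_mem_sphere, mul_one, Real.norm_of_nonneg (sub_nonneg.2 hτ.2.le)] at h4
      linarith
    rw [coneCut_of_mem hτ.1 (hτ.2.le.trans h2) hn]
  · rw [coneCut_of_not h, mul_zero]; exact zero_le

/-- A continuity argument for primitives of bounded functions. -/
lemma rpow_setLIntegral_le_of_quadratic {h : ℝ → ℝ≥0∞} (hm : Measurable h) {K : ℝ≥0∞}
    (hK : K ≠ ∞) (hb : ∀ t, h t ≤ K) {p a T e c : ℝ} (hp : 0 < p) (haT : a ≤ T) (he : 0 < e)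
    (hc : 0 ≤ c) (hce : 4 * c * e < 1)
    (hX : ∀ S ∈ Icc a T, (∫⁻ t in Ioc a S, h t) ^ p ≤
      ENNReal.ofReal e + ENNReal.ofReal c * ((∫⁻ t in Ioc a S, h t) ^ p) ^ 2) :
    (∫⁻ t in Ioc a T, h t) ^ p ≤ ENNReal.ofReal (2 * e) := by
  have hfin : ∀ t, h t ≠ ∞ := fun t => ne_top_of_le_ne_top hK (hb t)
  have hint : ∀ u v, IntervalIntegrable (fun t => (h t).toReal) volume u v := by
    intro u v
    rw [intervalIntegrable_iff]
    refine Measure.integrableOn_of_bounded (M := K.toReal) ?_ hm.ennreal_toReal.aestronglyMeasurable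
      (Filter.Eventually.of_forall fun t => ?_)
    · simp [uIoc]
    · rw [Real.norm_of_nonneg ENNReal.toReal_nonneg]
      exact ENNReal.toReal_mono hK (hb t)
  obtain ⟨Φ, hΦ⟩ : ∃ Φ : ℝ → ℝ, Φ = fun S => ∫ t in a..S, (h t).toReal := ⟨_, rfl⟩
  have hΦc : Continuous Φ := by rw [hΦ]; exact intervalIntegral.continuous_primitive hint a
  have hΦ0 : ∀ S ∈ Icc a T, 0 ≤ Φ S := fun S hS => by
    rw [hΦ]
    exact intervalIntegral.integral_nonneg hS.1 fun t _ => ENNReal.toReal_nonneg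
  have hΦe : ∀ S ∈ Icc a T, ∫⁻ t in Ioc a S, h t = ENNReal.ofReal (Φ S) := by
    intro S hS
    rw [hΦ]; dsimp only
    rw [intervalIntegral.integral_of_le hS.1, ofReal_integral_eq_lintegral_ofReal]
    · exact lintegral_congr fun t => (ENNReal.ofReal_toReal (hfin t)).symm
    · have := hint a S
      rwa [intervalIntegrable_iff, uIoc_of_le hS.1] at this
    · exact Filter.Eventually.of_forall fun t => ENNReal.toReal_nonneg
  obtain ⟨X, hXd⟩ : ∃ X : ℝ → ℝ, X = fun S => Φ S ^ p := ⟨_, rfl⟩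
  have hXc : Continuous X := by rw [hXd]; exact hΦc.rpow_const fun _ => Or.inr hp.le
  have hX0 : ∀ S ∈ Icc a T, 0 ≤ X S := fun S hS => by
    rw [hXd]; exact Real.rpow_nonneg (hΦ0 S hS) _
  have hXe : ∀ S ∈ Icc a T, (∫⁻ t in Ioc a S, h t) ^ p = ENNReal.ofReal (X S) := fun S hS => by
    rw [hΦe S hS, ENNReal.ofReal_rpow_of_nonneg (hΦ0 S hS) hp.le, hXd]
  have hquad : ∀ S ∈ Icc a T, X S ≤ e + c * X S ^ 2 := by
    intro S hS
    have := hX S hS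
    rw [hXe S hS, ← ENNReal.ofReal_pow (hX0 S hS), ← ENNReal.ofReal_mul hc,
      ← ENNReal.ofReal_add he.le (by have := hX0 S hS; positivity)] at this
    exact (ENNReal.ofReal_le_ofReal_iff (by have := hX0 S hS; positivity)).1 this
  rw [hXe T ⟨haT, le_rfl⟩]
  refine ENNReal.ofReal_le_ofReal ?_
  by_contra! hlt
  have hXa : X a = 0 := by
    rw [hXd, hΦ]; simp [hp.ne']
  obtain ⟨S, hS, hSe⟩ := intermediate_value_Icc haT hXc.continuousOn
    (show 2 * e ∈ Icc (X a) (X T) from ⟨by rw [hXa]; positivity, hlt.le⟩)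
  have := hquad S hS
  rw [hSe] at this
  nlinarith

lemma exists_coneCut_rpow_le {V : ℝ × E3 → ℝ} (hV : Continuous V) {a T R r q : ℝ} (hr : 0 < r)
    (hq : 0 < q) :
    ∃ K : ℝ≥0∞, K ≠ ∞ ∧ ∀ t, ((∫⁻ x, coneCut V a T R t x ^ r) ^ (1 / r)) ^ q ≤ K := by
  obtain ⟨M, hM⟩ := (isCompact_Icc.prod (isCompact_closedBall (0:E3) (R - a))).exists_bound_of_continuousOn
    (f := V) (s := Icc a T ×ˢ Metric.closedBall (0:E3) (R - a)) hV.continuousOn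
  refine ⟨((ENNReal.ofReal M ^ r * volume (Metric.closedBall (0:E3) (R - a))) ^ (1 / r)) ^ q, ?_,
    fun t => ?_⟩
  · refine ENNReal.rpow_ne_top_of_nonneg hq.le (ENNReal.rpow_ne_top_of_nonneg (by positivity)
      (ENNReal.mul_ne_top (ENNReal.rpow_ne_top_of_nonneg hr.le ENNReal.ofReal_ne_top)
        measure_closedBall_lt_top.ne))
  · refine ENNReal.rpow_le_rpow (ENNReal.rpow_le_rpow ?_ (by positivity)) hq.le
    rw [← setLIntegral_const, ← lintegral_indicator Metric.isClosed_closedBall.measurableSet]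
    refine lintegral_mono fun x => ?_
    by_cases h : a < t ∧ t ≤ T ∧ ‖x‖ + t ≤ R
    · have hx : x ∈ Metric.closedBall (0:E3) (R - a) := by
        rw [mem_closedBall_zero_iff]; linarith [h.1, h.2.2]
      rw [coneCut_of_mem h.1 h.2.1 h.2.2, indicator_of_mem hx]
      refine ENNReal.rpow_le_rpow ?_ hr.le
      rw [← ofReal_norm]
      exact ENNReal.ofReal_le_ofReal (hM _ ⟨⟨h.1.le, h.2.1⟩, hx⟩)
    · rw [coneCut_of_not h, ENNReal.zero_rpow_of_pos hr]; exact zero_le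

lemma mixE_coneCut_eq {V : ℝ × E3 → ℝ} {a S T R r q : ℝ} (hr : 0 < r) (hq : 0 < q) (hST : S ≤ T) :
    mixE q r (coneCut V a S R) =
      (∫⁻ t in Ioc a S, ((∫⁻ x, coneCut V a T R t x ^ r) ^ (1 / r)) ^ q) ^ (1 / q) := by
  unfold mixE
  rw [← lintegral_indicator measurableSet_Ioc]
  congr 1
  refine lintegral_congr fun t => ?_
  by_cases ht : t ∈ Ioc a S
  · rw [indicator_of_mem ht]
    congr 2
    refine lintegral_congr fun x => ?_
    by_cases hx : ‖x‖ + t ≤ R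
    · rw [coneCut_of_mem ht.1 ht.2 hx, coneCut_of_mem ht.1 (ht.2.trans hST) hx]
    · rw [coneCut_of_not (by tauto), coneCut_of_not (by tauto)]
  · rw [indicator_of_notMem ht]
    have : ∀ x, coneCut V a S R t x = 0 := fun x => coneCut_of_not fun h => ht ⟨h.1, h.2.1⟩
    simp only [this]
    rw [ENNReal.zero_rpow_of_pos hr, lintegral_zero, ENNReal.zero_rpow_of_pos (by positivity),
      ENNReal.zero_rpow_of_pos hq]

lemma coneCut_mono_time {V : ℝ × E3 → ℝ} {a S T R : ℝ} (hST : S ≤ T) (t : ℝ) (x : E3) :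
    coneCut V a S R t x ≤ coneCut V a T R t x := by
  by_cases h : a < t ∧ t ≤ S ∧ ‖x‖ + t ≤ R
  · rw [coneCut_of_mem h.1 h.2.1 h.2.2, coneCut_of_mem h.1 (h.2.1.trans hST) h.2.2]
  · rw [coneCut_of_not h]; exact zero_le

lemma exists_bootstrap : ∃ B : ℝ, 0 < B ∧ ∀ (V : ℝ × E3 → ℝ) (a T R e δ : ℝ),
    ContDiff ℝ (⊤ : ℕ∞) V → a ≤ T →
    Filter.Tendsto (fun y => V (a, y)) (Filter.cocompact E3) (nhds 0) →
    (∀ τ ∈ Ioo a T, ∀ y, boxOp V (τ, y) = - V (τ, y) ^ 5) → 0 < e → 0 ≤ δ →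
    l2E (fun y => ‖fderiv ℝ V (a, y) (1, 0)‖ₑ) ≤ ENNReal.ofReal e →
    l2E (fun y => ‖fderiv ℝ (fun y => V (a, y)) y‖ₑ) ≤ ENNReal.ofReal e →
    mixE 27 (162/25) (coneCut V a T R) ≤ ENNReal.ofReal δ → 4 * B ^ 2 * δ ^ 3 * e < 1 →
    mixE (9/4) 54 (coneCut V a T R) ≤ ENNReal.ofReal (2 * B * e) := by
  obtain ⟨C, hC, hS⟩ := exists_lintegral_sphMean_mul_le (q := 9/4) (r := 54) (by norm_num)
    (by norm_num) (by norm_num)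
  have hκ : sphMeas univ ≠ 0 := sphMeas_univ_pos.ne'
  have hκ' : sphMeas univ ≠ ∞ := measure_ne_top _ _
  have hB1 : (sphMeas univ)⁻¹ * (C + C + C * ENNReal.ofReal (9/4)) ≠ ∞ :=
    ENNReal.mul_ne_top (ENNReal.inv_ne_top.2 hκ) (by finiteness)
  obtain ⟨B1, hB1d⟩ : ∃ B1, B1 = (sphMeas univ)⁻¹ * (C + C + C * ENNReal.ofReal (9/4)) := ⟨_, rfl⟩
  rw [← hB1d] at hB1
  refine ⟨B1.toReal + 1, by positivity, fun V a T R e δ hV haT hlim hbox he hδ hA hB hY hsmall => ?_⟩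
  obtain ⟨B, hBd⟩ : ∃ B, B = B1.toReal + 1 := ⟨_, rfl⟩
  rw [← hBd] at hsmall ⊢
  have hBpos : 0 < B := by rw [hBd]; positivity
  have hB1B : B1 ≤ ENNReal.ofReal B := by
    rw [hBd, ENNReal.le_ofReal_iff_toReal_le hB1 (by positivity)]; linarith
  have mA : Measurable fun y : E3 => ‖fderiv ℝ V (a, y) (1, 0)‖ₑ := by
    have := hV.continuous_fderiv (by simp)
    exact Continuous.measurable (by fun_prop)
  have mB : Measurable fun y : E3 => ‖fderiv ℝ (fun y => V (a, y)) y‖ₑ := by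
    have hVa : ContDiff ℝ (⊤ : ℕ∞) fun y => V (a, y) := by fun_prop
    exact (hVa.continuous_fderiv (by simp)).enorm.measurable
  obtain ⟨K, hK, hKb⟩ := exists_coneCut_rpow_le hV.continuous (a := a) (T := T) (R := R) (r := 54)
    (q := 9/4) (by norm_num) (by norm_num)
  have hmain : ∀ S ∈ Icc a T, mixE (9/4) 54 (coneCut V a S R) ≤ ENNReal.ofReal (B * e) +
      ENNReal.ofReal (B * δ ^ 3) * mixE (9/4) 54 (coneCut V a S R) ^ 2 := by
    intro S hS'
    have mW := measurable_coneCut hV.continuous a S R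
    have h1 := DualStrichartz.mixE_le (by norm_num) (by norm_num) hC hκ hκ' hS mA mB
      (F := fun τ y => coneCut V a S R τ y ^ (5:ℝ)) (mW.pow_const _) mW
      (coneCut_kirchhoff hV hlim fun τ hτ => hbox τ ⟨hτ.1, hτ.2.trans_le hS'.2⟩)
    have h2 : mixE 27 (162/25) (coneCut V a S R) ≤ ENNReal.ofReal δ :=
      (mixE_mono (by norm_num) (by norm_num) (coneCut_mono_time hS'.2)).trans hY
    rw [setLIntegral_univ] at h1
    refine h1.trans ?_
    calc _ ≤ (sphMeas univ)⁻¹ * (C * ENNReal.ofReal e + C * ENNReal.ofReal e +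
          C * ENNReal.ofReal (9/4) * ENNReal.ofReal e +
          (C + C + C * ENNReal.ofReal (9/4)) *
            (ENNReal.ofReal δ ^ 3 * mixE (9/4) 54 (coneCut V a S R) ^ 2)) := by
          gcongr
          · rw [add_assoc]; exact le_self_add
          · refine (lintegral_l2E_rpow_five_le mW).trans ?_
            gcongr
      _ = B1 * ENNReal.ofReal e + B1 * ENNReal.ofReal δ ^ 3 *
            mixE (9/4) 54 (coneCut V a S R) ^ 2 := by rw [hB1d]; ring
      _ ≤ _ := by
          rw [ENNReal.ofReal_mul hBpos.le, ENNReal.ofReal_mul hBpos.le, ENNReal.ofReal_pow hδ]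
          gcongr
  have hfinal := rpow_setLIntegral_le_of_quadratic (p := 1 / (9/4)) (e := B * e) (c := B * δ ^ 3)
    ((measurable_xnorm (measurable_coneCut hV.continuous a T R) 54 (1 / 54)).pow_const (9/4)) hK hKb
    (by norm_num) haT (by positivity) (by positivity) (by nlinarith) fun S hS' => by
      rw [← mixE_coneCut_eq (by norm_num) (by norm_num) hS'.2]
      exact hmain S hS'
  rw [← mixE_coneCut_eq (by norm_num) (by norm_num) le_rfl] at hfinal
  rwa [mul_assoc]

/-- A smooth function on a slab agrees with a globally smooth function on an interior slab. -/
lemma exists_contDiff_eq_of_slab {u : ℝ → E3 → ℝ} {s t₀ η : ℝ}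
    (hu : ContDiffOn ℝ (⊤ : ℕ∞) (uncurry u) (Icc s t₀ ×ˢ univ)) (hη : 0 < η)
    (hη' : 2 * η < t₀ - s) : ∃ V : ℝ × E3 → ℝ, ContDiff ℝ (⊤ : ℕ∞) V ∧
      ∀ τ ∈ Ioo (s + η / 2) (t₀ - η / 2), ∀ y, V (τ, y) = u τ y := by
  let χ : ContDiffBump ((s + t₀) / 2 : ℝ) :=
    { rIn := (t₀ - s) / 2 - η / 2, rOut := (t₀ - s) / 2 - η / 4
      rIn_pos := by linarith, rIn_lt_rOut := by linarith }
  refine ⟨fun z => χ z.1 * u z.1 z.2, ?_, ?_⟩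
  · rw [contDiff_iff_contDiffAt]
    intro z
    by_cases hz : z.1 ∈ Ioo s t₀
    · have h1 : ContDiffAt ℝ (⊤ : ℕ∞) (uncurry u) z :=
        hu.contDiffAt (prod_mem_nhds (Icc_mem_nhds hz.1 hz.2) Filter.univ_mem)
      have h2 : ContDiffAt ℝ (⊤ : ℕ∞) (fun z : ℝ × E3 => χ z.1) z :=
        (χ.contDiff.comp contDiff_fst).contDiffAt
      exact h2.mul h1
    · have h0 : (fun z : ℝ × E3 => χ z.1 * u z.1 z.2) =ᶠ[nhds z] fun _ => 0 := by
        have hout : z.1 ∈ (Metric.closedBall ((s + t₀) / 2 : ℝ) χ.rOut)ᶜ := by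
          intro hm
          rw [Metric.mem_closedBall, Real.dist_eq, abs_le] at hm
          refine hz ⟨?_, ?_⟩ <;>
          · have h3 : χ.rOut = (t₀ - s) / 2 - η / 4 := rfl
            linarith [hm.1, hm.2]
        have : ∀ᶠ w : ℝ × E3 in nhds z, w.1 ∈ (Metric.closedBall ((s + t₀) / 2 : ℝ) χ.rOut)ᶜ :=
          continuous_fst.continuousAt.eventually (Metric.isClosed_closedBall.isOpen_compl.mem_nhds hout)
        filter_upwards [this] with w hw
        rw [χ.zero_of_le_dist, zero_mul]
        exact (not_le.1 fun h => hw (Metric.mem_closedBall.2 h)).le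
      exact contDiffAt_const.congr_of_eventuallyEq h0
  · intro τ hτ y
    dsimp only
    rw [χ.one_of_mem_closedBall, one_mul]
    rw [Metric.mem_closedBall, Real.dist_eq, abs_le]
    have h3 : χ.rIn = (t₀ - s) / 2 - η / 2 := rfl
    constructor <;> linarith [hτ.1, hτ.2]

lemma hasDerivAt_slice {F : Type*} [NormedAddCommGroup F] [NormedSpace ℝ F]
    {G : ℝ × E3 → F} (hG : Differentiable ℝ G) (t : ℝ) (y : E3) :
    HasDerivAt (fun s => G (s, y)) (fderiv ℝ G (t, y) (1, 0)) t :=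
  (hG (t, y)).hasFDerivAt.comp_hasDerivAt t ((hasDerivAt_id t).prodMk (hasDerivAt_const t y))

lemma hasFDerivAt_slice {F : Type*} [NormedAddCommGroup F] [NormedSpace ℝ F]
    {G : ℝ × E3 → F} (hG : Differentiable ℝ G) (t : ℝ) (y : E3) :
    HasFDerivAt (fun y => G (t, y)) ((fderiv ℝ G (t, y)).comp (ContinuousLinearMap.inr ℝ ℝ E3)) y :=
  (hG (t, y)).hasFDerivAt.comp y (hasFDerivAt_prodMk_right t y)

lemma tderiv_eq_of_slab {u : ℝ → E3 → ℝ} {V : ℝ × E3 → ℝ} {b c : ℝ} (hV : ContDiff ℝ (⊤ : ℕ∞) V)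
    (huV : ∀ τ ∈ Ioo b c, ∀ y, V (τ, y) = u τ y) {τ : ℝ}
    (hτ : τ ∈ Ioo b c) (y : E3) :
    tderiv u τ y = fderiv ℝ V (τ, y) (1, 0) := by
  rw [← (hasDerivAt_slice (hV.differentiable (by simp)) τ y).deriv]
  refine Filter.EventuallyEq.deriv_eq ?_
  filter_upwards [Ioo_mem_nhds hτ.1 hτ.2] with s hs using (huV s hs y).symm

lemma tderiv2_eq_of_slab {u : ℝ → E3 → ℝ} {V : ℝ × E3 → ℝ} {b c : ℝ} (hV : ContDiff ℝ (⊤ : ℕ∞) V)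
    (huV : ∀ τ ∈ Ioo b c, ∀ y, V (τ, y) = u τ y) {τ : ℝ}
    (hτ : τ ∈ Ioo b c) (y : E3) :
    tderiv2 u τ y = fderiv ℝ (fderiv ℝ V) (τ, y) (1, 0) (1, 0) := by
  have hd : Differentiable ℝ (fderiv ℝ V) :=
    (hV.fderiv_right (m := 1) (by norm_cast)).differentiable (by simp)
  have h1 := (hasDerivAt_slice hd τ y).clm_apply (hasDerivAt_const τ ((1, 0) : ℝ × E3))
  simp only [map_zero, add_zero] at h1
  rw [← h1.deriv]
  refine Filter.EventuallyEq.deriv_eq ?_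
  filter_upwards [Ioo_mem_nhds hτ.1 hτ.2] with s hs using tderiv_eq_of_slab hV huV hs y

lemma lap_eq_of_slab {u : ℝ → E3 → ℝ} {V : ℝ × E3 → ℝ} {b c : ℝ} (hV : ContDiff ℝ (⊤ : ℕ∞) V)
    (huV : ∀ τ ∈ Ioo b c, ∀ y, V (τ, y) = u τ y) {τ : ℝ} (hτ : τ ∈ Ioo b c) (y : E3) :
    lap (u τ) y = ∑ i : Fin 3, fderiv ℝ (fderiv ℝ V) (τ, y) (0, EuclideanSpace.single i 1)
      (0, EuclideanSpace.single i 1) := by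
  have hd : Differentiable ℝ (fderiv ℝ V) :=
    (hV.fderiv_right (m := 1) (by norm_cast)).differentiable (by simp)
  have e : u τ = fun y => V (τ, y) := funext fun y => (huV τ hτ y).symm
  have e1 : fderiv ℝ (fun y => V (τ, y)) = fun y =>
      (fderiv ℝ V (τ, y)).comp (ContinuousLinearMap.inr ℝ ℝ E3) :=
    funext fun y => (hasFDerivAt_slice (hV.differentiable (by simp)) τ y).fderiv
  unfold lap
  refine Finset.sum_congr rfl fun i _ => ?_
  rw [iteratedFDeriv_two_apply, e, e1]
  have h2 := (hasFDerivAt_slice hd τ y).clm_comp (hasFDerivAt_const (ContinuousLinearMap.inr ℝ ℝ E3) y)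
  rw [h2.fderiv]
  simp

lemma boxOp_eq_of_slab {u : ℝ → E3 → ℝ} {V : ℝ × E3 → ℝ} {b c : ℝ} (hV : ContDiff ℝ (⊤ : ℕ∞) V)
    (huV : ∀ τ ∈ Ioo b c, ∀ y, V (τ, y) = u τ y) {I : Set ℝ} (hI : Ioo b c ⊆ I)
    (hu : ∀ t ∈ I, ∀ x, tderiv2 u t x - lap (u t) x + (u t x) ^ 5 = 0) {τ : ℝ}
    (hτ : τ ∈ Ioo b c) (y : E3) : boxOp V (τ, y) = - V (τ, y) ^ 5 := by
  have := hu τ (hI hτ) y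
  rw [tderiv2_eq_of_slab hV huV hτ, lap_eq_of_slab hV huV hτ] at this
  rw [boxOp, huV τ hτ y]
  linarith

lemma IsSchwartz.exists_schwartzMap {f : E3 → ℝ} (hf : IsSchwartz f) :
    ∃ F : SchwartzMap E3 ℝ, (F : E3 → ℝ) = f := ⟨⟨f, hf.1, hf.2⟩, rfl⟩

lemma IsSchwartz.tendsto_cocompact {f : E3 → ℝ} (hf : IsSchwartz f) :
    Filter.Tendsto f (Filter.cocompact E3) (nhds 0) := by
  obtain ⟨F, rfl⟩ := hf.exists_schwartzMap
  exact F.tendsto_cocompact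

lemma IsSchwartz.integrable_norm_pow {f : E3 → ℝ} (hf : IsSchwartz f) {n : ℕ} (hn : n ≠ 0) :
    Integrable fun x => ‖f x‖ ^ n := by
  obtain ⟨F, rfl⟩ := hf.exists_schwartzMap
  exact (F.memLp n).integrable_norm_pow hn

lemma IsSchwartz.integrable_norm_fderiv_sq {f : E3 → ℝ} (hf : IsSchwartz f) :
    Integrable fun x => ‖fderiv ℝ f x‖ ^ 2 := by
  obtain ⟨F, rfl⟩ := hf.exists_schwartzMap
  exact ((SchwartzMap.fderivCLM ℝ E3 ℝ F).memLp 2).integrable_norm_pow (by norm_num)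

lemma l2E_enorm_le {F : Type*} [NormedAddCommGroup F] {g : E3 → F}
    (hg : Integrable fun x => ‖g x‖ ^ 2) {M : ℝ} (h : ∫ x, ‖g x‖ ^ 2 ≤ M) :
    l2E (fun x => ‖g x‖ₑ) ≤ ENNReal.ofReal (M ^ (1 / 2 : ℝ)) := by
  have hM : 0 ≤ M := (integral_nonneg fun x => by positivity).trans h
  unfold l2E
  rw [← ENNReal.ofReal_rpow_of_nonneg hM (by norm_num)]
  refine ENNReal.rpow_le_rpow ?_ (by norm_num)
  refine le_trans (le_of_eq ?_) (ENNReal.ofReal_le_ofReal h)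
  rw [ofReal_integral_eq_lintegral_ofReal hg (Filter.Eventually.of_forall fun x => by positivity)]
  refine lintegral_congr fun x => ?_
  rw [ENNReal.ofReal_pow (norm_nonneg _), ofReal_norm, ENNReal.rpow_two]

lemma norm_gradient_eq (f : E3 → ℝ) (x : E3) : ‖gradient f x‖ = ‖fderiv ℝ f x‖ := by
  simp [gradient]

/-- The energy controls the `L²` norms of the time derivative and of the gradient. -/
lemma integral_sq_le_energy {u : ℝ → E3 → ℝ} {t E : ℝ} (h1 : IsSchwartz (u t))
    (h2 : IsSchwartz (tderiv u t)) (hE : energy u t ≤ E) :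
    (∫ x, ‖tderiv u t x‖ ^ 2 ≤ 2 * E) ∧ ∫ x, ‖fderiv ℝ (u t) x‖ ^ 2 ≤ 2 * E := by
  have i1 : Integrable fun x => (1 / 2) * ‖tderiv u t x‖ ^ 2 :=
    (h2.integrable_norm_pow two_ne_zero).const_mul _
  have i2 : Integrable fun x => (1 / 2) * ‖fderiv ℝ (u t) x‖ ^ 2 :=
    h1.integrable_norm_fderiv_sq.const_mul _
  have i3 : Integrable fun x => (1 / 6) * ‖u t x‖ ^ 6 :=
    (h1.integrable_norm_pow (by norm_num)).const_mul _
  have e : energy u t = (1 / 2) * (∫ x, ‖tderiv u t x‖ ^ 2) + (1 / 2) * (∫ x, ‖fderiv ℝ (u t) x‖ ^ 2)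
      + (1 / 6) * ∫ x, ‖u t x‖ ^ 6 := by
    rw [← integral_const_mul, ← integral_const_mul, ← integral_const_mul, ← integral_add i1 i2,
      ← integral_add (f := fun x => (1 / 2) * ‖tderiv u t x‖ ^ 2 + (1 / 2) * ‖fderiv ℝ (u t) x‖ ^ 2)
        (i1.add i2) i3]
    refine integral_congr_ae (Filter.Eventually.of_forall fun x => ?_)
    simp only [norm_gradient_eq, Real.norm_eq_abs, sq_abs]
    rw [Even.pow_abs ⟨3, rfl⟩]
  have p1 : 0 ≤ ∫ x, ‖tderiv u t x‖ ^ 2 := integral_nonneg fun x => by positivity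
  have p2 : 0 ≤ ∫ x, ‖fderiv ℝ (u t) x‖ ^ 2 := integral_nonneg fun x => by positivity
  have p3 : 0 ≤ ∫ x, ‖u t x‖ ^ 6 := integral_nonneg fun x => by positivity
  constructor <;> linarith

/-- The absolute value of `u` on the open slab `(s, t₀) × ℝ³`, extended by zero. -/
def slabAbs (u : ℝ → E3 → ℝ) (s t₀ t : ℝ) (x : E3) : ℝ≥0∞ :=
  (Ioo s t₀).indicator (fun t => ‖u t x‖ₑ) t

lemma measurable_slabAbs {u : ℝ → E3 → ℝ} {s t₀ : ℝ}
    (hu : ContDiffOn ℝ (⊤ : ℕ∞) (uncurry u) (Icc s t₀ ×ˢ univ)) :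
    Measurable (uncurry (slabAbs u s t₀)) := by
  have hm : MeasurableSet (Ioo s t₀ ×ˢ (univ : Set E3)) := measurableSet_Ioo.prod MeasurableSet.univ
  have hc : ContinuousOn (fun z : ℝ × E3 => ‖uncurry u z‖ₑ) (Ioo s t₀ ×ˢ univ) :=
    (hu.continuousOn.mono (prod_mono Ioo_subset_Icc_self subset_rfl)).enorm
  have e : uncurry (slabAbs u s t₀) =
      (Ioo s t₀ ×ˢ (univ : Set E3)).piecewise (fun z => ‖uncurry u z‖ₑ) 0 := by
    ext ⟨t, x⟩
    by_cases ht : t ∈ Ioo s t₀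
    · rw [piecewise_eq_of_mem _ _ _ (show (t, x) ∈ Ioo s t₀ ×ˢ (univ : Set E3) from ⟨ht, mem_univ _⟩)]
      exact indicator_of_mem ht (fun t => ‖u t x‖ₑ)
    · rw [piecewise_eq_of_notMem _ _ _
        (show (t, x) ∉ Ioo s t₀ ×ˢ (univ : Set E3) from fun h => ht h.1)]
      exact indicator_of_notMem ht (fun t => ‖u t x‖ₑ)
  rw [e]
  exact hc.measurable_piecewise continuousOn_const hm

lemma mixNorm_eq_mixE {p q : ℝ} (hp : 0 < p) (hq : 0 < q) (u : ℝ → E3 → ℝ) (s t₀ : ℝ) :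
    mixNorm p q (Icc s t₀) u = mixE p q (slabAbs u s t₀) := by
  unfold mixNorm mixE
  congr 1
  rw [← setLIntegral_congr Ioo_ae_eq_Icc, ← lintegral_indicator measurableSet_Ioo]
  refine lintegral_congr fun t => ?_
  by_cases ht : t ∈ Ioo s t₀
  · rw [indicator_of_mem ht]
    have : ∀ x, slabAbs u s t₀ t x = ‖u t x‖ₑ := fun x => indicator_of_mem ht _
    simp_rw [this]
    rfl
  · rw [indicator_of_notMem ht]
    have : ∀ x, slabAbs u s t₀ t x = 0 := fun x => indicator_of_notMem ht _
    simp_rw [this]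
    simp [ENNReal.zero_rpow_of_pos, hp, hq]

lemma coneCut_eq_slabAbs {u : ℝ → E3 → ℝ} {V : ℝ × E3 → ℝ} {s t₀ a T R : ℝ} (ha : s ≤ a)
    (hT : T < t₀) (huV : ∀ τ ∈ Ioc a T, ∀ y, V (τ, y) = u τ y) (t : ℝ) (x : E3)
    (h : a < t ∧ t ≤ T ∧ ‖x‖ + t ≤ R) : coneCut V a T R t x = slabAbs u s t₀ t x := by
  rw [coneCut_of_mem h.1 h.2.1 h.2.2, huV t ⟨h.1, h.2.1⟩]
  exact (indicator_of_mem (show t ∈ Ioo s t₀ from ⟨ha.trans_lt h.1, h.2.1.trans_lt hT⟩)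
    (fun t => ‖u t x‖ₑ)).symm

/-- The `L^{9/4}_t L^{54}_x` bound with data controlled by `e`. -/
lemma exists_mixE_slabAbs_le : ∃ B : ℝ, 0 < B ∧ ∀ (s t₀ E e δ : ℝ), s < t₀ → 0 ≤ δ →
    ∀ u : ℝ → E3 → ℝ, IsNLWOn u (Icc s t₀) → (∀ t ∈ Icc s t₀, energy u t ≤ E) →
    0 < e → (2 * E) ^ (1 / 2 : ℝ) ≤ e → 4 * B ^ 2 * δ ^ 3 * e < 1 →
    mixE 27 (162/25) (slabAbs u s t₀) ≤ ENNReal.ofReal δ →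
    mixE (9/4) 54 (slabAbs u s t₀) ≤ ENNReal.ofReal (2 * B * e) := by
  obtain ⟨B, hB, hboot⟩ := exists_bootstrap
  refine ⟨B, hB, fun s t₀ E e δ hst hδ u hu hE he hEe hsmall hX => ?_⟩
  obtain ⟨η, hηd⟩ : ∃ η : ℕ → ℝ, η = fun n : ℕ => (t₀ - s) / ((n : ℝ) + 3) := ⟨_, rfl⟩
  have hη : ∀ n, 0 < η n := fun n => by
    rw [hηd]; have := sub_pos.2 hst; positivity
  have hη' : ∀ n, 2 * η n < t₀ - s := fun n => by
    rw [hηd]; dsimp only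
    rw [← mul_div_assoc, div_lt_iff₀ (by positivity)]
    have := sub_pos.2 hst
    nlinarith [(Nat.cast_nonneg n : (0:ℝ) ≤ n)]
  have hanti : Antitone η := by
    rw [hηd]; intro m n hmn
    have := sub_pos.2 hst
    have h2 : (m:ℝ) ≤ n := by exact_mod_cast hmn
    dsimp only
    gcongr
  have hη0 : Filter.Tendsto η Filter.atTop (nhds 0) := by
    rw [hηd]
    exact Filter.Tendsto.div_atTop tendsto_const_nhds
      (Filter.tendsto_atTop_add_const_right _ _ tendsto_natCast_atTop_atTop)
  choose V hV huV using fun n => exists_contDiff_eq_of_slab hu.1 (hη n) (hη' n)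
  have hIoc : ∀ n, ∀ τ ∈ Icc (s + η n) (t₀ - η n), τ ∈ Ioo (s + η n / 2) (t₀ - η n / 2) :=
    fun n τ hτ => ⟨by linarith [hτ.1, hη n], by linarith [hτ.2, hη n]⟩
  have heq : ∀ n t x, (s + η n < t ∧ t ≤ t₀ - η n ∧ ‖x‖ + t ≤ (n:ℝ)) →
      coneCut (V n) (s + η n) (t₀ - η n) n t x = slabAbs u s t₀ t x := fun n t x h =>
    coneCut_eq_slabAbs (by linarith [hη n]) (by linarith [hη n])
      (fun τ hτ y => huV n τ (hIoc n τ ⟨hτ.1.le, hτ.2⟩) y) t x h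
  have hle : ∀ n t x, coneCut (V n) (s + η n) (t₀ - η n) n t x ≤ slabAbs u s t₀ t x := by
    intro n t x
    by_cases h : s + η n < t ∧ t ≤ t₀ - η n ∧ ‖x‖ + t ≤ (n:ℝ)
    · exact (heq n t x h).le
    · rw [coneCut_of_not h]; exact zero_le
  refine mixE_le_of_tendsto (V := fun n => coneCut (V n) (s + η n) (t₀ - η n) n) (by norm_num)
    (by norm_num) (fun n => measurable_coneCut (hV n).continuous _ _ _) ?_ ?_ ?_
  · intro t x m n hmn
    dsimp only
    by_cases h : s + η m < t ∧ t ≤ t₀ - η m ∧ ‖x‖ + t ≤ (m:ℝ)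
    · have h2 : (m:ℝ) ≤ n := by exact_mod_cast hmn
      have h3 := hanti hmn
      rw [heq m t x h, heq n t x ⟨by linarith [h.1], by linarith [h.2.1], h.2.2.trans h2⟩]
    · rw [coneCut_of_not h]; exact zero_le
  · intro t x
    by_cases ht : t ∈ Ioo s t₀
    · refine tendsto_const_nhds.congr' ?_
      filter_upwards [hη0.eventually_lt_const (sub_pos.2 ht.1),
        hη0.eventually_lt_const (sub_pos.2 ht.2),
        tendsto_natCast_atTop_atTop.eventually_ge_atTop (‖x‖ + t)] with n h1 h2 h3
      exact (heq n t x ⟨by linarith, by linarith, h3⟩).symm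
    · have h0 : slabAbs u s t₀ t x = 0 := indicator_of_notMem ht _
      rw [h0]
      refine tendsto_const_nhds.congr fun n => ?_
      exact (le_zero_iff.1 (h0 ▸ hle n t x)).symm
  · intro n
    have hmem : s + η n ∈ Ioo (s + η n / 2) (t₀ - η n / 2) :=
      hIoc n _ ⟨le_rfl, by linarith [hη' n]⟩
    have hmemI : s + η n ∈ Icc s t₀ := ⟨by linarith [hη n], by linarith [hη n, hη' n]⟩
    have hS := hu.2.1 _ hmemI
    have hen := integral_sq_le_energy hS.1 hS.2 (hE _ hmemI)
    have hVu : (fun y => V n (s + η n, y)) = u (s + η n) := funext fun y => huV n _ hmem y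
    have hVt : (fun y => ‖fderiv ℝ (V n) (s + η n, y) (1, 0)‖ₑ) =
        fun y => ‖tderiv u (s + η n) y‖ₑ :=
      funext fun y => by rw [tderiv_eq_of_slab (hV n) (huV n) hmem]
    refine hboot (V n) _ _ n e δ (hV n) (by linarith [hη' n]) ?_ ?_ he hδ ?_ ?_ ?_ hsmall
    · rw [hVu]; exact hS.1.tendsto_cocompact
    · intro τ hτ y
      exact boxOp_eq_of_slab (hV n) (huV n) (I := Icc s t₀)
        (fun r hr => ⟨by linarith [hr.1, hη n], by linarith [hr.2, hη n]⟩) hu.2.2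
        (hIoc n τ ⟨hτ.1.le, hτ.2.le⟩) y
    · rw [hVt]
      exact (l2E_enorm_le (hS.2.integrable_norm_pow two_ne_zero) hen.1).trans
        (ENNReal.ofReal_le_ofReal hEe)
    · rw [hVu]
      exact (l2E_enorm_le hS.1.integrable_norm_fderiv_sq hen.2).trans
        (ENNReal.ofReal_le_ofReal hEe)
    · exact (mixE_mono (by norm_num) (by norm_num) (hle n)).trans hX

lemma energy_nonneg (u : ℝ → E3 → ℝ) (t : ℝ) : 0 ≤ energy u t :=
  integral_nonneg fun x => by positivity

/-- The `L^{9/4}_t L^{54}_x` bound in terms of the energy. -/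
lemma exists_mixE_slabAbs_le_energy : ∃ B : ℝ, 0 < B ∧ ∀ (s t₀ E δ : ℝ), s < t₀ → 0 ≤ δ →
    ∀ u : ℝ → E3 → ℝ, IsNLWOn u (Icc s t₀) → (∀ t ∈ Icc s t₀, energy u t ≤ E) →
    16 * B ^ 2 * δ ^ 3 * E ^ (1 / 2 : ℝ) ≤ 1 →
    mixE 27 (162/25) (slabAbs u s t₀) ≤ ENNReal.ofReal δ →
    mixE (9/4) 54 (slabAbs u s t₀) ≤ ENNReal.ofReal (4 * B * E ^ (1 / 2 : ℝ)) := by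
  obtain ⟨B, hB, h⟩ := exists_mixE_slabAbs_le
  refine ⟨B, hB, fun s t₀ E δ hst hδ u hu hE hsmall hX => ?_⟩
  have hE0 : 0 ≤ E := (energy_nonneg u s).trans (hE s ⟨le_rfl, hst.le⟩)
  have hEr : 0 ≤ E ^ (1 / 2 : ℝ) := by positivity
  have h2E : (2 * E) ^ (1 / 2 : ℝ) ≤ 2 * E ^ (1 / 2 : ℝ) := by
    rw [Real.mul_rpow (by norm_num) hE0]
    refine mul_le_mul_of_nonneg_right ?_ hEr
    calc (2:ℝ) ^ (1 / 2 : ℝ) ≤ 2 ^ (1:ℝ) :=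
          Real.rpow_le_rpow_of_exponent_le (by norm_num) (by norm_num)
      _ = 2 := Real.rpow_one 2
  have hlim : Filter.Tendsto (fun e : ℝ => ENNReal.ofReal (2 * B * e))
      (nhdsWithin (2 * E ^ (1 / 2 : ℝ)) (Ioi (2 * E ^ (1 / 2 : ℝ))))
      (nhds (ENNReal.ofReal (2 * B * (2 * E ^ (1 / 2 : ℝ))))) :=
    ((ENNReal.continuous_ofReal.comp (continuous_const.mul continuous_id)).tendsto _).mono_left
      nhdsWithin_le_nhds
  have e1 : 4 * B * E ^ (1 / 2 : ℝ) = 2 * B * (2 * E ^ (1 / 2 : ℝ)) := by ring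
  rw [e1]
  refine ge_of_tendsto hlim ?_
  have hlt : ∀ᶠ e : ℝ in nhdsWithin (2 * E ^ (1 / 2 : ℝ)) (Ioi (2 * E ^ (1 / 2 : ℝ))),
      4 * B ^ 2 * δ ^ 3 * e < 1 := by
    refine Filter.Eventually.filter_mono nhdsWithin_le_nhds ?_
    have hc : Continuous fun e : ℝ => 4 * B ^ 2 * δ ^ 3 * e := by fun_prop
    refine hc.continuousAt.eventually_lt_const ?_
    linarith
  filter_upwards [hlt, self_mem_nhdsWithin] with e h1 h2
  have h3 : 2 * E ^ (1 / 2 : ℝ) < e := h2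
  exact h s t₀ E e δ hst hδ u hu hE (by linarith) (h2E.trans h3.le) h1 hX

/-- The parametrization of the face `x i = ε` of a cube. -/
def cubeFace (i : Fin 3) (ε : ℝ) (p : Fin 2 → ℝ) : E3 :=
  WithLp.toLp 2 (i.insertNth (α := fun _ => ℝ) ε p)

lemma norm_cubeFace_sq (i : Fin 3) (ε : ℝ) (p : Fin 2 → ℝ) :
    ‖cubeFace i ε p‖ ^ 2 = ε ^ 2 + (p 0 ^ 2 + p 1 ^ 2) := by
  rw [EuclideanSpace.real_norm_sq_eq, Fin.sum_univ_succAbove _ i]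
  simp [cubeFace, Fin.sum_univ_two]

lemma cubeFace_sub (i : Fin 3) (ε ε' : ℝ) (p q : Fin 2 → ℝ) :
    cubeFace i ε p - cubeFace i ε' q = cubeFace i (ε - ε') (p - q) := by
  ext j
  revert j
  rw [i.forall_iff_succAbove]
  simp [cubeFace]

lemma smul_cubeFace (i : Fin 3) (c ε : ℝ) (p : Fin 2 → ℝ) :
    c • cubeFace i ε p = cubeFace i (c * ε) (c • p) := by
  ext j
  revert j
  rw [i.forall_iff_succAbove]
  simp [cubeFace]

lemma one_le_norm_cubeFace (i : Fin 3) {ε : ℝ} (hε : ε ^ 2 = 1) (p : Fin 2 → ℝ) :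
    1 ≤ ‖cubeFace i ε p‖ := by
  have := norm_cubeFace_sq i ε p
  nlinarith [norm_nonneg (cubeFace i ε p), sq_nonneg (p 0), sq_nonneg (p 1)]

lemma norm_normalize_sub_le {a b : E3} (ha : 1 ≤ ‖a‖) (hb : 1 ≤ ‖b‖) :
    ‖‖a‖⁻¹ • a - ‖b‖⁻¹ • b‖ ≤ 2 * ‖a - b‖ := by
  have ha0 : 0 < ‖a‖ := by linarith
  have hb0 : 0 < ‖b‖ := by linarith
  have e : ‖a‖⁻¹ • a - ‖b‖⁻¹ • b = ‖a‖⁻¹ • (a - b) + (‖a‖⁻¹ * (‖b‖ - ‖a‖)) • (‖b‖⁻¹ • b) := by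
    rw [smul_sub, smul_smul, sub_add, ← sub_smul]
    congr 2
    field_simp
    ring
  have hi : ‖a‖⁻¹ ≤ 1 := inv_le_one_of_one_le₀ ha
  have hi0 : 0 ≤ ‖a‖⁻¹ := by positivity
  have h1 : ‖‖b‖⁻¹ • b‖ = 1 := by
    rw [norm_smul, norm_inv, norm_norm, inv_mul_cancel₀ hb0.ne']
  have h2 : |‖b‖ - ‖a‖| ≤ ‖a - b‖ := by rw [norm_sub_rev]; exact abs_norm_sub_norm_le b a
  rw [e]
  refine (norm_add_le _ _).trans ?_
  rw [norm_smul, norm_smul, h1, mul_one, norm_mul, norm_inv, norm_norm, Real.norm_eq_abs]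
  nlinarith [norm_nonneg (a - b), abs_nonneg (‖b‖ - ‖a‖)]

/-- The radial projection of a cube face to the unit sphere. -/
def sphereFace (i : Fin 3) (ε : ℝ) (p : Fin 2 → ℝ) : E3 :=
  ‖cubeFace i ε p‖⁻¹ • cubeFace i ε p

lemma lipschitzWith_sphereFace (i : Fin 3) {ε : ℝ} (hε : ε ^ 2 = 1) :
    LipschitzWith 4 (sphereFace i ε) := by
  refine LipschitzWith.of_dist_le_mul fun p q => ?_
  rw [dist_eq_norm, dist_eq_norm]
  refine (norm_normalize_sub_le (one_le_norm_cubeFace i hε p)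
    (one_le_norm_cubeFace i hε q)).trans ?_
  rw [cubeFace_sub, sub_self]
  have h := norm_cubeFace_sq i 0 (p - q)
  have h0 := sq_le_sq' (by linarith [neg_abs_le ((p - q) 0), norm_le_pi_norm (p - q) 0, Real.norm_eq_abs ((p - q) 0)])
    ((le_abs_self _).trans (norm_le_pi_norm (p - q) 0))
  have h1 := sq_le_sq' (by linarith [neg_abs_le ((p - q) 1), norm_le_pi_norm (p - q) 1, Real.norm_eq_abs ((p - q) 1)])
    ((le_abs_self _).trans (norm_le_pi_norm (p - q) 1))
  have h2 : ‖cubeFace i 0 (p - q)‖ ≤ 2 * ‖p - q‖ := by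
    refine abs_le_of_sq_le_sq' ?_ (by positivity) |>.2
    nlinarith [norm_nonneg (p - q)]
  push_cast
  linarith

/-- The unit sphere is covered by the six projected cube faces. -/
lemma exists_sphereFace_eq {ω : E3} (hω : ‖ω‖ = 1) : ∃ i : Fin 3, ∃ ε : ℝ, (ε = 1 ∨ ε = -1) ∧
    ∃ p ∈ Metric.closedBall (0 : Fin 2 → ℝ) 1, sphereFace i ε p = ω := by
  obtain ⟨i, hi⟩ := Finite.exists_max fun i => |ω i|
  have hpos : 0 < |ω i| := by
    by_contra h
    have h0 : ∀ j, ω j = 0 := fun j => abs_nonpos_iff.1 ((hi j).trans (not_lt.1 h))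
    have : ω = 0 := by ext j; exact h0 j
    rw [this, norm_zero] at hω
    exact zero_ne_one hω
  have hc : cubeFace i (ω i / |ω i|) (fun j => ω (i.succAbove j) / |ω i|) = |ω i|⁻¹ • ω := by
    ext j
    revert j
    rw [i.forall_iff_succAbove]
    simp [cubeFace, div_eq_inv_mul]
  refine ⟨i, ω i / |ω i|, ?_, fun j => ω (i.succAbove j) / |ω i|, ?_, ?_⟩
  · rcases abs_cases (ω i) with ⟨h, _⟩ | ⟨h, _⟩
    · left; rw [h]; exact div_self (by rw [← h]; exact hpos.ne')
    · right; rw [h, div_neg, div_self]; intro h2; rw [h2] at hpos; simp at hpos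
  · rw [mem_closedBall_zero_iff, pi_norm_le_iff_of_nonneg zero_le_one]
    intro j
    rw [norm_div, norm_abs_eq_norm, Real.norm_eq_abs, Real.norm_eq_abs, div_le_one hpos]
    exact hi _
  · rw [sphereFace, hc, norm_smul, hω, mul_one, norm_inv, Real.norm_eq_abs, abs_abs, inv_inv,
      smul_smul, mul_inv_cancel₀ hpos.ne', one_smul]

open scoped Pointwise in
/-- The area of a subset of a face is controlled by the volume of the cone over its projection. -/
lemma volume_face_le (i : Fin 3) {ε : ℝ} (hε : ε = 1 ∨ ε = -1) {S : Set (Fin 2 → ℝ)}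
    (hS : MeasurableSet S) (hS1 : S ⊆ Metric.closedBall 0 1) {A : Set E3}
    (hA : ∀ p ∈ S, sphereFace i ε p ∈ A) :
    volume S ≤ 64 * volume (Ioo (0:ℝ) 1 • A) := by
  have hε2 : ε ^ 2 = 1 := by rcases hε with rfl | rfl <;> norm_num
  have hmp : MeasurePreserving (fun z : ℝ × (Fin 2 → ℝ) => cubeFace i z.1 z.2)
      ((volume : Measure ℝ).prod volume) volume :=
    (PiLp.volume_preserving_toLp (Fin 3)).comp
      ((volume_preserving_piFinSuccAbove (fun _ : Fin 3 => ℝ) i).symm _)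
  obtain ⟨J, hJ⟩ : ∃ J : Set ℝ, J = {h | ε * h ∈ Ioo (1/4 : ℝ) (1/2)} := ⟨_, rfl⟩
  have hJm : MeasurableSet J := by
    rw [hJ]; exact (measurable_const.mul measurable_id) measurableSet_Ioo
  have hJv : volume J = ENNReal.ofReal (1/4) := by
    rcases hε with rfl | rfl
    · have : J = Ioo (1/4) (1/2) := by rw [hJ]; ext h; simp
      rw [this, Real.volume_Ioo]; norm_num
    · have : J = Ioo (-(1/2)) (-(1/4)) := by
        rw [hJ]; ext h; simp only [mem_ofPred_eq, mem_Ioo]; constructor <;> rintro ⟨h1, h2⟩ <;>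
        constructor <;> linarith
      rw [this, Real.volume_Ioo]; norm_num
  have hsub : {z : ℝ × (Fin 2 → ℝ) | z.1 ∈ J ∧ (ε * z.1)⁻¹ • z.2 ∈ S} ⊆
      (fun z : ℝ × (Fin 2 → ℝ) => cubeFace i z.1 z.2) ⁻¹' (Ioo (0:ℝ) 1 • A) := by
    rintro ⟨h, q⟩ ⟨h1, h2⟩
    rw [hJ] at h1
    obtain ⟨h3, h4⟩ : 1/4 < ε * h ∧ ε * h < 1/2 := h1
    dsimp only at h2
    have hp := hS1 h2
    rw [mem_closedBall_zero_iff] at hp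
    have hpi := norm_cubeFace_sq i ε ((ε * h)⁻¹ • q)
    have hge := one_le_norm_cubeFace i hε2 ((ε * h)⁻¹ • q)
    have k0 := (norm_le_pi_norm ((ε * h)⁻¹ • q) 0).trans hp
    have k1 := (norm_le_pi_norm ((ε * h)⁻¹ • q) 1).trans hp
    have l0 := (sq_le_one_iff_abs_le_one _).2 k0
    have l1 := (sq_le_one_iff_abs_le_one _).2 k1
    have hlt : ‖cubeFace i ε ((ε * h)⁻¹ • q)‖ < 2 := by nlinarith
    refine Set.mem_smul.2 ⟨ε * h * ‖cubeFace i ε ((ε * h)⁻¹ • q)‖, ⟨by positivity, by nlinarith⟩, _,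
      hA _ h2, ?_⟩
    have hne : ‖cubeFace i ε ((ε * h)⁻¹ • q)‖ ≠ 0 := by linarith
    have hne2 : ε * h ≠ 0 := by linarith
    rw [sphereFace, smul_smul, mul_assoc, mul_inv_cancel₀ hne, mul_one, smul_cubeFace, smul_smul,
      mul_inv_cancel₀ hne2, one_smul]
    congr 1
    linear_combination h * hε2
  have hTm : MeasurableSet {z : ℝ × (Fin 2 → ℝ) | z.1 ∈ J ∧ (ε * z.1)⁻¹ • z.2 ∈ S} := by
    have : Measurable fun z : ℝ × (Fin 2 → ℝ) => (ε * z.1)⁻¹ • z.2 := by fun_prop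
    exact (measurable_fst hJm).inter (this hS)
  have hT : ENNReal.ofReal (1/4) * (ENNReal.ofReal (1/16) * volume S) ≤
      volume (Ioo (0:ℝ) 1 • A) := by
    have h1 : ENNReal.ofReal (1/4) * (ENNReal.ofReal (1/16) * volume S) ≤
        ((volume : Measure ℝ).prod volume)
          {z : ℝ × (Fin 2 → ℝ) | z.1 ∈ J ∧ (ε * z.1)⁻¹ • z.2 ∈ S} := by
      rw [Measure.prod_apply hTm]
      refine le_trans ?_ (setLIntegral_le_lintegral J _)
      rw [mul_comm, ← hJv, ← setLIntegral_const]
      refine setLIntegral_mono' hJm fun h hh => ?_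
      have e : Prod.mk h ⁻¹' {z : ℝ × (Fin 2 → ℝ) | z.1 ∈ J ∧ (ε * z.1)⁻¹ • z.2 ∈ S} =
          (fun q => (ε * h)⁻¹ • q) ⁻¹' S := by
        ext q; simp [hh]
      rw [hJ] at hh
      obtain ⟨h3, h4⟩ : 1/4 < ε * h ∧ ε * h < 1/2 := hh
      rw [e, Measure.addHaar_preimage_smul _ (by positivity)]
      refine mul_le_mul_left (ENNReal.ofReal_le_ofReal ?_) _
      simp only [Module.finrank_fintype_fun_eq_card, Fintype.card_fin, inv_pow, inv_inv]
      rw [abs_of_nonneg (by positivity)]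
      nlinarith
    refine h1.trans ((measure_mono hsub).trans ?_)
    exact hmp.measure_preimage_le _
  calc volume S = 64 * (ENNReal.ofReal (1/4) * (ENNReal.ofReal (1/16) * volume S)) := by
        rw [← mul_assoc, ← mul_assoc, ← ENNReal.ofReal_ofNat 64,
          ← ENNReal.ofReal_mul (by norm_num), ← ENNReal.ofReal_mul (by norm_num)]
        norm_num
    _ ≤ _ := mul_le_mul_right hT _

open scoped Pointwise in
/-- Surface measure on the unit sphere is bounded by a multiple of the cone measure. -/
lemma hausdorffMeasure_image_sphere_le {A : Set (Metric.sphere (0 : E3) 1)} (hA : MeasurableSet A) :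
    μH[2] ((↑) '' A : Set E3) ≤ 6144 * sphMeas A := by
  obtain ⟨A', hA'⟩ : ∃ A' : Set E3, A' = (↑) '' A := ⟨_, rfl⟩
  have hA'm : MeasurableSet A' := by
    rw [hA']; exact (MeasurableEmbedding.subtype_coe Metric.isClosed_sphere.measurableSet).measurableSet_image.2 hA
  have hface : ∀ (i : Fin 3) (ε : ℝ), (ε = 1 ∨ ε = -1) →
      μH[2] (sphereFace i ε '' (Metric.closedBall 0 1 ∩ sphereFace i ε ⁻¹' A')) ≤
        1024 * sphMeas A := by
    intro i ε hε
    have hε2 : ε ^ 2 = 1 := by rcases hε with rfl | rfl <;> norm_num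
    have hS : MeasurableSet (Metric.closedBall 0 1 ∩ sphereFace i ε ⁻¹' A') :=
      Metric.isClosed_closedBall.measurableSet.inter
        ((lipschitzWith_sphereFace i hε2).continuous.measurable hA'm)
    have h1 := (lipschitzWith_sphereFace i hε2).hausdorffMeasure_image_le (d := 2) (by norm_num)
      (Metric.closedBall 0 1 ∩ sphereFace i ε ⁻¹' A')
    have h2 : (μH[2] : Measure (Fin 2 → ℝ)) = volume := by
      have := hausdorffMeasure_pi_real (ι := Fin 2)
      rw [Fintype.card_fin] at this
      exact_mod_cast this
    rw [h2] at h1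
    have h3 := volume_face_le i hε hS inter_subset_left (A := A') fun p hp => hp.2
    have h4 : sphMeas A = 3 * volume (Ioo (0:ℝ) 1 • A') := by
      rw [sphMeas, Measure.toSphere_apply' _ hA, finrank_E3, hA']; norm_num
    rw [h4]
    calc _ ≤ _ := h1
      _ ≤ (16:ℝ≥0∞) * (64 * volume (Ioo (0:ℝ) 1 • A')) := by
        refine mul_le_mul' (le_of_eq ?_) h3
        rw [ENNReal.rpow_two]; norm_num
      _ = 1024 * volume (Ioo (0:ℝ) 1 • A') := by rw [← mul_assoc]; norm_num
      _ ≤ _ := by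
        refine mul_le_mul_right ?_ _
        exact le_mul_of_one_le_left' (by norm_num)
  have hcov : A' ⊆ ⋃ i : Fin 3,
      (sphereFace i 1 '' (Metric.closedBall 0 1 ∩ sphereFace i 1 ⁻¹' A')) ∪
      (sphereFace i (-1) '' (Metric.closedBall 0 1 ∩ sphereFace i (-1) ⁻¹' A')) := by
    intro ω hω
    have hn : ‖ω‖ = 1 := by
      rw [hA'] at hω
      obtain ⟨ω', _, rfl⟩ := hω
      exact norm_eq_of_mem_sphere ω'
    obtain ⟨i, ε, hε, p, hp, rfl⟩ := exists_sphereFace_eq hn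
    refine mem_iUnion.2 ⟨i, ?_⟩
    rcases hε with rfl | rfl
    · exact Or.inl ⟨p, ⟨hp, hω⟩, rfl⟩
    · exact Or.inr ⟨p, ⟨hp, hω⟩, rfl⟩
  rw [← hA']
  calc μH[2] A' ≤ _ := measure_mono hcov
    _ ≤ ∑ i : Fin 3, _ := measure_iUnion_fintype_le _ _
    _ ≤ ∑ i : Fin 3, (1024 * sphMeas A + 1024 * sphMeas A) :=
      Finset.sum_le_sum fun i _ => (measure_union_le _ _).trans
        (add_le_add (hface i 1 (Or.inl rfl)) (hface i (-1) (Or.inr rfl)))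
    _ = 6144 * sphMeas A := by
      rw [Finset.sum_const, Finset.card_univ, Fintype.card_fin, ← add_mul, nsmul_eq_mul, ← mul_assoc]
      norm_num

/-- Surface integrals are bounded by integrals over the unit sphere against the cone measure. -/
lemma setLIntegral_sphere_le (x : E3) {r : ℝ} (hr : 0 < r) {f : E3 → ℝ≥0∞} (hf : Measurable f) :
    ∫⁻ y in Metric.sphere x r, f y ∂(μH[2]) ≤
      6144 * (ENNReal.ofReal (r ^ 2) * ∫⁻ ω, f (x + r • (ω : E3)) ∂sphMeas) := by
  have hg : Measurable fun ω : Metric.sphere (0 : E3) 1 => x + r • (ω : E3) := by fun_prop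
  have hm : (μH[2] : Measure E3).restrict (Metric.sphere x r) ≤
      (6144 * ENNReal.ofReal (r ^ 2)) • 
        sphMeas.map (fun ω : Metric.sphere (0 : E3) 1 => x + r • (ω : E3)) := by
    refine Measure.le_iff.2 fun B hB => ?_
    rw [Measure.restrict_apply hB, Measure.smul_apply, Measure.map_apply hg hB, smul_eq_mul]
    have hL : LipschitzWith (Real.toNNReal r) fun y : E3 => x + r • y := by
      refine LipschitzWith.of_dist_le_mul fun y z => ?_
      rw [dist_add_left, dist_smul₀, Real.norm_of_nonneg hr.le, Real.coe_toNNReal _ hr.le]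
    have hsub : B ∩ Metric.sphere x r ⊆ (fun y : E3 => x + r • y) ''
        ((↑) '' ((fun ω : Metric.sphere (0 : E3) 1 => x + r • (ω : E3)) ⁻¹' B)) := by
      rintro y ⟨hyB, hy⟩
      rw [mem_sphere_iff_norm] at hy
      have he : x + r • (r⁻¹ • (y - x)) = y := by
        rw [smul_smul, mul_inv_cancel₀ hr.ne', one_smul]; abel
      refine ⟨r⁻¹ • (y - x), ⟨⟨r⁻¹ • (y - x), ?_⟩, ?_, rfl⟩, he⟩
      · rw [mem_sphere_zero_iff_norm, norm_smul, hy, norm_inv, Real.norm_of_nonneg hr.le,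
          inv_mul_cancel₀ hr.ne']
      · rw [mem_preimage]; dsimp only; rwa [he]
    refine (measure_mono hsub).trans ((hL.hausdorffMeasure_image_le (by norm_num) _).trans ?_)
    rw [mul_comm (6144 : ℝ≥0∞), mul_assoc]
    refine mul_le_mul' (le_of_eq ?_) (hausdorffMeasure_image_sphere_le (hg hB))
    rw [ENNReal.rpow_two, ENNReal.ofReal_pow hr.le]; rfl
  refine (lintegral_mono' hm le_rfl).trans ?_
  rw [lintegral_smul_measure, lintegral_map hf hg, smul_eq_mul, mul_assoc]

/-- The Duhamel integral is bounded by integrals of spherical means of `|u|⁵`. -/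
lemma enorm_duh_le {u : ℝ → E3 → ℝ} {s t₀ t : ℝ} (hst : s ≤ t₀) (ht : t₀ ≤ t)
    (hu : ContDiffOn ℝ (⊤ : ℕ∞) (uncurry u) (Icc s t₀ ×ˢ univ)) (x : E3) :
    ‖duh u s t₀ t x‖ₑ ≤
      6144 * ∫⁻ τ in univ, sphMean (fun y => slabAbs u s t₀ τ y ^ (5:ℝ)) (t - τ) x := by
  rw [duh, intervalIntegral.integral_of_le hst]
  refine (enorm_integral_le_lintegral_enorm _).trans ?_
  rw [setLIntegral_congr Ioo_ae_eq_Ioc.symm, setLIntegral_univ]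
  refine le_trans ?_ (mul_le_mul_right (setLIntegral_le_lintegral (Ioo s t₀) _) _)
  rw [← lintegral_const_mul' _ _ (by norm_num)]
  refine setLIntegral_mono' measurableSet_Ioo fun τ hτ => ?_
  have hr : 0 < t - τ := by linarith [hτ.2]
  have hcont : Continuous (u τ) := by
    have h1 : ContinuousOn (fun y => uncurry u (τ, y)) univ :=
      hu.continuousOn.comp (by fun_prop) fun y _ => ⟨Ioo_subset_Icc_self hτ, mem_univ _⟩
    exact continuousOn_univ.1 h1
  have hm : Measurable fun y => ‖u τ y ^ 5‖ₑ := (hcont.pow 5).enorm.measurable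
  have h1 : ‖sphInt x (t - τ) fun y => u τ y ^ 5‖ₑ ≤ _ :=
    (enorm_integral_le_lintegral_enorm _).trans (setLIntegral_sphere_le x hr hm)
  have hsl : ∀ y, slabAbs u s t₀ τ y ^ (5:ℝ) = ‖u τ y ^ 5‖ₑ := fun y => by
    have : slabAbs u s t₀ τ y = ‖u τ y‖ₑ := indicator_of_mem hτ (fun t => ‖u t y‖ₑ)
    rw [this, enorm_pow]
    exact_mod_cast ENNReal.rpow_natCast _ 5
  unfold sphMean
  simp_rw [hsl]
  rw [enorm_mul, Real.enorm_of_nonneg (by positivity)]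
  refine (mul_le_mul_right h1 _).trans ?_
  rw [mul_left_comm]
  refine mul_le_mul_right ?_ _
  rw [← mul_assoc]
  refine mul_le_mul_left ?_ _
  rw [← ENNReal.ofReal_mul (by positivity)]
  refine ENNReal.ofReal_le_ofReal ?_
  have e : 1 / (4 * π * (t - τ)) * (t - τ) ^ 2 = (t - τ) * (1 / (4 * π)) := by
    field_simp
  rw [e]
  refine mul_le_of_le_one_right hr.le ?_
  rw [div_le_one (by positivity)]
  linarith [Real.pi_gt_three]

/-- The `L⁸` bound for the Duhamel integral to the future of the slab. -/
lemma exists_mixNorm_duh_le : ∃ K : ℝ, 0 ≤ K ∧ ∀ (s t₀ : ℝ), s ≤ t₀ → ∀ u : ℝ → E3 → ℝ,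
    ContDiffOn ℝ (⊤ : ℕ∞) (uncurry u) (Icc s t₀ ×ˢ univ) →
    mixNorm 8 8 (Ici t₀) (fun t x => duh u s t₀ t x) ≤ ENNReal.ofReal K *
      (mixE 27 (162/25) (slabAbs u s t₀) ^ 3 * mixE (9/4) 54 (slabAbs u s t₀) ^ 2) := by
  obtain ⟨C, hC, hS⟩ := exists_lintegral_sphMean_mul_le (q := 8) (r := 8) (by norm_num)
    (by norm_num) (by norm_num)
  refine ⟨(6144 * C).toReal, ENNReal.toReal_nonneg, fun s t₀ hst u hu => ?_⟩
  rw [ENNReal.ofReal_toReal (ENNReal.mul_ne_top (by norm_num) hC)]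
  have hW := measurable_slabAbs hu
  have hF : Measurable (uncurry fun τ y => slabAbs u s t₀ τ y ^ (5:ℝ)) := hW.pow_const (5:ℝ)
  obtain ⟨D, hD⟩ : ∃ D : ℝ → E3 → ℝ≥0∞, D = fun t x =>
    6144 * ∫⁻ τ in univ, sphMean (fun y => slabAbs u s t₀ τ y ^ (5:ℝ)) (t - τ) x := ⟨_, rfl⟩
  have hDm : Measurable (uncurry D) := by
    rw [hD]
    exact ((measurable_sphMean_joint hF).lintegral_prod_right').const_mul _
  have h0 : ∀ t x, sphMean (fun _ => 0) t x = 0 := fun t x => by simp [sphMean]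
  have h1 : mixE 8 8 D ≤ (6144⁻¹)⁻¹ * (C * l2E (fun _ => 0) + C * l2E (fun _ => 0) +
      C * ENNReal.ofReal 8 * l2E (fun _ => 0) +
      C * ∫⁻ τ in univ, l2E (fun y => slabAbs u s t₀ τ y ^ (5:ℝ))) := by
    refine DualStrichartz.mixE_le (q := 8) (r := 8) (κ := 6144⁻¹) (by norm_num) (by norm_num) hC
      (by norm_num) (by norm_num) hS (a := 0) measurable_const measurable_const hF hDm fun t x => ?_
    rw [hD]
    dsimp only
    rw [← mul_assoc, ENNReal.inv_mul_cancel (by norm_num) (by norm_num), one_mul]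
    exact le_add_self
  have h2 : l2E (fun _ => 0) = 0 := by simp [l2E]
  rw [h2, inv_inv, setLIntegral_univ] at h1
  simp only [mul_zero, zero_add] at h1
  refine le_trans ?_ (h1.trans ?_)
  · unfold mixNorm mixE
    refine ENNReal.rpow_le_rpow (le_trans ?_ (setLIntegral_le_lintegral (Ici t₀) _)) (by norm_num)
    refine setLIntegral_mono' measurableSet_Ici fun t ht => ENNReal.rpow_le_rpow
      (ENNReal.rpow_le_rpow (lintegral_mono fun x => ENNReal.rpow_le_rpow ?_ (by norm_num))
        (by norm_num)) (by norm_num)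
    rw [hD]
    exact enorm_duh_le hst ht hu x
  · rw [← mul_assoc]
    exact mul_le_mul_right (lintegral_l2E_rpow_five_le hW) _

/-- if `‖u‖_{L²⁷_t L^{162/25}_x([s,t₀]×ℝ³)} ≤ δ` with `C δ³ E^{1/2} ≤ 1` then
`‖u‖_{L^{9/4}_t L⁵⁴_x} ≤ C E^{1/2}` and `‖D_{[s,t₀]}u‖_{L⁸_{t,x}([t₀,∞)×ℝ³)} ≤ C δ³ E`. -/
theorem stmt18 :
    ∃ C : ℝ, 0 < C ∧ ∀ (s t₀ E δ : ℝ), 0 ≤ s → s < t₀ → 0 < δ →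
      ∀ u : ℝ → E3 → ℝ, IsNLWOn u (Icc s t₀) → (∀ t ∈ Icc s t₀, energy u t ≤ E) →
      C * δ ^ 3 * E ^ ((1:ℝ)/2) ≤ 1 →
      mixNorm 27 (162/25) (Icc s t₀) u ≤ ENNReal.ofReal δ →
      mixNorm (9/4) 54 (Icc s t₀) u ≤ ENNReal.ofReal (C * E ^ ((1:ℝ)/2)) ∧
      mixNorm 8 8 (Ici t₀) (fun t x => duh u s t₀ t x) ≤ ENNReal.ofReal (C * δ ^ 3 * E) := by
  obtain ⟨B, hB, hmain⟩ := exists_mixE_slabAbs_le_energy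
  obtain ⟨K, hK, hduh⟩ := exists_mixNorm_duh_le
  refine ⟨16 * B ^ 2 + 4 * B + K * (16 * B ^ 2), by positivity, ?_⟩
  intro s t₀ E δ _ hst hδ u hu hE hsmall hX
  have hE0 : 0 ≤ E := (energy_nonneg u s).trans (hE s ⟨le_rfl, hst.le⟩)
  have hEr : 0 ≤ E ^ ((1:ℝ)/2) := by positivity
  have hEsq : (E ^ ((1:ℝ)/2)) ^ 2 = E := by
    rw [← Real.rpow_natCast, ← Real.rpow_mul hE0]; norm_num
  rw [mixNorm_eq_mixE (by norm_num) (by norm_num)] at hX ⊢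
  have hY := hmain s t₀ E δ hst hδ.le u hu hE ?_ hX
  · refine ⟨hY.trans (ENNReal.ofReal_le_ofReal ?_), ?_⟩
    · refine mul_le_mul_of_nonneg_right ?_ hEr
      have : 0 ≤ 16 * B ^ 2 + K * (16 * B ^ 2) := by positivity
      linarith
    · refine (hduh s t₀ hst.le u hu.1).trans ?_
      have h1 := mul_le_mul' (pow_le_pow_left' hX 3) (pow_le_pow_left' hY 2)
      refine (mul_le_mul_right h1 _).trans ?_
      rw [← ENNReal.ofReal_pow hδ.le, ← ENNReal.ofReal_pow (by positivity),
        ← ENNReal.ofReal_mul (by positivity), ← ENNReal.ofReal_mul hK]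
      refine ENNReal.ofReal_le_ofReal ?_
      have e : K * (δ ^ 3 * (4 * B * E ^ ((1:ℝ)/2)) ^ 2) = K * (16 * B ^ 2) * (δ ^ 3 * E) := by
        rw [mul_pow, hEsq]; ring
      rw [e, mul_assoc _ (δ ^ 3) E]
      refine mul_le_mul_of_nonneg_right ?_ (by positivity)
      have : 0 ≤ 16 * B ^ 2 + 4 * B := by positivity
      linarith
  · refine le_trans ?_ hsmall
    refine mul_le_mul_of_nonneg_right (mul_le_mul_of_nonneg_right ?_ (by positivity)) hEr
    have : 0 ≤ 4 * B + K * (16 * B ^ 2) := by positivity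
    linarith

end
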